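/- Let ψ be the (σ,λ)-GFF on V_N and for ρ ∈ (0,1] let f_{N,ρ}^ψ(β) = (1/log N²) log Σ_{v∈A_{N,ρ}} e^{βψ_v} for β > 0. Then for all ρ ∈ (0,1], as N → ∞, f_{N,ρ}^ψ(β) converges to f^ψ(β), both in probability and in L^p for every 1 ≤ p < ∞. -/

import Mathlib

open Filter
open scoped Classical

noncomputable section GFFCommon

/-- Vertices of `ℤ²`. -/
abbrev Vtx : Type := ℤ × ℤ

/-- Sample space: a real-valued field indexed by the vertices of `ℤ²`. -/
abbrev FieldSp : Type := Vtx → ℝ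

/-- The box `V_N = {0,1,…,N}²`. -/
def VN (N : ℕ) : Finset Vtx := Finset.Icc (0, 0) ((N : ℤ), (N : ℤ))

/-- The boundary `∂B` of a finite box `B ⊆ ℤ²`:
vertices of `B` having a (Euclidean distance 1) neighbour outside `B`. -/
def bdry (B : Finset Vtx) : Finset Vtx :=
  B.filter fun v =>
    ¬((v.1 + 1, v.2) ∈ B ∧ (v.1 - 1, v.2) ∈ B ∧ (v.1, v.2 + 1) ∈ B ∧ (v.1, v.2 - 1) ∈ B)

/-- The interior `B° = B ∖ ∂B`. -/
def intr (B : Finset Vtx) : Finset Vtx := B \ bdry B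

/-- The neighbourhood `[v]_λ` of `v` in `V_N`. -/
def nbhd (N : ℕ) (lam : ℝ) (v : Vtx) : Finset Vtx :=
  if lam = 0 then VN N
  else if lam = 1 then {v}
  else (VN N).filter fun w =>
    |(w.1 : ℝ) - (v.1 : ℝ)| ≤ (N : ℝ) ^ ((1 : ℝ) - lam) / 2 ∧
    |(w.2 : ℝ) - (v.2 : ℝ)| ≤ (N : ℝ) ^ ((1 : ℝ) - lam) / 2

/-- The σ-algebra `F_{∂[v]_λ ∪ [v]_λ^c}`, generated by the field variables on the
boundary of `[v]_λ` and those outside of it. -/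
def scaleAlg (N : ℕ) (lam : ℝ) (v : Vtx) : MeasurableSpace FieldSp :=
  ⨆ w ∈ {w : Vtx | w ∈ VN N ∧ w ∉ intr (nbhd N lam v)},
    MeasurableSpace.comap (fun ω : FieldSp => ω w) inferInstance

/-- `G` is the Green function of simple random walk killed on `∂B`, normalized by `π/2`:
it vanishes unless both arguments are in `B°`, and in `B°` it satisfies the
first-step (discrete Poisson equation) characterization
`G(x,y) = (1/4)·Σ_{x'∼x} G(x',y) + (π/2)·1_{x=y}`. -/
def IsGreenFn (B : Finset Vtx) (G : Vtx → Vtx → ℝ) : Prop :=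
  (∀ x y : Vtx, x ∉ intr B ∨ y ∉ intr B → G x y = 0) ∧
  ∀ y ∈ intr B, ∀ x ∈ intr B,
    G x y = (G (x.1 + 1, x.2) y + G (x.1 - 1, x.2) y
        + G (x.1, x.2 + 1) y + G (x.1, x.2 - 1) y) / 4
      + (Real.pi / 2) * (if x = y then 1 else 0)

/-- `P` is the law (on the canonical space `FieldSp`) of the Gaussian free field on `V_N`:
a centered Gaussian field with covariance the Green function `G_{V_N}`. -/
def IsGFF (N : ℕ) (P : MeasureTheory.Measure FieldSp) : Prop :=
  MeasureTheory.IsProbabilityMeasure P ∧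
  ∃ G : Vtx → Vtx → ℝ, IsGreenFn (VN N) G ∧
    ∀ c : Vtx → ℝ,
      P.map (fun ω => ∑ v ∈ VN N, c v * ω v) =
        ProbabilityTheory.gaussianReal 0 (Real.toNNReal (∑ v ∈ VN N, ∑ w ∈ VN N, c v * c w * G v w))

open MeasureTheory in
/-- `φ_v(λ) = E[φ_v | F_{∂[v]_λ ∪ [v]_λ^c}]`. -/
def phiScale (N : ℕ) (P : MeasureTheory.Measure FieldSp) (v : Vtx) (lam : ℝ) : FieldSp → ℝ :=
  P[fun ω : FieldSp => ω v | scaleAlg N lam v]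

/-- Admissible parameters `(σ,λ)`: `σ_1,…,σ_M > 0` and `0 = λ_0 < λ_1 < … < λ_M = 1`. -/
def ScaleParams (M : ℕ) (sigv lamv : ℕ → ℝ) : Prop :=
  1 ≤ M ∧ (∀ i ∈ Finset.Icc 1 M, 0 < sigv i) ∧
  lamv 0 = 0 ∧ lamv M = 1 ∧ ∀ i, i < M → lamv i < lamv (i + 1)

/-- The `(σ,λ)`-GFF: `ψ_v = Σ_{i=1}^M σ_i (φ_v(λ_i) − φ_v(λ_{i−1}))`. -/
def psiFld (N M : ℕ) (sigv lamv : ℕ → ℝ) (P : MeasureTheory.Measure FieldSp) (v : Vtx) : FieldSp → ℝ :=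
  fun ω => ∑ i ∈ Finset.Icc 1 M, sigv i * (phiScale N P v (lamv i) ω - phiScale N P v (lamv (i - 1)) ω)

open MeasureTheory in
/-- `ψ_v(λ) = E[ψ_v | F_{∂[v]_λ ∪ [v]_λ^c}]`. -/
def psiScale (N M : ℕ) (sigv lamv : ℕ → ℝ) (P : MeasureTheory.Measure FieldSp) (v : Vtx) (lam : ℝ) :
    FieldSp → ℝ :=
  P[psiFld N M sigv lamv P v | scaleAlg N lam v]

/-- The increment `ψ_v(λ,λ') = ψ_v(λ') − ψ_v(λ)`. -/
def psiInc (N M : ℕ) (sigv lamv : ℕ → ℝ) (P : MeasureTheory.Measure FieldSp) (v : Vtx) (lam lam' : ℝ) :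
    FieldSp → ℝ :=
  fun ω => psiScale N M sigv lamv P v lam' ω - psiScale N M sigv lamv P v lam ω

/-- The step function `σ(s) = σ_1 1_{{0}}(s) + Σ_{i=1}^M σ_i 1_{(λ_{i−1},λ_i]}(s)`. -/
def stepFn (M : ℕ) (sigv lamv : ℕ → ℝ) (s : ℝ) : ℝ :=
  (if s = 0 then sigv 1 else 0) +
  ∑ i ∈ Finset.Icc 1 M, if lamv (i - 1) < s ∧ s ≤ lamv i then sigv i else 0

/-- `𝒥_f(s) = ∫_0^s f(r) dr`. -/
def Jint (f : ℝ → ℝ) (s : ℝ) : ℝ := ∫ r in (0:ℝ)..s, f r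

/-- `𝒥_f(s₁,s₂) = ∫_{s₁}^{s₂} f(r) dr`. -/
def Jint2 (f : ℝ → ℝ) (s₁ s₂ : ℝ) : ℝ := ∫ r in s₁..s₂, f r

/-- The speed function `𝒥_{σ²}`. -/
def Jsig2 (M : ℕ) (sigv lamv : ℕ → ℝ) (s : ℝ) : ℝ := Jint (fun r => (stepFn M sigv lamv r) ^ 2) s

/-- The normalized speed function `𝒥̄_{σ²} = 𝒥_{σ²}/𝒥_{σ²}(1)`. -/
def JsigBar (M : ℕ) (sigv lamv : ℕ → ℝ) (s : ℝ) : ℝ := Jsig2 M sigv lamv s / Jsig2 M sigv lamv 1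

/-- The concave hull on `[0,1]` of a function `f`, i.e. the pointwise infimum over all
concave functions dominating `f` on `[0,1]`. -/
def concaveHull (f : ℝ → ℝ) (s : ℝ) : ℝ :=
  sInf {y | ∃ g : ℝ → ℝ, ConcaveOn ℝ (Set.Icc (0:ℝ) 1) g ∧
    (∀ t ∈ Set.Icc (0:ℝ) 1, f t ≤ g t) ∧ y = g s}

/-- The effective parameters: jump scales `0 = λ⁰ < … < λ^m = 1`, values
`σ̄_1 > … > σ̄_m > 0`, and the left-continuous non-increasing step function `σ̄`
such that `∫_0^s σ̄²` is the concavification of `𝒥_{σ²}`. -/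
def EffParams (M : ℕ) (sigv lamv : ℕ → ℝ) (m : ℕ) (sigb lamb : ℕ → ℝ) (sigbar : ℝ → ℝ) : Prop :=
  1 ≤ m ∧ m ≤ M ∧ lamb 0 = 0 ∧ lamb m = 1 ∧ (∀ j, j < m → lamb j < lamb (j + 1)) ∧
  (∀ l, 1 ≤ l → l < m → sigb (l + 1) < sigb l) ∧ (∀ l ∈ Finset.Icc 1 m, 0 < sigb l) ∧
  sigbar 0 = sigb 1 ∧
  (∀ l ∈ Finset.Icc 1 m, ∀ s : ℝ, lamb (l - 1) < s → s ≤ lamb l → sigbar s = sigb l) ∧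
  (∀ s : ℝ, 0 < s → s ≤ 1 →
    concaveHull (Jsig2 M sigv lamv) s = ∫ r in (0:ℝ)..s, (sigbar r) ^ 2)

/-- `γ* = 𝒥_{σ²/σ̄}(1)`. -/
def gammaStar (M : ℕ) (sigv lamv : ℕ → ℝ) (sigbar : ℝ → ℝ) : ℝ :=
  ∫ s in (0:ℝ)..1, (stepFn M sigv lamv s) ^ 2 / sigbar s

/-- The critical levels `γ^l = ∫_0^1 σ²(s)/σ̄(s ∧ λ^l) ds`, `γ⁰ = 0`. -/
def gammaL (M : ℕ) (sigv lamv : ℕ → ℝ) (lamb : ℕ → ℝ) (sigbar : ℝ → ℝ) (l : ℕ) : ℝ :=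
  if l = 0 then 0 else ∫ s in (0:ℝ)..1, (stepFn M sigv lamv s) ^ 2 / sigbar (min s (lamb l))

/-- `EntE` is the entropy function `𝓔` of the model. -/
def IsEntropy (M : ℕ) (sigv lamv : ℕ → ℝ) (m : ℕ) (lamb : ℕ → ℝ) (sigbar : ℝ → ℝ)
    (EntE : ℝ → ℝ) : Prop :=
  EntE 0 = 1 ∧
  ∀ l ∈ Finset.Icc 1 m, ∀ γ : ℝ,
    gammaL M sigv lamv lamb sigbar (l - 1) < γ → γ ≤ gammaL M sigv lamv lamb sigbar l →
      EntE γ = (1 - lamb (l - 1)) -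
        (γ - ∫ s in (0:ℝ)..(lamb (l - 1)), (stepFn M sigv lamv s) ^ 2 / sigbar s) ^ 2 /
          Jint2 (fun r => (stepFn M sigv lamv r) ^ 2) (lamb (l - 1)) 1

/-- The limiting free energy of the `REM(σ)` model. -/
def fREM (σ β : ℝ) : ℝ :=
  if (2 / σ) < β then 2 * (β / (2 / σ)) else 1 + (β / (2 / σ)) ^ 2

/-- The index `l_β`. -/
def lbeta (m : ℕ) (sigb : ℕ → ℝ) (β : ℝ) : ℕ :=
  if β ≤ 2 / sigb m then sInf {l : ℕ | 1 ≤ l ∧ β ≤ 2 / sigb l} else m + 1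

/-- The limiting free energy `f^ψ(β)`, written with the `l_β` split. -/
def fpsiLim (m : ℕ) (sigb lamb : ℕ → ℝ) (β : ℝ) : ℝ :=
  (∑ j ∈ Finset.Icc 1 (lbeta m sigb β - 1), (2 * β / (2 / sigb j)) * (lamb j - lamb (j - 1))) +
  ∑ j ∈ Finset.Icc (lbeta m sigb β) m, (1 + β ^ 2 / (2 / sigb j) ^ 2) * (lamb j - lamb (j - 1))

/-- The set `ℬ` of non-critical inverse temperatures. -/
def critSet (m : ℕ) (sigb : ℕ → ℝ) : Set ℝ :=
  {β | 0 < β ∧ ∀ j ∈ Finset.Icc 1 m, β ≠ 2 / sigb j}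

/-- The partition function `Z_N^ψ(β)`. -/
def ZN (N M : ℕ) (sigv lamv : ℕ → ℝ) (P : MeasureTheory.Measure FieldSp) (β : ℝ) (ω : FieldSp) : ℝ :=
  ∑ v ∈ VN N, Real.exp (β * psiFld N M sigv lamv P v ω)

/-- The free energy `f_N^ψ(β)` on `V_N`. -/
def freeEnergy (N M : ℕ) (sigv lamv : ℕ → ℝ) (P : MeasureTheory.Measure FieldSp) (β : ℝ) (ω : FieldSp) : ℝ :=
  (Real.log ((N : ℝ) ^ 2))⁻¹ * Real.log (ZN N M sigv lamv P β ω)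

/-- The set `A_{N,ρ}` of points at distance at least `N^{1−ρ}` from `ℤ² ∖ V_N`. -/
def AN (N : ℕ) (ρ : ℝ) : Finset Vtx :=
  (VN N).filter fun v => ∀ z : Vtx, z ∉ VN N →
    (N : ℝ) ^ ((1 : ℝ) - ρ) ≤ Real.sqrt (((v.1 : ℝ) - (z.1 : ℝ)) ^ 2 + ((v.2 : ℝ) - (z.2 : ℝ)) ^ 2)

/-- The restricted partition function `Z_{N,ρ}^ψ(β)`. -/
def ZNres (N M : ℕ) (sigv lamv : ℕ → ℝ) (P : MeasureTheory.Measure FieldSp) (β ρ : ℝ) (ω : FieldSp) : ℝ :=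
  ∑ v ∈ AN N ρ, Real.exp (β * psiFld N M sigv lamv P v ω)

/-- The free energy `f_{N,ρ}^ψ(β)` on `A_{N,ρ}`. -/
def freeEnergyRes (N M : ℕ) (sigv lamv : ℕ → ℝ) (P : MeasureTheory.Measure FieldSp) (β ρ : ℝ)
    (ω : FieldSp) : ℝ :=
  (Real.log ((N : ℝ) ^ 2))⁻¹ * Real.log (ZNres N M sigv lamv P β ρ ω)

/-- The Gibbs weight `𝒢_{β,N}({v})`. -/
def gibbsW (N M : ℕ) (sigv lamv : ℕ → ℝ) (P : MeasureTheory.Measure FieldSp) (β : ℝ) (v : Vtx)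
    (ω : FieldSp) : ℝ :=
  Real.exp (β * psiFld N M sigv lamv P v ω) / ZN N M sigv lamv P β ω

/-- The restricted Gibbs weight `𝒢_{β,N,ρ}({v})`. -/
def gibbsWres (N M : ℕ) (sigv lamv : ℕ → ℝ) (P : MeasureTheory.Measure FieldSp) (β ρ : ℝ) (v : Vtx)
    (ω : FieldSp) : ℝ :=
  Real.exp (β * psiFld N M sigv lamv P v ω) / ZNres N M sigv lamv P β ρ ω

/-- `E𝒢_{β,N}^{×s}[F]`: the mean over the disorder of the `s`-fold Gibbs average of `F`. -/
def gibbsExp (N M : ℕ) (sigv lamv : ℕ → ℝ) (P : MeasureTheory.Measure FieldSp) (β : ℝ) (s : ℕ)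
    (F : (Fin s → Vtx) → ℝ) : ℝ :=
  ∫ ω, (∑ vv ∈ Fintype.piFinset (fun _ : Fin s => VN N),
    (∏ i, gibbsW N M sigv lamv P β (vv i) ω) * F vv) ∂P

/-- `E𝒢_{β,N,ρ}^{×s}[F]`, with an `ω`-dependent integrand allowed. -/
def gibbsExpRes (N M : ℕ) (sigv lamv : ℕ → ℝ) (P : MeasureTheory.Measure FieldSp) (β ρ : ℝ) (s : ℕ)
    (F : (Fin s → Vtx) → FieldSp → ℝ) : ℝ :=
  ∫ ω, (∑ vv ∈ Fintype.piFinset (fun _ : Fin s => AN N ρ),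
    (∏ i, gibbsWres N M sigv lamv P β ρ (vv i) ω) * F vv ω) ∂P

/-- `E𝒢_{β,N}^{×s}[F]`, with an `ω`-dependent integrand allowed. -/
def gibbsExpW (N M : ℕ) (sigv lamv : ℕ → ℝ) (P : MeasureTheory.Measure FieldSp) (β : ℝ) (s : ℕ)
    (F : (Fin s → Vtx) → FieldSp → ℝ) : ℝ :=
  ∫ ω, (∑ vv ∈ Fintype.piFinset (fun _ : Fin s => VN N),
    (∏ i, gibbsW N M sigv lamv P β (vv i) ω) * F vv ω) ∂P

/-- The covariance `E[ψ_v ψ_{v'}]`. -/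
def psiCov (N M : ℕ) (sigv lamv : ℕ → ℝ) (P : MeasureTheory.Measure FieldSp) (v v' : Vtx) : ℝ :=
  ∫ ω, psiFld N M sigv lamv P v ω * psiFld N M sigv lamv P v' ω ∂P

/-- `C₀` is a constant witnessing the uniform variance upper bound
`max_{v∈V_N} E[ψ_v²] ≤ 𝒥_{σ²}(1) log N + C₀` for `N` large. -/
def IsVarBound (M : ℕ) (sigv lamv : ℕ → ℝ) (P : ℕ → MeasureTheory.Measure FieldSp) (C₀ : ℝ) : Prop :=
  0 < C₀ ∧ ∃ N₀ : ℕ, ∀ N ≥ N₀, ∀ v ∈ VN N,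
    psiCov N M sigv lamv (P N) v v ≤ Jsig2 M sigv lamv 1 * Real.log N + C₀

/-- The overlap `q^N(v,v')`. -/
def overlapQ (N M : ℕ) (sigv lamv : ℕ → ℝ) (P : MeasureTheory.Measure FieldSp) (C₀ : ℝ) (v v' : Vtx) : ℝ :=
  psiCov N M sigv lamv P v v' / (Jsig2 M sigv lamv 1 * Real.log N + C₀)

/-- Convergence in probability to a constant, for a sequence of random variables on a
sequence of probability spaces. -/
def TendstoInProb (P : ℕ → MeasureTheory.Measure FieldSp) (X : ℕ → FieldSp → ℝ) (c : ℝ) : Prop :=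
  ∀ ε : ℝ, 0 < ε → Tendsto (fun N => P N {ω | ε < |X N ω - c|}) atTop (nhds 0)

/-- Convergence in `L^p` to a constant. -/
def TendstoLp (P : ℕ → MeasureTheory.Measure FieldSp) (X : ℕ → FieldSp → ℝ) (p c : ℝ) : Prop :=
  Tendsto (fun N => ∫ ω, |X N ω - c| ^ p ∂(P N)) atTop (nhds 0)

/-- The branching scale `b_N(v,v')`. -/
def bScale (N : ℕ) (v v' : Vtx) : ℝ :=
  sSup {lam : ℝ | lam ∈ Set.Icc (0:ℝ) 1 ∧ ((nbhd N lam v) ∩ (nbhd N lam v')).Nonempty}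

end GFFCommon

noncomputable def lap (u : Vtx → ℝ) (x : Vtx) : ℝ :=
  (u (x.1+1,x.2) + u (x.1-1,x.2) + u (x.1,x.2+1) + u (x.1,x.2-1))/4 - u x

def nbr (x w : Vtx) : Prop :=
  w = (x.1+1,x.2) ∨ w = (x.1-1,x.2) ∨ w = (x.1,x.2+1) ∨ w = (x.1,x.2-1)

lemma nbr_symm {x w : Vtx} (h : nbr x w) : nbr w x := by
  rcases h with h|h|h|h <;> subst h <;> simp [nbr]

lemma lap_add (u v : Vtx → ℝ) (x) : lap (fun z => u z + v z) x = lap u x + lap v x := by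
  simp only [lap]; ring
lemma lap_sub (u v : Vtx → ℝ) (x) : lap (fun z => u z - v z) x = lap u x - lap v x := by
  simp only [lap]; ring
lemma lap_neg (u : Vtx → ℝ) (x) : lap (fun z => - u z) x = - lap u x := by
  simp only [lap]; ring
lemma lap_smul (a : ℝ) (u : Vtx → ℝ) (x) : lap (fun z => a * u z) x = a * lap u x := by
  simp only [lap]; ring
lemma lap_sum {ι : Type*} (s : Finset ι) (u : ι → Vtx → ℝ) (x) :
    lap (fun z => ∑ i ∈ s, u i z) x = ∑ i ∈ s, lap (u i) x := by
  simp only [lap, Finset.sum_sub_distrib, ← Finset.sum_add_distrib, Finset.sum_div]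

lemma lap_off {I : Finset Vtx} {u : Vtx → ℝ} (hu : ∀ x ∉ I, u x = 0) {x : Vtx} (hx : x ∉ I)
    (hn : ∀ w, nbr x w → w ∉ I) : lap u x = 0 := by
  have e1 := hu _ (hn (x.1+1,x.2) (by simp [nbr]))
  have e2 := hu _ (hn (x.1-1,x.2) (by simp [nbr]))
  have e3 := hu _ (hn (x.1,x.2+1) (by simp [nbr]))
  have e4 := hu _ (hn (x.1,x.2-1) (by simp [nbr]))
  simp [lap, e1, e2, e3, e4, hu x hx]

lemma mp (I : Finset Vtx) (u : Vtx → ℝ) (c : ℝ) (hl : ∀ x ∈ I, 0 ≤ lap u x)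
    (hb : ∀ x ∈ I, ∀ w, nbr x w → w ∉ I → u w ≤ c) : ∀ x ∈ I, u x ≤ c := by
  by_contra! hcon
  obtain ⟨x0, hx0, hx0c⟩ := hcon
  obtain ⟨x1, hx1, hmax⟩ := Finset.exists_max_image I u ⟨x0, hx0⟩
  have hx1c : c < u x1 := lt_of_lt_of_le hx0c (hmax _ hx0)
  obtain ⟨x, hx, hmx⟩ := Finset.exists_max_image (I.filter (fun x => u x = u x1)) (fun x => x.1)
    ⟨x1, by simp [hx1]⟩
  obtain ⟨hxI, hxu⟩ := Finset.mem_filter.1 hx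
  have hnb : ∀ w, nbr x w → u w ≤ u x1 := fun w hw => by
    by_cases hwI : w ∈ I
    · exact hmax w hwI
    · exact (hb x hxI w hw hwI).trans hx1c.le
  have h1 := hnb (x.1+1,x.2) (by simp [nbr])
  have h2 := hnb (x.1-1,x.2) (by simp [nbr])
  have h3 := hnb (x.1,x.2+1) (by simp [nbr])
  have h4 := hnb (x.1,x.2-1) (by simp [nbr])
  have hlx := hl x hxI
  unfold lap at hlx
  have h1' : u (x.1+1,x.2) = u x1 := by linarith
  have hin : (x.1+1,x.2) ∈ I := by
    by_contra hcon
    have := hb x hxI _ (by simp [nbr]) hcon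
    linarith
  have := hmx (x.1+1,x.2) (by simp [hin, h1'])
  simp at this

lemma mp_zero (I : Finset Vtx) (u : Vtx → ℝ) (hu : ∀ x ∉ I, u x = 0) (hl : ∀ x ∈ I, lap u x = 0) :
    ∀ x, u x = 0 := by
  intro x
  by_cases hx : x ∈ I
  · apply le_antisymm
    · exact mp I u 0 (fun x hx => (hl x hx).ge) (fun x _ w _ hw => (hu w hw).le) x hx
    · have := mp I (fun z => - u z) 0 (fun x hx => by rw [lap_neg, hl x hx]; simp)
        (fun x _ w _ hw => by simp [hu w hw]) x hx
      linarith
  · exact hu x hx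

lemma gr_exists (I : Finset Vtx) (y : Vtx) : ∃ k : Vtx → ℝ, (∀ x ∉ I, k x = 0) ∧
    (y ∉ I → k = 0) ∧ ∀ x ∈ I, lap k x = if x = y then -(Real.pi/2) else 0 := by
  let ext : (I → ℝ) → Vtx → ℝ := fun u w => if h : w ∈ I then u ⟨w, h⟩ else 0
  let T : (I → ℝ) →ₗ[ℝ] (I → ℝ) :=
    { toFun := fun u x => lap (ext u) x
      map_add' := fun u v => by
        funext x
        show _ = lap (ext u) x + lap (ext v) x
        rw [← lap_add]; congr 1; funext w; simp only [ext]; split_ifs <;> simp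
      map_smul' := fun a u => by
        funext x
        show _ = a * lap (ext u) x
        rw [← lap_smul]; congr 1; funext w; simp only [ext]; split_ifs <;> simp }
  have hinj : Function.Injective T := by
    rw [← LinearMap.ker_eq_bot, LinearMap.ker_eq_bot']
    intro u hu
    funext x
    have := mp_zero I (ext u) (fun x hx => by simp [ext, hx])
      (fun x hx => congrFun hu ⟨x, hx⟩) x.1
    simpa [ext] using this
  have hsurj := LinearMap.injective_iff_surjective.1 hinj
  obtain ⟨u, hu⟩ := hsurj (fun x => if (x:Vtx) = y then -(Real.pi/2) else 0)
  by_cases hy : y ∈ I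
  · refine ⟨ext u, fun x hx => by simp [ext, hx], fun h => absurd hy h, fun x hx => ?_⟩
    exact congrFun hu ⟨x, hx⟩
  · refine ⟨0, fun _ _ => rfl, fun _ => rfl, fun x hx => ?_⟩
    rw [if_neg (by rintro rfl; exact hy hx)]; simp [lap]

noncomputable def gr (I : Finset Vtx) (y : Vtx) : Vtx → ℝ := (gr_exists I y).choose

lemma gr_off {I : Finset Vtx} {y x : Vtx} (hx : x ∉ I) : gr I y x = 0 :=
  (gr_exists I y).choose_spec.1 x hx
lemma gr_off' {I : Finset Vtx} {y : Vtx} (hy : y ∉ I) (x) : gr I y x = 0 := by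
  unfold gr; rw [(gr_exists I y).choose_spec.2.1 hy]; rfl
lemma gr_lap {I : Finset Vtx} {y x : Vtx} (hx : x ∈ I) :
    lap (gr I y) x = if x = y then -(Real.pi/2) else 0 :=
  (gr_exists I y).choose_spec.2.2 x hx

/-- finite support pairing -/
noncomputable def ip (u v : Vtx → ℝ) : ℝ := ∑' x, u x * v x

lemma ip_eq {I : Finset Vtx} (u : Vtx → ℝ) {v : Vtx → ℝ} (hv : ∀ x ∉ I, v x = 0) :
    ip u v = ∑ x ∈ I, u x * v x :=
  tsum_eq_sum (fun x hx => by simp [hv x hx])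

lemma ip_eq' {I : Finset Vtx} {u : Vtx → ℝ} (v : Vtx → ℝ) (hu : ∀ x ∉ I, u x = 0) :
    ip u v = ∑ x ∈ I, u x * v x :=
  tsum_eq_sum (fun x hx => by simp [hu x hx])

lemma ip_comm (u v) : ip u v = ip v u := by unfold ip; simp [mul_comm]

def shE (a b : ℤ) : Vtx ≃ Vtx where
  toFun x := (x.1 + a, x.2 + b)
  invFun x := (x.1 - a, x.2 - b)
  left_inv x := by simp
  right_inv x := by simp

lemma sbp {I : Finset Vtx} (u : Vtx → ℝ) {v : Vtx → ℝ} (hv : ∀ x ∉ I, v x = 0) :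
    ip (lap u) v = ip u (lap v) := by
  have hs : ∀ a b : ℤ, Summable (fun x : Vtx => u (x.1+a,x.2+b) * v x) := fun a b =>
    summable_of_ne_finset_zero (s := I) (fun x hx => by simp [hv x hx])
  have key : ∀ a b : ℤ, (∑' x : Vtx, u (x.1+a,x.2+b) * v x) = ∑' x : Vtx, u x * v (x.1-a,x.2-b) ∧
      Summable (fun x : Vtx => u x * v (x.1-a,x.2-b)) := fun a b => by
    have e : (fun x : Vtx => u (x.1+a,x.2+b) * v x)
        = (fun x : Vtx => u x * v (x.1-a,x.2-b)) ∘ (shE a b) := by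
      funext x; simp [shE]
    constructor
    · rw [e]; exact Equiv.tsum_eq (shE a b) (fun x : Vtx => u x * v (x.1-a,x.2-b))
    · exact (Equiv.summable_iff (shE a b)).1 (e ▸ hs a b)
  have k1 := key 1 0
  have k2 := key (-1) 0
  have k3 := key 0 1
  have k4 := key 0 (-1)
  have k0 := key 0 0
  have s1 := hs 1 0
  have s2 := hs (-1) 0
  have s3 := hs 0 1
  have s4 := hs 0 (-1)
  simp only [add_zero, sub_zero, sub_neg_eq_add, ← sub_eq_add_neg] at k1 k2 k3 k4 k0 s1 s2 s3 s4
  have L1 : ip (lap u) v = ((∑' x : Vtx, u (x.1+1,x.2) * v x) + (∑' x : Vtx, u (x.1-1,x.2) * v x)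
      + (∑' x : Vtx, u (x.1,x.2+1) * v x) + (∑' x : Vtx, u (x.1,x.2-1) * v x))/4 - ∑' x : Vtx, u x * v x := by
    rw [← (s1).tsum_add s2, ← (s1.add s2).tsum_add s3, ← ((s1.add s2).add s3).tsum_add s4,
      ← tsum_div_const, ← ((((s1.add s2).add s3).add s4).div_const 4).tsum_sub k0.2]
    unfold ip; congr 1; funext x; simp only [lap]; ring
  have L2 : ip u (lap v) = ((∑' x : Vtx, u x * v (x.1-1,x.2)) + (∑' x : Vtx, u x * v (x.1+1,x.2))
      + (∑' x : Vtx, u x * v (x.1,x.2-1)) + (∑' x : Vtx, u x * v (x.1,x.2+1)))/4 - ∑' x : Vtx, u x * v x := by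
    rw [← (k1.2).tsum_add k2.2, ← (k1.2.add k2.2).tsum_add k3.2, ← ((k1.2.add k2.2).add k3.2).tsum_add k4.2,
      ← tsum_div_const, ← ((((k1.2.add k2.2).add k3.2).add k4.2).div_const 4).tsum_sub k0.2]
    unfold ip; congr 1; funext x; simp only [lap]; ring
  rw [L1, L2, k1.1, k2.1, k3.1, k4.1]

lemma gr_rep {I : Finset Vtx} {u : Vtx → ℝ} (hu : ∀ x ∉ I, u x = 0) (x : Vtx) :
    u x = -(2/Real.pi) * ∑ z ∈ I, gr I x z * lap u z := by
  by_cases hx : x ∈ I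
  · have h := sbp (I := I) u (v := gr I x) (fun z hz => gr_off hz)
    rw [ip_eq _ (I := I) (fun z hz => gr_off hz), ip_eq' (I := I) _ hu,
      Finset.sum_congr (s₂ := I) (g := fun z => u z * if z = x then -(Real.pi/2) else 0) (f := fun z => u z * lap (gr I x) z) rfl (fun z hz => by rw [gr_lap hz])] at h
    simp only [mul_ite, mul_zero, Finset.sum_ite_eq', hx, if_true] at h
    have : ∑ z ∈ I, gr I x z * lap u z = u x * -(Real.pi/2) := by
      rw [← h]; exact Finset.sum_congr rfl (fun z _ => mul_comm _ _)
    rw [this]; field_simp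
  · rw [hu x hx]; simp [gr_off' hx]

lemma gr_symm (I : Finset Vtx) (x y : Vtx) : gr I x y = gr I y x := by
  by_cases hy : y ∈ I
  · have h := gr_rep (I := I) (u := gr I y) (fun z hz => gr_off hz) x
    rw [Finset.sum_congr rfl (fun z hz => by rw [gr_lap hz])] at h
    simp only [mul_ite, mul_zero, Finset.sum_ite_eq', hy, if_true] at h
    rw [h]; field_simp
  · rw [gr_off hy, gr_off' hy]

lemma gr_nonneg (I : Finset Vtx) (y x : Vtx) : 0 ≤ gr I y x := by
  by_cases hx : x ∈ I
  · have := mp I (fun z => - gr I y z) 0 (fun x hx => by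
      rw [lap_neg, gr_lap hx]; split_ifs <;> simp; positivity)
        (fun x _ w _ hw => by simp [gr_off hw]) x hx
    linarith
  · rw [gr_off hx]

lemma gr_mono {I I' : Finset Vtx} (h : I ⊆ I') (y x : Vtx) : gr I y x ≤ gr I' y x := by
  by_cases hx : x ∈ I
  · have := mp I (fun z => gr I y z - gr I' y z) 0 (fun x hx => by
      rw [lap_sub, gr_lap hx, gr_lap (h hx)]; simp)
        (fun x _ w _ hw => by simp [gr_off hw, gr_nonneg]) x hx
    linarith
  · rw [gr_off hx]; exact gr_nonneg _ _ _

lemma gr_le_diag (I : Finset Vtx) (y x : Vtx) : gr I y x ≤ gr I y y := by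
  by_cases hx : x ∈ I.erase y
  · refine mp (I.erase y) (gr I y) _ (fun x hx => ?_) (fun x _ w _ hw => ?_) x hx
    · rw [gr_lap (Finset.mem_of_mem_erase hx), if_neg (Finset.ne_of_mem_erase hx)]
    · by_cases hwy : w = y
      · rw [hwy]
      · rw [gr_off (fun h => hw (Finset.mem_erase.2 ⟨hwy, h⟩))]; exact gr_nonneg _ _ _
  · by_cases hwy : x = y
    · rw [hwy]
    · rw [gr_off (fun h => hx (Finset.mem_erase.2 ⟨hwy, h⟩))]; exact gr_nonneg _ _ _

lemma gr_nbr_diag {I : Finset Vtx} {y z : Vtx} (h : nbr y z) : gr I y y - gr I y z ≤ 2 * Real.pi := by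
  by_cases hy : y ∈ I
  · have hl := gr_lap (y := y) hy
    rw [if_pos rfl, lap] at hl
    have h1 := gr_le_diag I y (y.1+1,y.2)
    have h2 := gr_le_diag I y (y.1-1,y.2)
    have h3 := gr_le_diag I y (y.1,y.2+1)
    have h4 := gr_le_diag I y (y.1,y.2-1)
    rcases h with h|h|h|h <;> subst h <;> linarith
  · rw [gr_off' hy, gr_off' hy]; have := Real.pi_pos; linarith

lemma gr_nbr_le {I : Finset Vtx} {y z : Vtx} (h : nbr y z) (x : Vtx) :
    gr I y x - gr I z x ≤ 2 * Real.pi := by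
  have hpi := Real.pi_pos
  by_cases hx : x ∈ I
  swap
  · rw [gr_off hx, gr_off hx]; linarith
  have hyy : gr I y y - gr I z y ≤ 2 * Real.pi := by rw [gr_symm I z y]; exact gr_nbr_diag h
  by_cases hxy : x = y
  · rw [hxy]; exact hyy
  refine mp (I.erase y) (fun x => gr I y x - gr I z x) _ (fun x hx => ?_) (fun x _ w _ hw => ?_) x
    (Finset.mem_erase.2 ⟨hxy, hx⟩)
  · rw [lap_sub, gr_lap (Finset.mem_of_mem_erase hx), gr_lap (Finset.mem_of_mem_erase hx),
      if_neg (Finset.ne_of_mem_erase hx)]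
    split_ifs <;> simp; positivity
  · by_cases hwy : w = y
    · rw [hwy]; exact hyy
    · have := (fun h => hw (Finset.mem_erase.2 ⟨hwy, h⟩) : w ∉ I)
      simp only [gr_off this]; linarith

lemma gr_lip1 (I : Finset Vtx) (x : Vtx) (y : Vtx) (n : ℕ) (a b : ℤ) (hab : nbr (0,0) (a,b)) :
    |gr I y x - gr I (y.1 + n * a, y.2 + n * b) x| ≤ 2 * Real.pi * n := by
  induction n with
  | zero => simp
  | succ n ih =>
    have hn : nbr (y.1 + n * a, y.2 + n * b) (y.1 + (n+1:ℕ) * a, y.2 + (n+1:ℕ) * b) := by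
      simp only [nbr, Prod.mk.injEq, zero_add, zero_sub] at hab ⊢
      push_cast
      rcases hab with h|h|h|h <;> obtain ⟨rfl, rfl⟩ := h <;> ring_nf <;> simp
    have h1 := gr_nbr_le (I := I) hn x
    have h2 := gr_nbr_le (I := I) (nbr_symm hn) x
    have h3 : |gr I (y.1 + n * a, y.2 + n * b) x - gr I (y.1 + (n+1:ℕ) * a, y.2 + (n+1:ℕ) * b) x| ≤ 2 * Real.pi :=
      abs_le.2 ⟨by linarith, h1⟩
    have := abs_sub_le (gr I y x) (gr I (y.1 + n * a, y.2 + n * b) x) (gr I (y.1 + (n+1:ℕ) * a, y.2 + (n+1:ℕ) * b) x)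
    push_cast at *
    linarith

lemma gr_lip (I : Finset Vtx) (x y z : Vtx) :
    |gr I y x - gr I z x| ≤ 2 * Real.pi * (|(z.1:ℝ) - y.1| + |(z.2:ℝ) - y.2|) := by
  have s1 : |gr I y x - gr I (z.1, y.2) x| ≤ 2 * Real.pi * |(z.1:ℝ) - y.1| := by
    have hc : (((z.1 - y.1).natAbs : ℕ) : ℝ) = |(z.1:ℝ) - y.1| := by
      rw [Nat.cast_natAbs]; push_cast; rfl
    rcases le_total y.1 z.1 with h | h
    · have := gr_lip1 I x y (z.1 - y.1).natAbs 1 0 (by simp [nbr])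
      rwa [hc, show (y.1 + ((z.1 - y.1).natAbs:ℤ) * 1, y.2 + ((z.1 - y.1).natAbs:ℤ) * 0) = (z.1, y.2) by
        ext <;> simp only [] <;> omega] at this
    · have := gr_lip1 I x y (z.1 - y.1).natAbs (-1) 0 (by simp [nbr])
      rwa [hc, show (y.1 + ((z.1 - y.1).natAbs:ℤ) * -1, y.2 + ((z.1 - y.1).natAbs:ℤ) * 0) = (z.1, y.2) by
        ext <;> simp only [] <;> omega] at this
  have s2 : |gr I (z.1, y.2) x - gr I z x| ≤ 2 * Real.pi * |(z.2:ℝ) - y.2| := by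
    have hc : (((z.2 - y.2).natAbs : ℕ) : ℝ) = |(z.2:ℝ) - y.2| := by
      rw [Nat.cast_natAbs]; push_cast; rfl
    rcases le_total y.2 z.2 with h | h
    · have := gr_lip1 I x (z.1, y.2) (z.2 - y.2).natAbs 0 1 (by simp [nbr])
      rwa [hc, show (((z.1, y.2) : Vtx).1 + ((z.2 - y.2).natAbs:ℤ) * 0, ((z.1,y.2):Vtx).2 + ((z.2 - y.2).natAbs:ℤ) * 1) = z by
        ext <;> simp only [] <;> omega] at this
    · have := gr_lip1 I x (z.1, y.2) (z.2 - y.2).natAbs 0 (-1) (by simp [nbr])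
      rwa [hc, show (((z.1, y.2) : Vtx).1 + ((z.2 - y.2).natAbs:ℤ) * 0, ((z.1,y.2):Vtx).2 + ((z.2 - y.2).natAbs:ℤ) * -1) = z by
        ext <;> simp only [] <;> omega] at this
  have := abs_sub_le (gr I y x) (gr I (z.1, y.2) x) (gr I z x)
  linarith

noncomputable def hh (x : Vtx) : ℝ := (1/2) * Real.log ((x.1:ℝ)^2 + (x.2:ℝ)^2 + 1)
noncomputable def ff (x : Vtx) : ℝ := lap hh x

lemma ff_eq (x : Vtx) : ∃ t : ℝ, 0 ≤ t ∧ t ≤ 19 / ((x.1:ℝ)^2 + (x.2:ℝ)^2 + 1)^2 ∧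
    ff x = (1/8) * Real.log (1 + t) := by
  set a : ℝ := (x.1:ℝ) with ha
  set b : ℝ := (x.2:ℝ) with hb
  set r : ℝ := a^2 + b^2 + 1 with hr
  have r1 : 1 ≤ r := by nlinarith [sq_nonneg a, sq_nonneg b]
  have r0 : 0 < r := by linarith
  refine ⟨(2*r^2+8*r+5+16*a^2*b^2)/r^4, by positivity, ?_, ?_⟩
  · rw [div_le_div_iff₀ (by positivity) (by positivity)]
    have h1 : 16*a^2*b^2 ≤ 4*r^2 := by
      have : r^2 = (a^2+b^2)^2 + 2*(a^2+b^2)+1 := by rw [hr]; ring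
      nlinarith [sq_nonneg (a^2-b^2), sq_nonneg a, sq_nonneg b]
    have h2 : 2*r^2+8*r+5+16*a^2*b^2 ≤ 19*r^2 := by nlinarith
    have h3 : 0 ≤ r^2 := by positivity
    calc (2*r^2+8*r+5+16*a^2*b^2) * r^2 ≤ 19*r^2*r^2 := by gcongr
      _ = 19 * r^4 := by ring
  · have p1 : 0 < (a+1)^2+b^2+1 := by positivity
    have p2 : 0 < (a-1)^2+b^2+1 := by positivity
    have p3 : 0 < a^2+(b+1)^2+1 := by positivity
    have p4 : 0 < a^2+(b-1)^2+1 := by positivity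
    have e : 1 + (2*r^2+8*r+5+16*a^2*b^2)/r^4 =
        ((a+1)^2+b^2+1) * ((a-1)^2+b^2+1) * (a^2+(b+1)^2+1) * (a^2+(b-1)^2+1) / r^4 := by
      rw [eq_div_iff (by positivity), add_mul, div_mul_cancel₀ _ (by positivity), hr]; ring
    rw [e, Real.log_div (by positivity) (by positivity), Real.log_mul (by positivity) (by positivity),
      Real.log_mul (by positivity) (by positivity), Real.log_mul (by positivity) (by positivity),
      Real.log_pow]
    simp only [ff, lap, hh]
    push_cast
    rw [← ha, ← hb, ← hr]; ring

lemma ff_nonneg (x) : 0 ≤ ff x := by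
  obtain ⟨t, h0, -, h⟩ := ff_eq x
  rw [h]; have := Real.log_nonneg (show 1 ≤ 1 + t by linarith); positivity

lemma ff_le (x : Vtx) : ff x ≤ 19 / 8 / ((x.1:ℝ)^2 + (x.2:ℝ)^2 + 1)^2 := by
  obtain ⟨t, h0, h1, h⟩ := ff_eq x
  have := Real.log_le_sub_one_of_pos (show 0 < 1 + t by linarith)
  rw [h, div_right_comm]; linarith

lemma ff_summable1 : Summable (fun z : Vtx => ff z * (|(z.1:ℝ)| + |(z.2:ℝ)|)) := by
  have h := (EisensteinSeries.summable_one_div_norm_rpow (k := 3) (by norm_num))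
  have h2 := ((finTwoArrowEquiv ℤ).symm.summable_iff).2 h
  refine Summable.of_nonneg_of_le (fun z => mul_nonneg (ff_nonneg z) (by positivity)) (fun z => ?_)
    (h2.mul_left (19/4))
  simp only [Function.comp_apply, finTwoArrowEquiv_symm_apply]
  have hn : ‖![z.1, z.2]‖ = max |(z.1:ℝ)| |(z.2:ℝ)| := by
    simp [EisensteinSeries.norm_eq_max_natAbs, Nat.cast_natAbs]
  rw [hn]
  set m := max |(z.1:ℝ)| |(z.2:ℝ)| with hm
  have m1 : |(z.1:ℝ)| ≤ m := le_max_left _ _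
  have m2 : |(z.2:ℝ)| ≤ m := le_max_right _ _
  have m0 : 0 ≤ m := (abs_nonneg _).trans m1
  rcases m0.eq_or_lt with hz | hz
  · have e1 : |(z.1:ℝ)| = 0 := le_antisymm (hz ▸ m1) (abs_nonneg _)
    have e2 : |(z.2:ℝ)| = 0 := le_antisymm (hz ▸ m2) (abs_nonneg _)
    rw [e1, e2, add_zero, mul_zero]
    positivity
  · have hr : m^2 ≤ (z.1:ℝ)^2 + (z.2:ℝ)^2 + 1 := by
      rcases le_total |(z.1:ℝ)| |(z.2:ℝ)| with h | h
      · rw [hm, max_eq_right h, sq_abs]; nlinarith [sq_nonneg (z.1:ℝ)]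
      · rw [hm, max_eq_left h, sq_abs]; nlinarith [sq_nonneg (z.2:ℝ)]
    have h3 : m^(-3:ℝ) = 1/m^3 := by
      rw [Real.rpow_neg m0, one_div]; norm_cast
    rw [h3]
    calc ff z * (|(z.1:ℝ)| + |(z.2:ℝ)|) ≤ (19/8/(m^2)^2) * (2*m) := by
          apply mul_le_mul _ (by linarith) (by positivity) (by positivity)
          refine (ff_le z).trans ?_
          gcongr
      _ = 19/4*(1/m^3) := by field_simp; norm_num

lemma ff_summable : Summable ff := by
  have h0 : Summable (fun z : Vtx => if z = (0,0) then ff z else 0) :=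
    summable_of_ne_finset_zero (s := {(0,0)}) (fun x hx => if_neg (by simpa using hx))
  refine Summable.of_nonneg_of_le ff_nonneg (fun z => ?_) (ff_summable1.add h0)
  by_cases hz : z = (0,0)
  · rw [if_pos hz]; have := ff_nonneg z
    have : 0 ≤ ff z * (|(z.1:ℝ)| + |(z.2:ℝ)|) := by positivity
    linarith
  · rw [if_neg hz, add_zero]
    apply le_mul_of_one_le_right (ff_nonneg z)
    have : z.1 ≠ 0 ∨ z.2 ≠ 0 := by
      by_contra! h; exact hz (Prod.ext h.1 h.2)
    rcases this with h | h
    · have : (1:ℝ) ≤ |(z.1:ℝ)| := by exact_mod_cast Int.one_le_abs h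
      linarith [abs_nonneg (z.2:ℝ)]
    · have : (1:ℝ) ≤ |(z.2:ℝ)| := by exact_mod_cast Int.one_le_abs h
      linarith [abs_nonneg (z.1:ℝ)]

lemma Icc_succ_int (R : ℕ) : Finset.Icc (-((R+1:ℕ):ℤ)) ((R+1:ℕ):ℤ) =
    insert (-((R:ℤ)+1)) (insert ((R:ℤ)+1) (Finset.Icc (-(R:ℤ)) R)) := by
  ext a; simp only [Finset.mem_insert, Finset.mem_Icc]; push_cast; omega

lemma tele_sum (k : ℤ → ℝ) (R : ℕ) :
    ∑ a ∈ Finset.Icc (-(R:ℤ)) R, (k (a+1) + k (a-1) - 2 * k a)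
      = k (R+1) - k R + (k (-R-1) - k (-R)) := by
  induction R with
  | zero => simp; ring
  | succ R ih =>
    rw [Icc_succ_int, Finset.sum_insert, Finset.sum_insert, ih]
    · push_cast
      rw [show -((R:ℤ)+1)+1 = -R by ring, show -((R:ℤ)+1) = -R-1 by ring, show (R:ℤ)+1-1 = R by ring]; ring
    · simp
    · simp; omega

lemma even_sum (q : ℤ → ℝ) (hq : ∀ a, q (-a) = q a) (R : ℕ) :
    ∑ a ∈ Finset.Icc (-(R:ℤ)) R, q a = 2 * (∑ b ∈ Finset.range (R+1), q b) - q 0 := by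
  induction R with
  | zero => simp; ring
  | succ R ih =>
    rw [Icc_succ_int, Finset.sum_insert, Finset.sum_insert, ih, Finset.sum_range_succ _ (R+1), hq]
    · push_cast; ring
    · simp
    · simp; omega

noncomputable def pp (R : ℕ) (b : ℤ) : ℝ := hh (R+1, b) - hh (R, b)

lemma box_sum (R : ℕ) : ∑ z ∈ Finset.Icc (-(R:ℤ)) R ×ˢ Finset.Icc (-(R:ℤ)) R, ff z
    = 2 * (∑ b ∈ Finset.range (R+1), pp R b) - pp R 0 := by
  have e1 : ∀ a b : ℤ, hh (-a, b) = hh (a, b) := fun a b => by simp [hh]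
  have e3 : ∀ a b : ℤ, hh (a, -b) = hh (a, b) := fun a b => by simp [hh]
  have e2 : ∀ a b : ℤ, hh (a, b) = hh (b, a) := fun a b => by simp [hh, add_comm]
  have ev := even_sum (fun b => pp R b) (fun a => by simp only [pp, e3]) R
  rw [← ev]
  have h1 : ∀ z : Vtx, ff z = (1/4) * (hh (z.1+1,z.2) + hh (z.1-1,z.2) - 2 * hh (z.1,z.2))
      + (1/4) * (hh (z.1,z.2+1) + hh (z.1,z.2-1) - 2 * hh (z.1,z.2)) := fun z => by
    simp only [ff, lap]; ring
  rw [Finset.sum_congr rfl (fun z _ => h1 z), Finset.sum_add_distrib, Finset.sum_product_right,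
    Finset.sum_product]
  simp only [← Finset.mul_sum]
  rw [Finset.sum_congr rfl (fun b _ => tele_sum (fun a => hh (a, b)) R),
    Finset.sum_congr rfl (fun a _ => tele_sum (fun b => hh (a, b)) R), Finset.mul_sum, Finset.mul_sum,
    ← Finset.sum_add_distrib]
  refine Finset.sum_congr rfl (fun b _ => ?_)
  rw [show -(R:ℤ)-1 = -((R:ℤ)+1) by ring, e1, e1, e3, e3, e2 b, e2 b, pp]; ring

lemma arctan_diff {x y : ℝ} (hx : 0 ≤ x) (hxy : x < y) :
    (y - x)/(1+y^2) ≤ Real.arctan y - Real.arctan x ∧ Real.arctan y - Real.arctan x ≤ (y-x)/(1+x^2) := by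
  obtain ⟨c, ⟨hc1, hc2⟩, hc⟩ := exists_deriv_eq_slope Real.arctan hxy Real.continuous_arctan.continuousOn
    Real.differentiable_arctan.differentiableOn
  have hpos : 0 < y - x := by linarith
  rw [Real.deriv_arctan, eq_div_iff hpos.ne'] at hc
  simp only at hc
  rw [← hc, one_div_mul_eq_div]
  constructor
  · apply div_le_div_of_nonneg_left hpos.le (by positivity); gcongr; linarith
  · apply div_le_div_of_nonneg_left hpos.le (by positivity); gcongr

lemma pp_eq (R : ℕ) (b : ℤ) : pp R b = (1/2) * Real.log (1 + (2*R+1)/((R:ℝ)^2 + (b:ℝ)^2+1)) := by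
  simp only [pp, hh]
  rw [← mul_sub, ← Real.log_div (by positivity) (by positivity)]
  congr 2; push_cast; field_simp; ring

lemma pp_upper (R : ℕ) (hR : 1 ≤ R) : ∑ b ∈ Finset.range (R+1), pp R b ≤
    (1 + 1/(R:ℝ)) * (1/(R:ℝ) + Real.arctan 1) := by
  have hR' : (1:ℝ) ≤ R := by exact_mod_cast hR
  have h1 : ∀ b : ℕ, pp R b ≤ (1+1/(R:ℝ)) * ((R:ℝ)/((R:ℝ)^2+(b:ℝ)^2)) := fun b => by
    rw [pp_eq]
    have hl := Real.log_le_sub_one_of_pos (show 0 < 1 + (2*R+1)/((R:ℝ)^2 + ((b:ℤ):ℝ)^2+1) by positivity)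
    have : (2*R+1)/((R:ℝ)^2 + ((b:ℤ):ℝ)^2+1) ≤ 2 * ((1+1/(R:ℝ)) * ((R:ℝ)/((R:ℝ)^2+(b:ℝ)^2))) := by
      have e : 2 * ((1+1/(R:ℝ)) * ((R:ℝ)/((R:ℝ)^2+(b:ℝ)^2))) = (2*R+2)/((R:ℝ)^2+(b:ℝ)^2) := by
        field_simp
      rw [e]; push_cast
      apply div_le_div₀ (by positivity) (by linarith) (by positivity) (by linarith)
    linarith
  have h2 : ∀ n : ℕ, ∑ b ∈ Finset.range (n+1), ((R:ℝ)/((R:ℝ)^2+(b:ℝ)^2)) ≤ 1/(R:ℝ) + Real.arctan (n/R) := by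
    intro n
    induction n with
    | zero => simp; field_simp; norm_num
    | succ n ih =>
      rw [Finset.sum_range_succ]
      have := (arctan_diff (x := (n:ℝ)/R) (y := ((n+1:ℕ):ℝ)/R) (by positivity) (by gcongr; simp)).1
      have e : (((n+1:ℕ):ℝ)/R - n/R) / (1 + (((n+1:ℕ):ℝ)/R)^2) = (R:ℝ)/((R:ℝ)^2+((n+1:ℕ):ℝ)^2) := by
        push_cast; field_simp; ring
      rw [e] at this; linarith
  calc ∑ b ∈ Finset.range (R+1), pp R b ≤ ∑ b ∈ Finset.range (R+1), (1+1/(R:ℝ)) * ((R:ℝ)/((R:ℝ)^2+(b:ℝ)^2)) :=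
        Finset.sum_le_sum (fun b _ => h1 b)
    _ ≤ _ := by
      rw [← Finset.mul_sum]
      have := h2 R
      rw [div_self (by positivity)] at this
      gcongr

lemma pp_lower (R : ℕ) : ((R:ℝ)/(R+1)) * (Real.arctan 1 - Real.arctan (1/((R:ℝ)+1))) ≤
    ∑ b ∈ Finset.range (R+1), pp R b := by
  have h1 : ∀ b : ℕ, ((R:ℝ)/(R+1)) * (((R:ℝ)+1)/(((R:ℝ)+1)^2+((b:ℝ)+1)^2)) ≤ pp R b := fun b => by
    rw [pp_eq]
    have hl := Real.one_sub_inv_le_log_of_pos (show 0 < 1 + (2*R+1)/((R:ℝ)^2 + ((b:ℤ):ℝ)^2+1) by positivity)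
    have e : 1 - (1 + (2*R+1)/((R:ℝ)^2 + ((b:ℤ):ℝ)^2+1))⁻¹ = (2*R+1)/(((R:ℝ)+1)^2+(b:ℝ)^2+1) := by
      push_cast; field_simp; ring
    rw [e] at hl
    have e2 : ((R:ℝ)/(R+1)) * (((R:ℝ)+1)/(((R:ℝ)+1)^2+((b:ℝ)+1)^2)) = (1/2) * ((2*R)/(((R:ℝ)+1)^2+((b:ℝ)+1)^2)) := by
      field_simp
    rw [e2]
    have : (2*R)/(((R:ℝ)+1)^2+((b:ℝ)+1)^2) ≤ (2*R+1)/(((R:ℝ)+1)^2+(b:ℝ)^2+1) := by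
      have : (0:ℝ) ≤ b := by positivity
      apply div_le_div₀ (by positivity) (by linarith) (by positivity) (by nlinarith)
    linarith
  have h2 : ∀ n : ℕ, Real.arctan ((n+1)/(R+1)) - Real.arctan (1/((R:ℝ)+1)) ≤
      ∑ b ∈ Finset.range n, (((R:ℝ)+1)/(((R:ℝ)+1)^2+((b:ℝ)+1)^2)) := by
    intro n
    induction n with
    | zero => simp
    | succ n ih =>
      rw [Finset.sum_range_succ]
      have := (arctan_diff (x := ((n:ℝ)+1)/(R+1)) (y := (((n+1:ℕ):ℝ)+1)/(R+1)) (by positivity) (by gcongr; simp)).2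
      have e : ((((n+1:ℕ):ℝ)+1)/((R:ℝ)+1) - ((n:ℝ)+1)/(R+1)) / (1 + (((n:ℝ)+1)/(R+1))^2) = ((R:ℝ)+1)/(((R:ℝ)+1)^2+((n:ℝ)+1)^2) := by
        push_cast; field_simp; ring
      rw [e] at this; linarith
  calc _ ≤ ((R:ℝ)/(R+1)) * ∑ b ∈ Finset.range (R+1), (((R:ℝ)+1)/(((R:ℝ)+1)^2+((b:ℝ)+1)^2)) := by
        have := h2 (R+1)
        have h3 : Real.arctan 1 ≤ Real.arctan ((((R+1:ℕ):ℝ)+1)/(R+1)) := by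
          apply Real.arctan_strictMono.monotone
          rw [one_le_div (by positivity)]; push_cast; linarith
        gcongr; linarith
    _ ≤ _ := by
      rw [Finset.mul_sum]; exact Finset.sum_le_sum (fun b _ => h1 b)

lemma ff_tsum : ∑' z, ff z = Real.pi / 2 := by
  have hbox : Tendsto (fun R : ℕ => Finset.Icc (-(R:ℤ)) R ×ˢ Finset.Icc (-(R:ℤ)) R) atTop atTop := by
    apply tendsto_atTop_finset_of_monotone
    · intro a b hab
      have : (a:ℤ) ≤ b := by exact_mod_cast hab
      apply Finset.product_subset_product <;> apply Finset.Icc_subset_Icc <;> omega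
    · intro z
      refine ⟨z.1.natAbs + z.2.natAbs, ?_⟩
      simp only [Finset.mem_product, Finset.mem_Icc]; push_cast; 
      have := le_abs_self z.1; have := neg_abs_le z.1; have := le_abs_self z.2
      have := neg_abs_le z.2; have := abs_nonneg z.1; have := abs_nonneg z.2
      omega
  have h1 := ff_summable.hasSum.comp hbox
  have h2 : Tendsto (fun R : ℕ => ∑ b ∈ Finset.range (R+1), pp R b) atTop (nhds (Real.pi/4)) := by
    have i0 : Tendsto (fun R : ℕ => 1/(R:ℝ)) atTop (nhds 0) := tendsto_one_div_atTop_nhds_zero_nat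
    have i1 : Tendsto (fun R : ℕ => 1/((R:ℝ)+1)) atTop (nhds 0) := tendsto_one_div_add_atTop_nhds_zero_nat
    have i2 : Tendsto (fun R : ℕ => (R:ℝ)/((R:ℝ)+1)) atTop (nhds 1) := tendsto_natCast_div_add_atTop 1
    have i3 : Tendsto (fun R : ℕ => Real.arctan (1/((R:ℝ)+1))) atTop (nhds 0) := by
      have := (Real.continuous_arctan.tendsto 0).comp i1
      rwa [Real.arctan_zero] at this
    refine tendsto_of_tendsto_of_tendsto_of_le_of_le' ?_ ?_ (Eventually.of_forall pp_lower)
      ((eventually_ge_atTop 1).mono pp_upper)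
    · have := i2.mul (i3.const_sub (Real.arctan 1))
      simpa [Real.arctan_one] using this
    · have := (i0.const_add 1).mul (i0.add_const (Real.arctan 1))
      simpa [Real.arctan_one] using this
  have h3 : Tendsto (fun R : ℕ => pp R 0) atTop (nhds 0) := by
    refine squeeze_zero' (g := fun R : ℕ => 2/(R:ℝ)) (Eventually.of_forall fun R => ?_) ?_ (tendsto_const_div_atTop_nhds_zero_nat 2)
    · rw [pp_eq]; 
      have := Real.log_nonneg (show (1:ℝ) ≤ 1 + (2*R+1)/((R:ℝ)^2 + ((0:ℤ):ℝ)^2+1) by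
        have : (0:ℝ) ≤ (2*R+1)/((R:ℝ)^2 + ((0:ℤ):ℝ)^2+1) := by positivity
        linarith)
      positivity
    · filter_upwards [eventually_ge_atTop 1] with R hR
      have hR' : (1:ℝ) ≤ R := by exact_mod_cast hR
      rw [pp_eq]
      have hl := Real.log_le_sub_one_of_pos (show 0 < 1 + (2*R+1)/((R:ℝ)^2 + ((0:ℤ):ℝ)^2+1) by positivity)
      have : (2*R+1)/((R:ℝ)^2 + ((0:ℤ):ℝ)^2+1) ≤ 2 * (2/R) := by
        rw [show 2*(2/(R:ℝ)) = 4/R by ring, div_le_div_iff₀ (by positivity) (by positivity)]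
        push_cast; nlinarith
      linarith
  have h4 := (h2.const_mul 2).sub h3
  have h5 : (fun R : ℕ => 2 * (∑ b ∈ Finset.range (R+1), pp R b) - pp R 0) = (fun s => ∑ z ∈ s, ff z) ∘ (fun R : ℕ => Finset.Icc (-(R:ℤ)) R ×ˢ Finset.Icc (-(R:ℤ)) R) := by
    funext R; exact (box_sum R).symm
  rw [h5] at h4
  have := tendsto_nhds_unique h1 h4
  rw [this]; ring

noncomputable def C0 : ℝ := 4 * ∑' z : Vtx, ff z * (|(z.1:ℝ)| + |(z.2:ℝ)|)

lemma C0_nonneg : 0 ≤ C0 := by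
  unfold C0
  have : 0 ≤ ∑' z : Vtx, ff z * (|(z.1:ℝ)| + |(z.2:ℝ)|) :=
    tsum_nonneg (fun z => mul_nonneg (ff_nonneg z) (by positivity))
  positivity

noncomputable def pot (I : Finset Vtx) (y x : Vtx) : ℝ := (2/Real.pi) * ∑ z ∈ I, ff (z - y) * gr I z x

lemma pot_close (I : Finset Vtx) (y x : Vtx) : |pot I y x - gr I x y| ≤ C0 := by
  have hpi := Real.pi_pos
  have e1 : pot I y x = (2/Real.pi) * ∑' z, ff z * gr I (z + y) x := by
    rw [pot, ← tsum_eq_sum (L := .unconditional _) (s := I) (f := fun z => ff (z - y) * gr I z x) (fun z hz => by simp [gr_off' hz])]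
    congr 1
    rw [← Equiv.tsum_eq (Equiv.addRight y)]
    simp
  have e2 : gr I x y = (2/Real.pi) * ∑' z, ff z * gr I y x := by
    rw [tsum_mul_right, ff_tsum, gr_symm I x y]; field_simp
  have hb : ∀ z : Vtx, |ff z * gr I (z+y) x - ff z * gr I y x| ≤ 2*Real.pi*(ff z * (|(z.1:ℝ)| + |(z.2:ℝ)|)) := fun z => by
    rw [← mul_sub, abs_mul, abs_of_nonneg (ff_nonneg z)]
    have := gr_lip I x (z+y) y
    have e : |(y.1:ℝ) - (z+y).1| + |(y.2:ℝ) - (z+y).2| = |(z.1:ℝ)| + |(z.2:ℝ)| := by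
      rw [Prod.fst_add, Prod.snd_add]; push_cast
      rw [show (y.1:ℝ) - (z.1+y.1) = -z.1 by ring, show (y.2:ℝ) - (z.2+y.2) = -z.2 by ring, abs_neg, abs_neg]
    rw [e] at this
    calc _ ≤ ff z * (2*Real.pi*(|(z.1:ℝ)| + |(z.2:ℝ)|)) := mul_le_mul_of_nonneg_left this (ff_nonneg z)
      _ = _ := by ring
  have hs : Summable (fun z : Vtx => ff z * gr I y x) := ff_summable.mul_right _
  have hd : Summable (fun z : Vtx => ff z * gr I (z+y) x - ff z * gr I y x) :=
    Summable.of_norm_bounded (ff_summable1.mul_left (2*Real.pi)) (fun z => hb z)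
  have hs1 : Summable (fun z : Vtx => ff z * gr I (z+y) x) := by
    have := hd.add hs; simpa using this
  rw [e1, e2, ← mul_sub, ← hs1.tsum_sub hs, abs_mul, abs_of_pos (by positivity)]
  have h1 : |∑' z : Vtx, (ff z * gr I (z+y) x - ff z * gr I y x)| ≤ 2*Real.pi * ∑' z : Vtx, ff z * (|(z.1:ℝ)| + |(z.2:ℝ)|) := by
    rw [← tsum_mul_left]
    rw [← Real.norm_eq_abs]
    exact tsum_of_norm_bounded ((ff_summable1.mul_left (2*Real.pi)).hasSum) (fun z => hb z)
  calc _ ≤ (2/Real.pi) * (2*Real.pi * ∑' z : Vtx, ff z * (|(z.1:ℝ)| + |(z.2:ℝ)|)) := by gcongr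
    _ = C0 := by rw [C0]; field_simp; ring

lemma lap_shift (u : Vtx → ℝ) (y x : Vtx) : lap (fun z => u (z - y)) x = lap u (x - y) := by
  simp only [lap]
  have e1 : ((x.1+1,x.2) : Vtx) - y = ((x-y).1+1,(x-y).2) := by ext <;> (simp; try ring)
  have e2 : ((x.1-1,x.2) : Vtx) - y = ((x-y).1-1,(x-y).2) := by ext <;> (simp; try ring)
  have e3 : ((x.1,x.2+1) : Vtx) - y = ((x-y).1,(x-y).2+1) := by ext <;> (simp; try ring)
  have e4 : ((x.1,x.2-1) : Vtx) - y = ((x-y).1,(x-y).2-1) := by ext <;> (simp; try ring)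
  rw [e1, e2, e3, e4]

lemma pot_lap {I : Finset Vtx} (y : Vtx) {x : Vtx} (hx : x ∈ I) : lap (pot I y) x = - ff (x - y) := by
  unfold pot
  rw [lap_smul, lap_sum]
  simp only [lap_smul, gr_lap hx]
  simp only [mul_ite, mul_zero, Finset.sum_ite_eq, hx, if_true]
  have := Real.pi_pos
  field_simp

lemma key_green {I : Finset Vtx} {y y' : Vtx} {c : ℝ}
    (hb : ∀ x ∈ I, ∀ w, nbr x w → w ∉ I → hh (w - y) ≤ hh (w - y') + c) {x : Vtx} (hx : x ∈ I) :
    gr I x y + hh (x - y) ≤ gr I x y' + hh (x - y') + c + 2 * C0 := by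
  have := mp I (fun x => (pot I y x + hh (x - y)) - (pot I y' x + hh (x - y'))) c (fun x hx => by
    rw [lap_sub, lap_add, lap_add, pot_lap y hx, pot_lap y' hx, lap_shift, lap_shift]
    simp [ff]) (fun x hx w hw hwI => by
      have := hb x hx w hw hwI
      have e : ∀ y, pot I y w = 0 := fun y => by simp [pot, gr_off hwI]
      simp only [e]; linarith) x hx
  have h1 := abs_le.1 (pot_close I y x)
  have h2 := abs_le.1 (pot_close I y' x)
  linarith [h1.1, h2.2]

lemma log5 : Real.log 5 ≤ 2 := by
  rw [Real.log_le_iff_le_exp (by norm_num)]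
  have : Real.exp 2 = Real.exp 1 * Real.exp 1 := by rw [← Real.exp_add]; norm_num
  rw [this]; nlinarith [Real.exp_one_gt_d9]

lemma hh_le5 {x y : Vtx} (h : x.1^2 + x.2^2 + 1 ≤ 5 * (y.1^2 + y.2^2 + 1)) : hh x ≤ hh y + 1 := by
  have h' : (x.1:ℝ)^2 + (x.2:ℝ)^2 + 1 ≤ 5 * ((y.1:ℝ)^2 + (y.2:ℝ)^2 + 1) := by exact_mod_cast h
  have := Real.log_le_log (by positivity) h'
  rw [Real.log_mul (by norm_num) (by positivity)] at this
  have := log5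
  simp only [hh]; linarith

lemma hh_mono {x y : Vtx} (h : x.1^2 + x.2^2 ≤ y.1^2 + y.2^2) : hh x ≤ hh y := by
  have h' : (x.1:ℝ)^2 + (x.2:ℝ)^2 ≤ (y.1:ℝ)^2 + (y.2:ℝ)^2 := by exact_mod_cast h
  have := Real.log_le_log (by positivity) (by linarith : (x.1:ℝ)^2 + (x.2:ℝ)^2 + 1 ≤ (y.1:ℝ)^2 + (y.2:ℝ)^2 + 1)
  simp only [hh]; linarith

lemma hh_zero : hh 0 = 0 := by simp [hh]

noncomputable def C1 : ℝ := 2 * C0 + 1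

noncomputable def Rc (p q : Vtx) : Finset Vtx := Finset.Ioo p.1 q.1 ×ˢ Finset.Ioo p.2 q.2
noncomputable def dR (p q v : Vtx) : ℤ := min (min (v.1 - p.1) (q.1 - v.1)) (min (v.2 - p.2) (q.2 - v.2))

lemma mem_Rc {p q v : Vtx} : v ∈ Rc p q ↔ (p.1 < v.1 ∧ v.1 < q.1) ∧ (p.2 < v.2 ∧ v.2 < q.2) := by
  simp [Rc]
lemma mem_Rc_iff {p q v : Vtx} : v ∈ Rc p q ↔ 0 < dR p q v := by
  rw [mem_Rc, dR]; omega
lemma Rc_inter (p q p' q' : Vtx) : Rc p q ∩ Rc p' q' = Rc (p ⊔ p') (q ⊓ q') := by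
  ext v; simp only [Finset.mem_inter, mem_Rc, Prod.fst_sup, Prod.snd_sup, Prod.fst_inf, Prod.snd_inf]; omega
lemma dR_inter (p q p' q' v : Vtx) : dR (p ⊔ p') (q ⊓ q') v = min (dR p q v) (dR p' q' v) := by
  apply eq_of_forall_le_iff; intro c
  simp only [dR, Prod.fst_sup, Prod.snd_sup, Prod.fst_inf, Prod.snd_inf, le_min_iff, le_sub_iff_add_le]
  omega
lemma Rc_outer {p q x w : Vtx} (hx : x ∈ Rc p q) (h : nbr x w) :
    p.1 ≤ w.1 ∧ w.1 ≤ q.1 ∧ p.2 ≤ w.2 ∧ w.2 ≤ q.2 := by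
  rw [mem_Rc] at hx
  rcases h with h|h|h|h <;> subst h <;> simp only <;> omega

lemma est_up {I : Finset Vtx} {v y : Vtx} {d : ℤ} (hd : 0 < d) (hv : v ∈ I) (hy : y ∉ I)
    (hyd : (v-y).1^2 + (v-y).2^2 = 4*d^2)
    (h : ∀ x ∈ I, ∀ w, nbr x w → (w-v).1^2 + (w-v).2^2 ≤ (w-y).1^2+(w-y).2^2) :
    gr I v v ≤ Real.log d + C1 := by
  have := key_green (I := I) (y := v) (y' := y) (c := 0) (fun x hx w hw _ => by
    have := hh_mono (h x hx w hw); linarith) hv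
  rw [gr_off hy, sub_self, hh_zero] at this
  have hd' : (1:ℝ) ≤ d := by exact_mod_cast hd
  have h2 : hh (v - y) ≤ Real.log d + 1 := by
    have e : ((v-y).1:ℝ)^2 + ((v-y).2:ℝ)^2 = 4*(d:ℝ)^2 := by exact_mod_cast hyd
    have : Real.log (4*(d:ℝ)^2 + 1) ≤ Real.log (5 * (d:ℝ)^2) := Real.log_le_log (by positivity) (by nlinarith)
    rw [Real.log_mul (by norm_num) (by positivity), Real.log_pow] at this
    have := log5
    simp only [hh]; rw [e]; push_cast at *; linarith
  unfold C1; linarith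

lemma est {p q v : Vtx} (hv : 0 < dR p q v) : |gr (Rc p q) v v - Real.log (dR p q v)| ≤ C1 := by
  set d := dR p q v with hd
  have hvI : v ∈ Rc p q := mem_Rc_iff.2 hv
  have hd' : (1:ℝ) ≤ d := by exact_mod_cast hv
  rw [abs_le]; constructor
  · -- lower bound
    set B := Rc (v.1 - d, v.2 - d) (v.1 + d, v.2 + d) with hB
    have hsub : B ⊆ Rc p q := fun w hw => by
      rw [hB, mem_Rc] at hw; rw [mem_Rc]; simp only [dR] at hd hw; omega
    have hvB : v ∈ B := by rw [hB, mem_Rc]; simp only; omega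
    have hm := gr_mono hsub v v
    have hy : ((v.1 + d, v.2) : Vtx) ∉ B := by rw [hB, mem_Rc]; simp
    have := key_green (I := B) (y := (v.1 + d, v.2)) (y' := v) (c := 1) (fun x hx w hw hwB => by
      apply hh_le5
      obtain ⟨h1, h2, h3, h4⟩ := Rc_outer hx hw
      rw [hB, mem_Rc] at hwB
      simp only [Prod.fst_sub, Prod.snd_sub] at *
      have a1 : (w.1 - v.1)^2 ≤ d^2 := by apply sq_le_sq'; omega; omega
      have a2 : (w.2 - v.2)^2 ≤ d^2 := by apply sq_le_sq'; omega; omega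
      have a3 : (w.1 - (v.1+d))^2 ≤ (2*d)^2 := by apply sq_le_sq'; omega; omega
      have a4 : d^2 ≤ (w.1-v.1)^2 + (w.2-v.2)^2 := by
        have : w.1 - v.1 = d ∨ w.1 - v.1 = -d ∨ w.2 - v.2 = d ∨ w.2-v.2=-d := by omega
        rcases this with h|h|h|h <;> rw [h] <;> nlinarith [sq_nonneg (w.1-v.1), sq_nonneg (w.2-v.2)]
      nlinarith) hvB
    rw [gr_off hy, sub_self, hh_zero] at this
    have h2 : Real.log d ≤ hh (v - (v.1+d, v.2)) := by
      simp only [hh, Prod.fst_sub, Prod.snd_sub]; push_cast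
      have : Real.log ((d:ℝ)^2) ≤ Real.log (((v.1:ℝ) - (v.1+d))^2 + ((v.2:ℝ)-v.2)^2 + 1) :=
        Real.log_le_log (by positivity) (by ring_nf; linarith)
      rw [Real.log_pow] at this; push_cast at *; linarith
    unfold C1; linarith
  · have hmem := mem_Rc.1 hvI
    have hc : d = v.1 - p.1 ∨ d = q.1 - v.1 ∨ d = v.2 - p.2 ∨ d = q.2 - v.2 := by
      simp only [dR] at hd; omega
    have : gr (Rc p q) v v ≤ Real.log d + C1 := by
      rcases hc with h|h|h|h
      · refine est_up (y := (v.1 - 2*d, v.2)) hv hvI (by rw [mem_Rc]; simp only; omega) (by simp only [Prod.fst_sub, Prod.snd_sub]; ring) (fun x hx w hw => ?_)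
        have := Rc_outer hx hw
        simp only [Prod.fst_sub, Prod.snd_sub]; nlinarith [mul_nonneg hv.le (by linarith : 0 ≤ w.1 - p.1)]
      · refine est_up (y := (v.1 + 2*d, v.2)) hv hvI (by rw [mem_Rc]; simp only; omega) (by simp only [Prod.fst_sub, Prod.snd_sub]; ring) (fun x hx w hw => ?_)
        have := Rc_outer hx hw
        simp only [Prod.fst_sub, Prod.snd_sub]; nlinarith [mul_nonneg hv.le (by linarith : 0 ≤ q.1 - w.1)]
      · refine est_up (y := (v.1, v.2 - 2*d)) hv hvI (by rw [mem_Rc]; simp only; omega) (by simp only [Prod.fst_sub, Prod.snd_sub]; ring) (fun x hx w hw => ?_)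
        have := Rc_outer hx hw
        simp only [Prod.fst_sub, Prod.snd_sub]; nlinarith [mul_nonneg hv.le (by linarith : 0 ≤ w.2 - p.2)]
      · refine est_up (y := (v.1, v.2 + 2*d)) hv hvI (by rw [mem_Rc]; simp only; omega) (by simp only [Prod.fst_sub, Prod.snd_sub]; ring) (fun x hx w hw => ?_)
        have := Rc_outer hx hw
        simp only [Prod.fst_sub, Prod.snd_sub]; nlinarith [mul_nonneg hv.le (by linarith : 0 ≤ q.2 - w.2)]
    linarith

lemma far_sq {p q v c x w : Vtx} {l : ℤ} (hl : 0 ≤ l) (hd : 4 * l ≤ dR p q v) (h1 : |v.1 - c.1| ≤ l) (h2 : |v.2 - c.2| ≤ l)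
    (hx : x ∈ Rc p q) (hw : nbr x w) (hwI : w ∉ Rc p q) :
    (w-v).1^2 + (w-v).2^2 ≤ 5 * ((w-c).1^2 + (w-c).2^2) ∧ (w-c).1^2 + (w-c).2^2 ≤ 5 * ((w-v).1^2 + (w-v).2^2) := by
  have ho := Rc_outer hx hw
  rw [mem_Rc] at hwI
  simp only [dR] at hd
  simp only [Prod.fst_sub, Prod.snd_sub]
  have a1 : (v.1-c.1)^2 ≤ l^2 := by rw [← sq_abs]; gcongr
  have a2 : (v.2-c.2)^2 ≤ l^2 := by rw [← sq_abs]; gcongr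
  have a4 : 16*l^2 ≤ (w.1-v.1)^2 + (w.2-v.2)^2 := by
    have : 4*l ≤ w.1 - v.1 ∨ 4*l ≤ v.1 - w.1 ∨ 4*l ≤ w.2-v.2 ∨ 4*l ≤ v.2-w.2 := by omega
    rcases this with h|h|h|h <;> nlinarith [sq_nonneg (w.1-v.1), sq_nonneg (w.2-v.2)]
  constructor
  · nlinarith [sq_nonneg ((w.1-c.1)+(v.1-c.1)), sq_nonneg ((w.2-c.2)+(v.2-c.2))]
  · nlinarith [sq_nonneg ((w.1-v.1)-(v.1-c.1)), sq_nonneg ((w.2-v.2)-(v.2-c.2))]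

lemma est_diff {p q v c : Vtx} {l : ℤ} (hl : 0 ≤ l) (hv : 0 < dR p q v) (hc : 0 < dR p q c) (hd : 4 * l ≤ dR p q v)
    (h1 : |v.1 - c.1| ≤ l) (h2 : |v.2 - c.2| ≤ l) :
    |gr (Rc p q) v v + gr (Rc p q) c c - 2 * gr (Rc p q) v c - 2 * hh (v - c)| ≤ 2 * C1 := by
  have k1 := fun (x : Vtx) (hx : x ∈ Rc p q) => key_green (I := Rc p q) (y := v) (y' := c) (c := 1) (fun x hx w hw hwI =>
    hh_le5 (by have := (far_sq hl hd h1 h2 hx hw hwI).1; linarith)) hx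
  have k2 := fun (x : Vtx) (hx : x ∈ Rc p q) => key_green (I := Rc p q) (y := c) (y' := v) (c := 1) (fun x hx w hw hwI =>
    hh_le5 (by have := (far_sq hl hd h1 h2 hx hw hwI).2; linarith)) hx
  have a := k1 v (mem_Rc_iff.2 hv)
  have b := k1 c (mem_Rc_iff.2 hc)
  have a' := k2 v (mem_Rc_iff.2 hv)
  have b' := k2 c (mem_Rc_iff.2 hc)
  have e : hh (c - v) = hh (v - c) := by
    have h0 : c - v = -(v - c) := by abel
    rw [h0]; simp only [hh, Prod.fst_neg, Prod.snd_neg]; push_cast; rw [neg_sq, neg_sq]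
  rw [sub_self, hh_zero] at a b a' b'
  rw [e] at b b'
  rw [gr_symm _ c v] at b b'
  unfold C1
  rw [abs_le]; constructor <;> linarith

open MeasureTheory ProbabilityTheory

noncomputable def lc (N : ℕ) (c : Vtx → ℝ) (ω : FieldSp) : ℝ := ∑ v ∈ VN N, c v * ω v
noncomputable def Qf (N : ℕ) (c c' : Vtx → ℝ) : ℝ :=
  ∑ v ∈ VN N, ∑ w ∈ VN N, c v * c' w * gr (intr (VN N)) v w
noncomputable def xi (N : ℕ) (k : Vtx → ℝ) : FieldSp → ℝ := lc N (fun z => -(2/Real.pi) * lap k z)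
noncomputable def Cv (N : ℕ) (k k' : Vtx → ℝ) : ℝ := ∑ v ∈ VN N, (-(2/Real.pi) * lap k v) * k' v

lemma intr_sub (B : Finset Vtx) : intr B ⊆ B := Finset.sdiff_subset
lemma mem_intr {B : Finset Vtx} {v : Vtx} : v ∈ intr B ↔ v ∈ B ∧
    ((v.1 + 1, v.2) ∈ B ∧ (v.1 - 1, v.2) ∈ B ∧ (v.1, v.2 + 1) ∈ B ∧ (v.1, v.2 - 1) ∈ B) := by
  simp only [intr, bdry, Finset.mem_sdiff, Finset.mem_filter]; tauto
lemma intr_mono {B B' : Finset Vtx} (h : B ⊆ B') : intr B ⊆ intr B' := fun v hv => by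
  rw [mem_intr] at hv ⊢
  exact ⟨h hv.1, h hv.2.1, h hv.2.2.1, h hv.2.2.2.1, h hv.2.2.2.2⟩

lemma green_unique {N : ℕ} {G : Vtx → Vtx → ℝ} (hG : IsGreenFn (VN N) G) (x y : Vtx) :
    G x y = gr (intr (VN N)) x y := by
  set J := intr (VN N)
  by_cases hy : y ∈ J
  · rw [gr_symm]
    have := mp_zero J (fun x => G x y - gr J y x) (fun x hx => by
      simp [hG.1 x y (Or.inl hx), gr_off hx]) (fun x hx => by
        rw [lap_sub, gr_lap hx]
        have := hG.2 y hy x hx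
        simp only [lap]
        split_ifs at * <;> linarith) x
    linarith
  · rw [hG.1 x y (Or.inr hy), gr_off hy]

lemma lc_meas (N : ℕ) (c : Vtx → ℝ) : Measurable (lc N c) := by
  unfold lc
  exact Finset.measurable_sum _ (fun v _ => (measurable_pi_apply v).const_mul _)

lemma gff_law {N : ℕ} {P : Measure FieldSp} (h : IsGFF N P) (c : Vtx → ℝ) :
    P.map (lc N c) = gaussianReal 0 (Real.toNNReal (Qf N c c)) := by
  obtain ⟨-, G, hG, hl⟩ := h
  have := hl c
  simp only [green_unique hG] at this
  exact this

lemma lc_memLp {N : ℕ} {P : Measure FieldSp} (h : IsGFF N P) (c : Vtx → ℝ) : MemLp (lc N c) 2 P := by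
  have := h.1
  have h1 : MemLp id 2 (P.map (lc N c)) := by rw [gff_law h c]; exact memLp_id_gaussianReal 2
  exact (memLp_map_measure_iff (by fun_prop) (lc_meas N c).aemeasurable).1 h1

lemma lc_var {N : ℕ} {P : Measure FieldSp} (h : IsGFF N P) (c : Vtx → ℝ) :
    Var[lc N c; P] = Real.toNNReal (Qf N c c) := by
  rw [← variance_id_map (lc_meas N c).aemeasurable, gff_law h c, variance_id_gaussianReal]

lemma lc_single {N : ℕ} {v : Vtx} (hv : v ∈ VN N) (a : ℝ) : lc N (fun z => if z = v then a else 0) = fun ω => a * ω v := by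
  funext ω; simp [lc, hv]

lemma Qf_single {N : ℕ} {v w : Vtx} (hv : v ∈ VN N) (hw : w ∈ VN N) :
    Qf N (fun z => if z = v then 1 else 0) (fun z => if z = w then 1 else 0) = gr (intr (VN N)) v w := by
  simp [Qf, ite_mul, hv, hw]

lemma Qf_add (N : ℕ) (c c' : Vtx → ℝ) : Qf N (fun z => c z + c' z) (fun z => c z + c' z) =
    Qf N c c + 2 * Qf N c c' + Qf N c' c' := by
  have e : Qf N c' c = Qf N c c' := by
    unfold Qf; rw [Finset.sum_comm]
    refine Finset.sum_congr rfl fun v _ => Finset.sum_congr rfl fun w _ => ?_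
    rw [gr_symm]; ring
  have : Qf N (fun z => c z + c' z) (fun z => c z + c' z) = Qf N c c + Qf N c c' + Qf N c' c + Qf N c' c' := by
    unfold Qf
    simp only [← Finset.sum_add_distrib]
    refine Finset.sum_congr rfl fun v _ => Finset.sum_congr rfl fun w _ => ?_
    ring
  rw [this, e]; ring

lemma cov_phi {N : ℕ} {P : Measure FieldSp} (h : IsGFF N P) {v w : Vtx} (hv : v ∈ VN N) (hw : w ∈ VN N) :
    cov[fun ω : FieldSp => ω v, fun ω : FieldSp => ω w; P] = gr (intr (VN N)) v w := by
  have := h.1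
  set c1 : Vtx → ℝ := fun z => if z = v then 1 else 0
  set c2 : Vtx → ℝ := fun z => if z = w then 1 else 0
  have e1 : lc N c1 = fun ω => ω v := by rw [lc_single hv]; simp
  have e2 : lc N c2 = fun ω => ω w := by rw [lc_single hw]; simp
  rw [← e1, ← e2]
  have ha := variance_fun_add (lc_memLp h c1) (lc_memLp h c2)
  have e3 : (fun ω => lc N c1 ω + lc N c2 ω) = lc N (fun z => c1 z + c2 z) := by
    funext ω; simp only [lc, ← Finset.sum_add_distrib, add_mul]
  rw [e3, lc_var h, lc_var h, lc_var h, Qf_add, Qf_single hv hv, Qf_single hv hw, Qf_single hw hw] at ha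
  have g1 := gr_nonneg (intr (VN N)) v v
  have g2 := gr_nonneg (intr (VN N)) v w
  have g3 := gr_nonneg (intr (VN N)) w w
  rw [Real.coe_toNNReal _ g1, Real.coe_toNNReal _ g3, Real.coe_toNNReal _ (by positivity)] at ha
  linarith

lemma phi_memLp {N : ℕ} {P : Measure FieldSp} (h : IsGFF N P) {v : Vtx} (hv : v ∈ VN N) :
    MemLp (fun ω : FieldSp => ω v) 2 P := by
  have := lc_memLp h (fun z => if z = v then 1 else 0)
  rw [lc_single hv] at this; simpa using this

lemma cov_lc {N : ℕ} {P : Measure FieldSp} (h : IsGFF N P) (c c' : Vtx → ℝ) :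
    cov[lc N c, lc N c'; P] = Qf N c c' := by
  have := h.1
  unfold lc
  rw [covariance_fun_sum_fun_sum' (fun i hi => (phi_memLp h hi).const_mul _) (fun i hi => (phi_memLp h hi).const_mul _)]
  unfold Qf
  refine Finset.sum_congr rfl fun v hv => Finset.sum_congr rfl fun w hw => ?_
  rw [covariance_const_mul_left, covariance_const_mul_right, cov_phi h hv hw]; ring

lemma Qf_nonneg {N : ℕ} {P : Measure FieldSp} (h : IsGFF N P) (c : Vtx → ℝ) : 0 ≤ Qf N c c := by
  have := h.1
  rw [← cov_lc h, covariance_self (lc_meas N c).aemeasurable]; exact variance_nonneg _ _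

lemma sum_gr {N : ℕ} {k : Vtx → ℝ} (hk : ∀ x ∉ intr (VN N), k x = 0) (v : Vtx) :
    ∑ w ∈ VN N, (-(2/Real.pi) * lap k w) * gr (intr (VN N)) v w = k v := by
  rw [gr_rep hk v, Finset.mul_sum]
  symm
  rw [← Finset.sum_subset (intr_sub (VN N)) (fun w _ hw => by simp [gr_off hw])]
  exact Finset.sum_congr rfl (fun w _ => by ring)

lemma Qf_xi {N : ℕ} {k : Vtx → ℝ} (hk : ∀ x ∉ intr (VN N), k x = 0) (c : Vtx → ℝ) :
    Qf N c (fun z => -(2/Real.pi) * lap k z) = ∑ v ∈ VN N, c v * k v := by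
  unfold Qf
  refine Finset.sum_congr rfl fun v _ => ?_
  rw [← sum_gr hk v, Finset.mul_sum]
  exact Finset.sum_congr rfl fun w _ => by ring

lemma xi_law {N : ℕ} {P : Measure FieldSp} (h : IsGFF N P) {k : Vtx → ℝ} (hk : ∀ x ∉ intr (VN N), k x = 0) :
    P.map (xi N k) = gaussianReal 0 (Real.toNNReal (Cv N k k)) := by
  unfold xi; rw [gff_law h, Qf_xi hk]; rfl

lemma Cv_nonneg {N : ℕ} {P : Measure FieldSp} (h : IsGFF N P) {k : Vtx → ℝ} (hk : ∀ x ∉ intr (VN N), k x = 0) :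
    0 ≤ Cv N k k := by
  have := Qf_nonneg h (fun z => -(2/Real.pi) * lap k z)
  rwa [Qf_xi hk] at this

lemma Cv_symm {N : ℕ} {k k' : Vtx → ℝ} (hk : ∀ x ∉ intr (VN N), k x = 0) (hk' : ∀ x ∉ intr (VN N), k' x = 0) :
    Cv N k k' = Cv N k' k := by
  rw [Cv, ← Qf_xi hk', Cv, ← Qf_xi hk]
  unfold Qf; rw [Finset.sum_comm]
  refine Finset.sum_congr rfl fun v _ => Finset.sum_congr rfl fun w _ => ?_
  rw [gr_symm]; ring

lemma Cv_gr {N : ℕ} {I : Finset Vtx} (hI : I ⊆ VN N) {k' : Vtx → ℝ} (hk' : ∀ x ∉ I, k' x = 0) (v : Vtx) :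
    Cv N (gr I v) k' = k' v := by
  unfold Cv
  rw [← Finset.sum_subset hI (fun w _ hw => by simp [hk' w hw]),
    Finset.sum_congr (g := fun z => if z = v then k' z else 0) rfl (fun w hw => by
    rw [gr_lap hw]
    split_ifs
    · field_simp
    · simp)]
  rw [Finset.sum_ite_eq']
  split_ifs with h
  · rfl
  · rw [hk' v h]

lemma Cv_sum_left {ι : Type*} (N : ℕ) (s : Finset ι) (a : ι → ℝ) (k : ι → Vtx → ℝ) (k' : Vtx → ℝ) :
    Cv N (fun z => ∑ i ∈ s, a i * k i z) k' = ∑ i ∈ s, a i * Cv N (k i) k' := by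
  simp only [Cv, lap_sum, lap_smul, Finset.mul_sum, Finset.sum_mul]
  rw [Finset.sum_comm]
  refine Finset.sum_congr rfl fun v _ => Finset.sum_congr rfl fun w _ => by ring
lemma Cv_sum_right {ι : Type*} (N : ℕ) (s : Finset ι) (a : ι → ℝ) (k : ι → Vtx → ℝ) (k' : Vtx → ℝ) :
    Cv N k' (fun z => ∑ i ∈ s, a i * k i z) = ∑ i ∈ s, a i * Cv N k' (k i) := by
  simp only [Cv, Finset.mul_sum]
  rw [Finset.sum_comm]
  refine Finset.sum_congr rfl fun v _ => Finset.sum_congr rfl fun w _ => by ring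
lemma Cv_sub_left (N : ℕ) (k1 k2 k' : Vtx → ℝ) : Cv N (fun z => k1 z - k2 z) k' = Cv N k1 k' - Cv N k2 k' := by
  simp only [Cv, lap_sub, ← Finset.sum_sub_distrib]
  refine Finset.sum_congr rfl fun v _ => by ring
lemma Cv_sub_right (N : ℕ) (k1 k2 k' : Vtx → ℝ) : Cv N k' (fun z => k1 z - k2 z) = Cv N k' k1 - Cv N k' k2 := by
  simp only [Cv, ← Finset.sum_sub_distrib]
  refine Finset.sum_congr rfl fun v _ => by ring

lemma xi_sum {ι : Type*} (N : ℕ) (s : Finset ι) (a : ι → ℝ) (k : ι → Vtx → ℝ) (ω : FieldSp) :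
    xi N (fun z => ∑ i ∈ s, a i * k i z) ω = ∑ i ∈ s, a i * xi N (k i) ω := by
  simp only [xi, lc, lap_sum, lap_smul, Finset.mul_sum, Finset.sum_mul]
  rw [Finset.sum_comm]
  refine Finset.sum_congr rfl fun v _ => Finset.sum_congr rfl fun w _ => by ring
lemma xi_sub (N : ℕ) (k1 k2 : Vtx → ℝ) (ω : FieldSp) : xi N (fun z => k1 z - k2 z) ω = xi N k1 ω - xi N k2 ω := by
  simp only [xi, lc, lap_sub, ← Finset.sum_sub_distrib]
  refine Finset.sum_congr rfl fun v _ => by ring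
lemma xi_add (N : ℕ) (k1 k2 : Vtx → ℝ) (ω : FieldSp) : xi N (fun z => k1 z + k2 z) ω = xi N k1 ω + xi N k2 ω := by
  simp only [xi, lc, lap_add, ← Finset.sum_add_distrib]
  refine Finset.sum_congr rfl fun v _ => by ring
lemma xi_smul (N : ℕ) (a : ℝ) (k : Vtx → ℝ) (ω : FieldSp) : xi N (fun z => a * k z) ω = a * xi N k ω := by
  simp only [xi, lc, lap_smul, Finset.mul_sum]
  refine Finset.sum_congr rfl fun v _ => by ring
lemma Cv_smul (N : ℕ) (a : ℝ) (k : Vtx → ℝ) : Cv N (fun z => a * k z) (fun z => a * k z) = a^2 * Cv N k k := by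
  simp only [Cv, lap_smul, Finset.mul_sum]
  refine Finset.sum_congr rfl fun v _ => by ring
lemma xi_meas (N : ℕ) (k : Vtx → ℝ) : Measurable (xi N k) := lc_meas _ _

lemma xi_mgf {N : ℕ} {P : Measure FieldSp} (h : IsGFF N P) {k : Vtx → ℝ} (hk : ∀ x ∉ intr (VN N), k x = 0) :
    Integrable (fun ω => Real.exp (xi N k ω)) P ∧ ∫ ω, Real.exp (xi N k ω) ∂P = Real.exp (Cv N k k / 2) := by
  have := h.1
  have hl := xi_law h hk
  constructor
  · have h1 := integrable_exp_mul_gaussianReal (μ := 0) (v := Real.toNNReal (Cv N k k)) 1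
    rw [← hl] at h1
    have := h1.comp_measurable (xi_meas N k)
    simpa [Function.comp_def] using this
  · have := mgf_gaussianReal hl 1
    simp only [mgf, one_mul, zero_mul, zero_add, one_pow, mul_one] at this
    rw [this, Real.coe_toNNReal _ (Cv_nonneg h hk)]

lemma phi_gaussian {N : ℕ} {P : Measure FieldSp} (h : IsGFF N P) :
    HasGaussianLaw (fun (ω : FieldSp) (v : VN N) => ω v) P := by
  have := h.1
  have hm : Measurable (fun (ω : FieldSp) (v : VN N) => ω v) := by fun_prop
  constructor
  apply isGaussian_of_map_eq_gaussianReal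
  intro L
  refine ⟨0, Real.toNNReal (Qf N (fun v => if hv : v ∈ VN N then L (Pi.single ⟨v, hv⟩ 1) else 0)
    (fun v => if hv : v ∈ VN N then L (Pi.single ⟨v, hv⟩ 1) else 0)), ?_⟩
  rw [Measure.map_map (by fun_prop) hm, ← gff_law h]
  congr 1
  funext ω
  simp only [Function.comp_apply, lc]
  rw [← Finset.sum_coe_sort]
  refine Eq.trans (LinearMap.pi_apply_eq_sum_univ (L : (VN N → ℝ) →ₗ[ℝ] ℝ) (fun v : VN N => ω v)) ?_
  refine Finset.sum_congr rfl fun v _ => ?_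
  simp only [smul_eq_mul, Finset.coe_mem, dif_pos]
  rw [mul_comm]; congr 1
  show L _ = L _
  congr 1; funext j; simp [Pi.single_apply, eq_comm]

lemma scaleAlg_le (N : ℕ) (lam : ℝ) (v : Vtx) : scaleAlg N lam v ≤ (inferInstance : MeasurableSpace FieldSp) := by
  unfold scaleAlg
  exact iSup₂_le fun w _ => (measurable_pi_apply w).comap_le

lemma nbhd_sub {N : ℕ} {lam : ℝ} {v : Vtx} (hv : v ∈ VN N) : nbhd N lam v ⊆ VN N := by
  unfold nbhd; split_ifs
  · rfl
  · simpa using hv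
  · exact Finset.filter_subset _ _

lemma xi_indep {N : ℕ} {P : Measure FieldSp} (h : IsGFF N P) {I : Finset Vtx} {k : Vtx → ℝ}
    (hk : ∀ x ∉ intr (VN N), k x = 0) (hkI : ∀ x ∉ I, k x = 0) :
    IndepFun (xi N k) (fun (ω : FieldSp) (w : {w : Vtx // w ∈ VN N ∧ w ∉ I}) => ω w) P := by
  have := h.1
  have : Finite {w : Vtx // w ∈ VN N ∧ w ∉ I} := Finite.of_injective (fun w => (⟨w.1, w.2.1⟩ : VN N)) (fun a b hab => by
    simpa [Subtype.ext_iff] using hab)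
  have : Fintype {w : Vtx // w ∈ VN N ∧ w ∉ I} := Fintype.ofFinite _
  apply HasGaussianLaw.indepFun_of_covariance_strongDual
  · let L : (VN N → ℝ) →ₗ[ℝ] ℝ × ({w : Vtx // w ∈ VN N ∧ w ∉ I} → ℝ) :=
      { toFun := fun x => (∑ v : VN N, (-(2/Real.pi) * lap k v) * x v, fun w => x ⟨w.1, w.2.1⟩)
        map_add' := fun x y => by ext <;> simp [mul_add, Finset.sum_add_distrib]
        map_smul' := fun a x => by
          ext
          · simp only [Pi.smul_apply, smul_eq_mul, RingHom.id_apply, Prod.smul_fst, Finset.mul_sum]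
            refine Finset.sum_congr rfl fun v _ => by ring
          · simp }
    have := (phi_gaussian h).map L.toContinuousLinearMap
    have e : (fun ω : FieldSp => (xi N k ω, fun w : {w : Vtx // w ∈ VN N ∧ w ∉ I} => ω w)) =
        (L.toContinuousLinearMap ∘ fun (ω : FieldSp) (v : VN N) => ω v) := by
      funext ω
      simp only [Function.comp_apply, LinearMap.coe_toContinuousLinearMap', L, LinearMap.coe_mk, AddHom.coe_mk, xi, lc]
      congr 1
      rw [← Finset.sum_coe_sort]
    rw [e]
    exact this
  · intro L1 L2
    have e1 : L1 ∘ xi N k = fun ω => L1 1 * xi N k ω := by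
      funext ω; simp only [Function.comp_apply]
      have := L1.map_smul (xi N k ω) 1
      simp only [smul_eq_mul, mul_one] at this; rw [this, mul_comm]
    let c : Vtx → ℝ := fun w => if hw : w ∈ VN N ∧ w ∉ I then L2 (Pi.single ⟨w, hw⟩ 1) else 0
    have e2 : L2 ∘ (fun (ω : FieldSp) (w : {w : Vtx // w ∈ VN N ∧ w ∉ I}) => ω w) = lc N c := by
      funext ω
      simp only [Function.comp_apply, lc]
      rw [← Finset.sum_subset (s₁ := (VN N).filter (fun w => w ∉ I)) (Finset.filter_subset _ _) (fun w hw hw2 => by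
        have : ¬ (w ∈ VN N ∧ w ∉ I) := by rw [Finset.mem_filter] at hw2; exact hw2
        simp [c, dif_neg this])]
      have e4 := Finset.sum_subtype (F := this) ((VN N).filter (fun w => w ∉ I)) (p := fun w => w ∈ VN N ∧ w ∉ I) (by simp) (fun w => c w * ω w)
      rw [e4]
      refine Eq.trans (LinearMap.pi_apply_eq_sum_univ (L2 : ({w : Vtx // w ∈ VN N ∧ w ∉ I} → ℝ) →ₗ[ℝ] ℝ) (fun w => ω w)) ?_
      refine Finset.sum_congr rfl fun v _ => ?_
      have : c v = L2 (Pi.single v 1) := dif_pos v.2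
      rw [smul_eq_mul, mul_comm, this]; congr 1
      show L2 _ = L2 _
      congr 1; funext j; simp [Pi.single_apply, eq_comm]
    rw [e1, e2, covariance_const_mul_left, covariance_comm, xi, cov_lc h, Qf_xi hk]
    rw [Finset.sum_eq_zero, mul_zero]
    intro v _
    by_cases hv : v ∈ I
    · have : ¬ (v ∈ VN N ∧ v ∉ I) := fun h => h.2 hv
      simp [c, dif_neg this]
    · simp [hkI v hv]

lemma xi_mean {N : ℕ} {P : Measure FieldSp} (h : IsGFF N P) (k : Vtx → ℝ) : ∫ ω, xi N k ω ∂P = 0 := by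
  have hl := gff_law h (fun z => -(2/Real.pi) * lap k z)
  have := integral_map (μ := P) (xi_meas N k).aemeasurable (f := id) (by fun_prop)
  simp only [id] at this
  rw [← this]; unfold xi; rw [hl]; simp

lemma phiScale_eq {N : ℕ} {P : Measure FieldSp} (h : IsGFF N P) {v : Vtx} (hv : v ∈ VN N) (lam : ℝ) :
    phiScale N P v lam =ᵐ[P] fun ω => ω v - xi N (gr (intr (nbhd N lam v)) v) ω := by
  have := h.1
  set I := intr (nbhd N lam v) with hI
  have hIJ : I ⊆ intr (VN N) := intr_mono (nbhd_sub hv)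
  have hIV : I ⊆ VN N := hIJ.trans (intr_sub _)
  set X := xi N (gr I v)
  have hle := scaleAlg_le N lam v
  have hkI : ∀ x ∉ I, gr I v x = 0 := fun x hx => gr_off hx
  have hind := xi_indep h (k := gr I v) (fun x hx => gr_off (fun hx' => hx (hIJ hx'))) hkI
  have hlam : scaleAlg N lam v ≤ MeasurableSpace.comap (fun (ω : FieldSp) (w : {w : Vtx // w ∈ VN N ∧ w ∉ I}) => ω w) inferInstance := by
    unfold scaleAlg
    refine iSup₂_le fun w hw => ?_
    rw [← measurable_iff_comap_le]
    exact (show Measurable (fun f : {w : Vtx // w ∈ VN N ∧ w ∉ I} → ℝ => f ⟨w, hw⟩) from measurable_pi_apply _).comp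
      (comap_measurable (fun (ω : FieldSp) (w : {w : Vtx // w ∈ VN N ∧ w ∉ I}) => ω w))
  have hind2 : Indep (MeasurableSpace.comap X inferInstance) (scaleAlg N lam v) P :=
    indep_of_indep_of_le_right hind hlam
  have hX : P[X | scaleAlg N lam v] =ᵐ[P] fun _ => P[X] :=
    condExp_indep_eq (xi_meas N _).comap_le hle (comap_measurable X).stronglyMeasurable hind2
  have hint : Integrable (fun ω : FieldSp => ω v) P := (phi_memLp h hv).integrable one_le_two
  have hintX : Integrable X P := (lc_memLp h _).integrable one_le_two
  have hmeas : StronglyMeasurable[scaleAlg N lam v] (fun ω : FieldSp => ω v - X ω) := by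
    have e : (fun ω : FieldSp => ω v - X ω) = fun ω => ∑ z ∈ (VN N).filter (fun z => z ∉ I),
        ((if z = v then 1 else 0) + (2/Real.pi) * lap (gr I v) z) * ω z := by
      funext ω
      rw [Finset.sum_filter_of_ne (fun z hz hne hzI => by
        apply hne
        rw [gr_lap hzI]
        split_ifs
        · have := Real.pi_pos
          field_simp
          try norm_num
        · simp)]
      simp only [X, xi, lc, add_mul, Finset.sum_add_distrib, ite_mul, one_mul, zero_mul, Finset.sum_ite_eq', hv, if_true,
        neg_mul, Finset.sum_neg_distrib, sub_neg_eq_add]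
    rw [e]
    apply Measurable.stronglyMeasurable
    refine Finset.measurable_sum _ (fun z hz => Measurable.const_mul ?_ _)
    rw [Finset.mem_filter] at hz
    rw [measurable_iff_comap_le]
    unfold scaleAlg
    exact le_iSup₂ (f := fun w (_ : w ∈ {w : Vtx | w ∈ VN N ∧ w ∉ intr (nbhd N lam v)}) => MeasurableSpace.comap (fun ω : FieldSp => ω w) inferInstance) z hz
  have h1 : P[fun ω : FieldSp => ω v - X ω | scaleAlg N lam v] = fun ω => ω v - X ω :=
    condExp_of_stronglyMeasurable hle hmeas (hint.sub hintX)
  have h2 : P[fun ω : FieldSp => (ω v - X ω) + X ω | scaleAlg N lam v] =ᵐ[P] _ := condExp_add (hint.sub hintX) hintX _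
  simp only [sub_add_cancel] at h2
  unfold phiScale
  filter_upwards [h2, hX] with ω a b
  rw [a, Pi.add_apply, b]
  rw [show ∫ ω, X ω ∂P = 0 from xi_mean h _, add_zero]
  exact congrFun h1 ω

def Whp (P : ℕ → Measure FieldSp) (A : ℕ → Set FieldSp) : Prop :=
  Tendsto (fun N => P N (A N)ᶜ) atTop (nhds 0)

lemma Whp.mono2 {P : ℕ → Measure FieldSp} {A B D : ℕ → Set FieldSp} (hA : Whp P A) (hB : Whp P B)
    (h : ∀ᶠ N in atTop, A N ∩ B N ⊆ D N) : Whp P D := by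
  have h0 : Tendsto (fun N => P N (A N)ᶜ + P N (B N)ᶜ) atTop (nhds 0) := by
    simpa using Filter.Tendsto.add hA hB
  refine tendsto_of_tendsto_of_tendsto_of_le_of_le' tendsto_const_nhds h0
    (Eventually.of_forall fun _ => zero_le) ?_
  filter_upwards [h] with N hN
  refine le_trans (measure_mono ?_) (measure_union_le _ _)
  rw [← Set.compl_inter]; exact Set.compl_subset_compl.2 hN

lemma Whp.mono {P : ℕ → Measure FieldSp} {A B : ℕ → Set FieldSp} (hA : Whp P A)
    (h : ∀ᶠ N in atTop, A N ⊆ B N) : Whp P B :=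
  hA.mono2 hA (h.mono fun N hN => by rw [Set.inter_self]; exact hN)

lemma Whp.all {P : ℕ → Measure FieldSp} {A : ℕ → ℕ → Set FieldSp} (n : ℕ) (h : ∀ k < n, Whp P (A k)) :
    Whp P (fun N => {ω | ∀ k < n, ω ∈ A k N}) := by
  induction n with
  | zero => simp [Whp]
  | succ n ih =>
    refine (ih fun k hk => h k (by omega)).mono2 (h n (by omega)) (Eventually.of_forall fun N ω hω k hk => ?_)
    rcases Nat.lt_succ_iff_lt_or_eq.1 hk with h1 | h1
    · exact hω.1 k h1
    · rw [h1]; exact hω.2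

lemma sum_exp_bd {N : ℕ} {P : Measure FieldSp} (h : IsGFF N P) {ι : Type*} (S : Finset ι) (k : ι → Vtx → ℝ)
    (hk : ∀ i ∈ S, ∀ x ∉ intr (VN N), k i x = 0) (V a : ℝ) (hV : ∀ i ∈ S, Cv N (k i) (k i) ≤ V) :
    P {ω | ∑ i ∈ S, Real.exp (xi N (k i) ω) < Real.exp a}ᶜ ≤ ENNReal.ofReal (S.card * Real.exp (V/2 - a)) := by
  have := h.1
  have hint : Integrable (fun ω => ∑ i ∈ S, Real.exp (xi N (k i) ω)) P :=
    integrable_finset_sum _ fun i hi => (xi_mgf h (hk i hi)).1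
  have hI : ∫ ω, ∑ i ∈ S, Real.exp (xi N (k i) ω) ∂P ≤ S.card * Real.exp (V/2) := by
    rw [integral_finset_sum _ fun i hi => (xi_mgf h (hk i hi)).1, ← nsmul_eq_mul]
    refine Finset.sum_le_card_nsmul _ _ _ fun i hi => ?_
    rw [(xi_mgf h (hk i hi)).2]
    exact Real.exp_le_exp.2 (by linarith [hV i hi])
  have hM := mul_meas_ge_le_integral_of_nonneg (μ := P) (f := fun ω => ∑ i ∈ S, Real.exp (xi N (k i) ω))
    (Eventually.of_forall fun ω => Finset.sum_nonneg fun i _ => (Real.exp_pos _).le) hint (Real.exp a)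
  have e : {ω | ∑ i ∈ S, Real.exp (xi N (k i) ω) < Real.exp a}ᶜ = {ω | Real.exp a ≤ ∑ i ∈ S, Real.exp (xi N (k i) ω)} := by
    ext ω; simp
  rw [e, ENNReal.le_ofReal_iff_toReal_le (measure_ne_top _ _) (by positivity)]
  have : P.real {ω | Real.exp a ≤ ∑ i ∈ S, Real.exp (xi N (k i) ω)} ≤ (S.card * Real.exp (V/2)) / Real.exp a := by
    rw [le_div_iff₀ (Real.exp_pos _), mul_comm]; exact hM.trans hI
  rw [Real.exp_sub, ← mul_div_assoc]; exact this

lemma logN_top : Tendsto (fun N : ℕ => Real.log N) atTop atTop :=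
  Real.tendsto_log_atTop.comp tendsto_natCast_atTop_atTop

lemma Whp_sum {P : ℕ → Measure FieldSp} (h : ∀ N, IsGFF N (P N)) {ι : Type*} (S : ℕ → Finset ι)
    (k : ℕ → ι → Vtx → ℝ) (A C p q a : ℝ) (hpq : p + q/2 < a)
    (hc : ∀ᶠ N : ℕ in atTop, ((S N).card : ℝ) ≤ A * Real.exp (p * Real.log N))
    (hk : ∀ᶠ N in atTop, ∀ i ∈ S N, ∀ x ∉ intr (VN N), k N i x = 0)
    (hV : ∀ᶠ N : ℕ in atTop, ∀ i ∈ S N, Cv N (k N i) (k N i) ≤ q * Real.log N + C) :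
    Whp P (fun N => {ω | ∑ i ∈ S N, Real.exp (xi N (k N i) ω) < Real.exp (a * Real.log N)}) := by
  have h0 : Tendsto (fun N : ℕ => ENNReal.ofReal (A * Real.exp (C/2) * Real.exp (-((a - p - q/2) * Real.log N)))) atTop (nhds 0) := by
    rw [← ENNReal.ofReal_zero]
    apply ENNReal.tendsto_ofReal
    rw [← mul_zero (A * Real.exp (C/2))]
    refine Tendsto.const_mul _ (Real.tendsto_exp_neg_atTop_nhds_zero.comp ?_)
    exact logN_top.const_mul_atTop (by linarith)
  refine tendsto_of_tendsto_of_tendsto_of_le_of_le' tendsto_const_nhds h0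
    (Eventually.of_forall fun _ => zero_le) ?_
  filter_upwards [hc, hk, hV] with N h1 h2 h3
  refine (sum_exp_bd (h N) (S N) (k N) h2 _ _ h3).trans (ENNReal.ofReal_le_ofReal ?_)
  calc _ ≤ A * Real.exp (p * Real.log N) * Real.exp ((q * Real.log N + C)/2 - a * Real.log N) := by gcongr
    _ = _ := by rw [mul_assoc, mul_assoc, ← Real.exp_add, ← Real.exp_add]; congr 2; ring

lemma Whp_lt {P : ℕ → Measure FieldSp} (h : ∀ N, IsGFF N (P N)) {ι : Type*} (S : ℕ → Finset ι)
    (k : ℕ → ι → Vtx → ℝ) (A C p q a : ℝ) (hpq : p + q/2 < a)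
    (hc : ∀ᶠ N : ℕ in atTop, ((S N).card : ℝ) ≤ A * Real.exp (p * Real.log N))
    (hk : ∀ᶠ N in atTop, ∀ i ∈ S N, ∀ x ∉ intr (VN N), k N i x = 0)
    (hV : ∀ᶠ N : ℕ in atTop, ∀ i ∈ S N, Cv N (k N i) (k N i) ≤ q * Real.log N + C) :
    Whp P (fun N => {ω | ∀ i ∈ S N, xi N (k N i) ω < a * Real.log N}) := by
  refine (Whp_sum h S k A C p q a hpq hc hk hV).mono (Eventually.of_forall fun N ω hω i hi => ?_)
  rw [← Real.exp_lt_exp]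
  exact (Finset.single_le_sum (f := fun i => Real.exp (xi N (k N i) ω)) (fun i _ => (Real.exp_pos _).le) hi).trans_lt hω

lemma Whp_small {P : ℕ → Measure FieldSp} (h : ∀ N, IsGFF N (P N)) {ι : Type*} (S : ℕ → Finset ι)
    (k : ℕ → ι → Vtx → ℝ) (A C p η : ℝ) (hη : 0 < η) (hp : 0 ≤ p)
    (hc : ∀ᶠ N : ℕ in atTop, ((S N).card : ℝ) ≤ A * Real.exp (p * Real.log N))
    (hk : ∀ᶠ N in atTop, ∀ i ∈ S N, ∀ x ∉ intr (VN N), k N i x = 0)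
    (hV : ∀ᶠ N : ℕ in atTop, ∀ i ∈ S N, Cv N (k N i) (k N i) ≤ C) :
    Whp P (fun N => {ω | ∀ i ∈ S N, |xi N (k N i) ω| < η * Real.log N}) := by
  have key : ∀ R : ℝ, p < R * η → Whp P (fun N => {ω | ∀ i ∈ S N, xi N (fun z => R * k N i z) ω < (R * η) * Real.log N}) := by
    intro R hR
    refine Whp_lt h S (fun N i z => R * k N i z) A (R^2 * C) p 0 (R*η) (by linarith) hc
      (hk.mono fun N hN i hi x hx => by rw [hN i hi x hx, mul_zero]) (hV.mono fun N hN i hi => ?_)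
    rw [Cv_smul]; have := hN i hi; nlinarith [sq_nonneg R]
  have key2 : ∀ R : ℝ, p < R * η → Whp P (fun N => {ω | ∀ i ∈ S N, xi N (fun z => (-R) * k N i z) ω < (R * η) * Real.log N}) := by
    intro R hR
    refine Whp_lt h S (fun N i z => (-R) * k N i z) A (R^2 * C) p 0 (R*η) (by linarith) hc
      (hk.mono fun N hN i hi x hx => by rw [hN i hi x hx, mul_zero]) (hV.mono fun N hN i hi => ?_)
    rw [Cv_smul]; have := hN i hi; nlinarith [sq_nonneg R]
  have hR : p < (p+1)/η * η := by field_simp; linarith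
  have hR0 : 0 < (p+1)/η := by positivity
  refine (key _ hR).mono2 (key2 _ hR) (Eventually.of_forall fun N ω hω i hi => ?_)
  have h1 := hω.1 i hi
  have h2 := hω.2 i hi
  rw [xi_smul] at h1 h2
  rw [abs_lt]
  constructor <;> nlinarith

/- chains -/
lemma chain_var {N : ℕ} {I : ℕ → Finset Vtx} (hI : ∀ k, I (k+1) ⊆ I k) (h0 : I 0 ⊆ intr (VN N)) (a : ℕ → ℝ) (K : ℕ) (v : Vtx) :
    Cv N (fun z => ∑ k ∈ Finset.range K, a k * (gr (I k) v z - gr (I (k+1)) v z))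
      (fun z => ∑ k ∈ Finset.range K, a k * (gr (I k) v z - gr (I (k+1)) v z)) =
    ∑ k ∈ Finset.range K, a k ^ 2 * (gr (I k) v v - gr (I (k+1)) v v) := by
  have hanti : Antitone I := antitone_nat_of_succ_le hI
  have hJ : ∀ k, I k ⊆ intr (VN N) := fun k => (hanti (Nat.zero_le k)).trans h0
  have hV : ∀ k, I k ⊆ VN N := fun k => (hJ k).trans (intr_sub _)
  have hs : ∀ k, ∀ x ∉ I k, gr (I k) v x - gr (I (k+1)) v x = 0 := fun k x hx => by
    rw [gr_off hx, gr_off (fun h => hx (hI k h)), sub_zero]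
  have hsJ : ∀ k, ∀ x ∉ intr (VN N), gr (I k) v x - gr (I (k+1)) v x = 0 := fun k x hx => hs k x fun h => hx (hJ k h)
  have h1 : ∀ j k, j < k → Cv N (fun z => gr (I j) v z - gr (I (j+1)) v z) (fun z => gr (I k) v z - gr (I (k+1)) v z) = 0 := by
    intro j k hjk
    rw [Cv_sub_left, Cv_gr (hV j) (fun x hx => hs k x fun h => hx (hanti hjk.le h)),
      Cv_gr (hV (j+1)) (fun x hx => hs k x fun h => hx (hanti hjk h)), sub_self]
  have h2 : ∀ k, Cv N (fun z => gr (I k) v z - gr (I (k+1)) v z) (fun z => gr (I k) v z - gr (I (k+1)) v z) = gr (I k) v v - gr (I (k+1)) v v := by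
    intro k
    rw [Cv_sub_left, Cv_gr (hV k) (hs k), Cv_sub_right, Cv_gr (hV (k+1)) (fun x hx => gr_off hx),
      Cv_symm (fun x hx => gr_off fun h => hx (hJ _ h)) (fun x hx => gr_off fun h => hx (hJ _ h)),
      Cv_gr (hV k) (fun x hx => gr_off fun h => hx (hI k h))]
    ring
  rw [Cv_sum_left]
  refine Finset.sum_congr rfl fun j hj => ?_
  rw [Cv_sum_right, Finset.sum_eq_single j, h2]
  · ring
  · intro k _ hkj
    rcases lt_or_gt_of_ne hkj with h | h
    · rw [Cv_symm (hsJ j) (hsJ k), h1 k j h, mul_zero]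
    · rw [h1 j k h, mul_zero]
  · intro h; exact absurd hj h

noncomputable def lgp (d : ℤ) : ℝ := Real.log (max 1 (d:ℝ))
lemma lgp_mono : Monotone lgp := fun a b h => Real.log_le_log (by positivity) (max_le_max le_rfl (by exact_mod_cast h))
lemma lgp_of_pos {d : ℤ} (h : 0 < d) : lgp d = Real.log d := by
  rw [lgp, max_eq_right]; exact_mod_cast h
lemma est' (p q v : Vtx) : |gr (Rc p q) v v - lgp (dR p q v)| ≤ C1 := by
  by_cases h : 0 < dR p q v
  · rw [lgp_of_pos h]; exact est h
  · rw [gr_off (fun h' => h (mem_Rc_iff.1 h')), lgp, max_eq_left (by push Not at h; exact_mod_cast h.trans zero_le_one)]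
    simp; unfold C1; linarith [C0_nonneg]

noncomputable def dV (N : ℕ) (v : Vtx) : ℤ := dR (0,0) (N,N) v
noncomputable def rr (N : ℕ) (t : ℝ) : ℤ := if t = 0 then N else if t = 1 then 0 else ⌊(N:ℝ)^(1-t)/2⌋
noncomputable def Ik (N : ℕ) (t : ℝ) (v : Vtx) : Finset Vtx := intr (nbhd N t v)
def pI (_ : ℕ) (r : ℤ) (v : Vtx) : Vtx := (0,0) ⊔ (v.1 - r, v.2 - r)
def qI (N : ℕ) (r : ℤ) (v : Vtx) : Vtx := ((N:ℤ),(N:ℤ)) ⊓ (v.1 + r, v.2 + r)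

lemma mem_VN {N : ℕ} {v : Vtx} : v ∈ VN N ↔ (0 ≤ v.1 ∧ 0 ≤ v.2) ∧ (v.1 ≤ N ∧ v.2 ≤ N) := by
  simp [VN, Prod.le_def]

lemma abs_sub_floor (a b : ℤ) (x : ℝ) : |(a:ℝ) - b| ≤ x ↔ a ≤ b + ⌊x⌋ ∧ b ≤ a + ⌊x⌋ := by
  rw [abs_le]
  constructor
  · intro ⟨h1, h2⟩
    have e1 : a - b ≤ ⌊x⌋ := Int.le_floor.2 (by push_cast; linarith)
    have e2 : b - a ≤ ⌊x⌋ := Int.le_floor.2 (by push_cast; linarith)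
    constructor <;> linarith
  · intro ⟨h1, h2⟩
    have e1 := Int.le_floor.1 (by linarith : a - b ≤ ⌊x⌋)
    have e2 := Int.le_floor.1 (by linarith : b - a ≤ ⌊x⌋)
    push_cast at e1 e2
    constructor <;> linarith

lemma Ik_eq {N : ℕ} {t : ℝ} {v : Vtx} (hv : v ∈ VN N) : Ik N t v = Rc (pI N (rr N t) v) (qI N (rr N t) v) := by
  rw [mem_VN] at hv
  ext w
  rw [Ik, mem_intr, mem_Rc]
  simp only [pI, qI, Prod.fst_sup, Prod.snd_sup, Prod.fst_inf, Prod.snd_inf, sup_lt_iff, lt_inf_iff]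
  unfold nbhd rr
  split_ifs with h0 h1
  · simp only [mem_VN]; omega
  · simp only [Finset.mem_singleton, Prod.ext_iff]; omega
  · simp only [Finset.mem_filter, mem_VN, abs_sub_floor]; omega

lemma Ik_dR {N : ℕ} (r : ℤ) (v w : Vtx) :
    dR (pI N r v) (qI N r v) w = min (dV N w) (dR (v.1 - r, v.2 - r) (v.1 + r, v.2 + r) w) := dR_inter _ _ _ _ _
lemma Ik_dR_self {N : ℕ} (r : ℤ) (v : Vtx) : dR (pI N r v) (qI N r v) v = min (dV N v) r := by
  rw [Ik_dR]; congr 1; simp only [dR]; omega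

lemma rr_anti {N : ℕ} (hN : 1 ≤ N) {t t' : ℝ} (h0 : 0 ≤ t) (h1 : t' ≤ 1) (h : t ≤ t') : rr N t' ≤ rr N t := by
  have hN' : (1:ℝ) ≤ N := by exact_mod_cast hN
  unfold rr
  by_cases a : t = 0
  · simp only [a, if_true]
    split_ifs
    · exact le_rfl
    · positivity
    · apply Int.floor_le_iff.2
      have : (N:ℝ)^(1-t') ≤ (N:ℝ)^(1:ℝ) := Real.rpow_le_rpow_of_exponent_le hN' (by linarith)
      rw [Real.rpow_one] at this; push_cast; linarith
  · have : 0 < t := lt_of_le_of_ne h0 (Ne.symm a)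
    rw [if_neg (ne_of_gt (by linarith : 0 < t')), if_neg a]
    split_ifs with b c
    · exact le_rfl
    · positivity
    · exfalso; exact b (by linarith)
    · apply Int.floor_le_floor
      have := Real.rpow_le_rpow_of_exponent_le hN' (by linarith : 1 - t' ≤ 1 - t)
      linarith

lemma Ik_anti {N : ℕ} (hN : 1 ≤ N) {v : Vtx} (hv : v ∈ VN N) {t t' : ℝ} (h0 : 0 ≤ t) (h1 : t' ≤ 1) (h : t ≤ t') :
    Ik N t' v ⊆ Ik N t v := by
  rw [Ik_eq hv, Ik_eq hv]
  intro w
  have := rr_anti hN h0 h1 h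
  simp only [mem_Rc, pI, qI, Prod.fst_sup, Prod.snd_sup, Prod.fst_inf, Prod.snd_inf, sup_lt_iff, lt_inf_iff]
  omega

lemma Ik_sub {N : ℕ} {t : ℝ} {v : Vtx} (hv : v ∈ VN N) : Ik N t v ⊆ intr (VN N) := intr_mono (nbhd_sub hv)

lemma intrVN_eq (N : ℕ) : intr (VN N) = Rc (0,0) (N,N) := by
  ext w; rw [mem_intr, mem_Rc]; simp only [mem_VN]; omega

noncomputable def C2 : ℝ := C1 + Real.log 4
lemma log4_pos : 0 < Real.log 4 := Real.log_pos (by norm_num)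
lemma C1_nonneg : 0 ≤ C1 := by unfold C1; linarith [C0_nonneg]
lemma C2_nonneg : 0 ≤ C2 := by unfold C2; linarith [C1_nonneg, log4_pos]

lemma rr_log {N : ℕ} (hN : 1 ≤ N) {t : ℝ} (h0 : 0 ≤ t) (h1 : t ≤ 1) : |lgp (rr N t) - (1-t) * Real.log N| ≤ Real.log 4 := by
  have hN' : (1:ℝ) ≤ N := by exact_mod_cast hN
  unfold rr lgp
  split_ifs with a b
  · subst a; push_cast; rw [max_eq_right hN']; simp [log4_pos.le]
  · subst b; simp [log4_pos.le]
  · have hx : 1 ≤ (N:ℝ)^(1-t) := Real.one_le_rpow hN' (by linarith)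
    rw [← Real.log_rpow (by linarith)]
    set x := (N:ℝ)^(1-t)
    have f1 := Int.floor_le (x/2)
    have f2 := Int.lt_floor_add_one (x/2)
    have u1 : max 1 ((⌊x/2⌋:ℤ):ℝ) ≤ 4 * x := max_le (by linarith) (by linarith)
    have u2 : x ≤ 4 * max 1 ((⌊x/2⌋:ℤ):ℝ) := by
      rcases le_total x 4 with h | h
      · linarith [le_max_left 1 ((⌊x/2⌋:ℤ):ℝ)]
      · linarith [le_max_right 1 ((⌊x/2⌋:ℤ):ℝ)]
    have v1 := Real.log_le_log (by positivity) u1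
    have v2 := Real.log_le_log (by positivity) u2
    rw [Real.log_mul (by norm_num) (by positivity)] at v1 v2
    rw [abs_le]; constructor <;> linarith

lemma g_est {N : ℕ} (hN : 1 ≤ N) {v : Vtx} (hv : v ∈ VN N) {t : ℝ} (h0 : 0 ≤ t) (h1 : t ≤ 1) :
    |gr (Ik N t v) v v - min (lgp (dV N v)) ((1-t) * Real.log N)| ≤ C2 := by
  have e1 := est' (pI N (rr N t) v) (qI N (rr N t) v) v
  rw [Ik_eq hv]
  rw [Ik_dR_self, lgp_mono.map_min] at e1
  have e2 := rr_log hN h0 h1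
  have e3 := abs_min_sub_min_le_max (lgp (dV N v)) (lgp (rr N t)) (lgp (dV N v)) ((1-t) * Real.log N)
  rw [sub_self, abs_zero, max_eq_right (abs_nonneg _)] at e3
  unfold C2
  calc _ ≤ _ := abs_sub_le _ (min (lgp (dV N v)) (lgp (rr N t))) _
    _ ≤ _ := by linarith

noncomputable def ker (N : ℕ) (a t : ℕ → ℝ) (n : ℕ) (v : Vtx) : Vtx → ℝ := fun z =>
  ∑ k ∈ Finset.range n, a k * (gr (Ik N (t k) v) v z - gr (Ik N (t (k+1)) v) v z)

structure Grid (K : ℕ) (t : ℕ → ℝ) : Prop where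
  mono : Monotone t
  zero : t 0 = 0
  one : ∀ k ≥ K, t k = 1
lemma Grid.nn {K : ℕ} {t : ℕ → ℝ} (h : Grid K t) (k : ℕ) : 0 ≤ t k := h.zero ▸ h.mono (Nat.zero_le k)
lemma Grid.le1 {K : ℕ} {t : ℕ → ℝ} (h : Grid K t) (k : ℕ) : t k ≤ 1 := by
  rw [← h.one (max k K) (le_max_right _ _)]; exact h.mono (le_max_left _ _)

lemma ker_supp {N : ℕ} {a t : ℕ → ℝ} {n : ℕ} {v : Vtx} (hv : v ∈ VN N) (x : Vtx) (hx : x ∉ intr (VN N)) : ker N a t n v x = 0 := by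
  refine Finset.sum_eq_zero fun k _ => ?_
  rw [gr_off fun h => hx (Ik_sub hv h), gr_off fun h => hx (Ik_sub hv h)]; simp

lemma ker_var {N : ℕ} (hN : 1 ≤ N) {K : ℕ} {t : ℕ → ℝ} (ht : Grid K t) (a : ℕ → ℝ) (n : ℕ) {v : Vtx} (hv : v ∈ VN N) :
    Cv N (ker N a t n v) (ker N a t n v) = ∑ k ∈ Finset.range n, a k ^ 2 * (gr (Ik N (t k) v) v v - gr (Ik N (t (k+1)) v) v v) :=
  chain_var (I := fun k => Ik N (t k) v) (fun k => Ik_anti hN hv (ht.nn k) (ht.le1 _) (ht.mono (Nat.le_succ k))) (Ik_sub hv) a n v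

lemma ker_var_le {N : ℕ} (hN : 1 ≤ N) {K : ℕ} {t : ℕ → ℝ} (ht : Grid K t) (a : ℕ → ℝ) (n : ℕ) {v : Vtx} (hv : v ∈ VN N) :
    Cv N (ker N a t n v) (ker N a t n v) ≤ (∑ k ∈ Finset.range n, a k ^ 2 * (t (k+1) - t k)) * Real.log N
      + 2 * C2 * ∑ k ∈ Finset.range n, a k ^ 2 := by
  rw [ker_var hN ht a n hv, Finset.sum_mul, Finset.mul_sum, ← Finset.sum_add_distrib]
  refine Finset.sum_le_sum fun k _ => ?_
  have h1 := abs_le.1 (g_est hN hv (ht.nn k) (ht.le1 k))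
  have h2 := abs_le.1 (g_est hN hv (ht.nn (k+1)) (ht.le1 (k+1)))
  have hL : 0 ≤ Real.log N := Real.log_natCast_nonneg N
  have hm := mul_nonneg (sub_nonneg.2 (ht.mono (Nat.le_succ k))) hL
  have h3 : min (lgp (dV N v)) ((1-t k) * Real.log N) - min (lgp (dV N v)) ((1-t (k+1)) * Real.log N) ≤ (t (k+1) - t k) * Real.log N := by
    rcases min_cases (lgp (dV N v)) ((1-t (k+1)) * Real.log N) with h | h
    · rw [h.1]; linarith [min_le_left (lgp (dV N v)) ((1-t k) * Real.log N)]
    · rw [h.1]; linarith [min_le_right (lgp (dV N v)) ((1-t k) * Real.log N)]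
  have : gr (Ik N (t k) v) v v - gr (Ik N (t (k+1)) v) v v ≤ (t (k+1) - t k) * Real.log N + 2 * C2 := by linarith
  nlinarith [sq_nonneg (a k), mul_le_mul_of_nonneg_left this (sq_nonneg (a k))]

lemma Cv_add_le {N : ℕ} {P : Measure FieldSp} (h : IsGFF N P) {k k' : Vtx → ℝ} (hk : ∀ x ∉ intr (VN N), k x = 0)
    (hk' : ∀ x ∉ intr (VN N), k' x = 0) :
    Cv N (fun z => k z + k' z) (fun z => k z + k' z) ≤ 2 * Cv N k k + 2 * Cv N k' k' := by
  have h1 := Cv_nonneg h (k := fun z => k z - k' z) (fun x hx => by rw [hk x hx, hk' x hx, sub_zero])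
  have h2 : Cv N (fun z => k z + k' z) (fun z => k z + k' z) + Cv N (fun z => k z - k' z) (fun z => k z - k' z)
      = 2 * Cv N k k + 2 * Cv N k' k' := by
    simp only [Cv, lap_add, lap_sub, Finset.mul_sum, ← Finset.sum_add_distrib]
    refine Finset.sum_congr rfl fun v _ => by ring
  linarith

lemma Cv_sub_le {N : ℕ} {P : Measure FieldSp} (h : IsGFF N P) {k k' : Vtx → ℝ} (hk : ∀ x ∉ intr (VN N), k x = 0)
    (hk' : ∀ x ∉ intr (VN N), k' x = 0) :
    Cv N (fun z => k z - k' z) (fun z => k z - k' z) ≤ 2 * Cv N k k + 2 * Cv N k' k' := by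
  have h1 := Cv_add_le h hk (k' := fun z => (-1) * k' z) (fun x hx => by rw [hk' x hx, mul_zero])
  rw [Cv_smul] at h1
  have e : (fun z => k z + -1 * k' z) = fun z => k z - k' z := by funext z; ring
  rw [e] at h1; linarith

lemma Cv_diffsum {N : ℕ} {P : Measure FieldSp} (h : IsGFF N P) (Y : ℕ → Vtx → ℝ) (τ : ℕ → ℝ) (C : ℝ)
    (hk : ∀ j, ∀ x ∉ intr (VN N), Y j x = 0) (n : ℕ) (hC : ∀ j ≤ n, Cv N (Y j) (Y j) ≤ C) :
    Cv N (fun z => ∑ j ∈ Finset.range n, τ j * (Y j z - Y (j+1) z)) (fun z => ∑ j ∈ Finset.range n, τ j * (Y j z - Y (j+1) z))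
      ≤ 2^n * (4 * C) * ∑ j ∈ Finset.range n, τ j ^ 2 := by
  induction n with
  | zero => simp [Cv]
  | succ n ih =>
    simp only [Finset.sum_range_succ]
    have hd : ∀ x ∉ intr (VN N), Y n x - Y (n+1) x = 0 := fun x hx => by rw [hk _ x hx, hk _ x hx, sub_zero]
    have h1 := Cv_add_le h (k := fun z => ∑ j ∈ Finset.range n, τ j * (Y j z - Y (j+1) z))
      (k' := fun z => τ n * (Y n z - Y (n+1) z))
      (fun x hx => Finset.sum_eq_zero fun j _ => by rw [hk _ x hx, hk _ x hx, sub_zero, mul_zero])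
      (fun x hx => by rw [hd x hx, mul_zero])
    rw [Cv_smul] at h1
    have h2 := Cv_sub_le h (hk n) (hk (n+1))
    have h3 := ih fun j hj => hC j (by omega)
    have h4 := hC n (by omega)
    have h5 := hC (n+1) le_rfl
    have h0 := (Cv_nonneg h (hk n)).trans h4
    have h6 : τ n ^2 * Cv N (fun z => Y n z - Y (n+1) z) (fun z => Y n z - Y (n+1) z) ≤ τ n ^2 * (4 * C) :=
      mul_le_mul_of_nonneg_left (by linarith) (sq_nonneg _)
    have h7 : (1:ℝ) ≤ 2^n := one_le_pow₀ (by norm_num)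
    have h8 : 2 * (τ n ^2 * (4 * C)) ≤ 2^(n+1) * (4 * C) * τ n ^2 := by
      have e : (2:ℝ)^(n+1) = 2 * 2^n := by ring
      rw [e]; nlinarith [mul_le_mul_of_nonneg_right h7 (mul_nonneg (sq_nonneg (τ n)) h0)]
    calc _ ≤ _ := h1
      _ ≤ 2 * (2^n * (4 * C) * ∑ j ∈ Finset.range n, τ j ^ 2) + 2^(n+1) * (4 * C) * τ n ^2 := by linarith
      _ = _ := by rw [pow_succ]; ring

lemma nest {N : ℕ} {I I' : Finset Vtx} (hI : I ⊆ intr (VN N)) (h : I' ⊆ I) (v w : Vtx) :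
    Cv N (fun z => gr I v z - gr I' v z) (fun z => gr I w z - gr I' w z) = gr I w v - gr I' w v := by
  have hV := hI.trans (intr_sub _)
  rw [Cv_sub_left, Cv_gr hV (fun x hx => by rw [gr_off hx, gr_off fun h' => hx (h h'), sub_zero]), Cv_sub_right,
    Cv_gr (h.trans hV) (fun x hx => gr_off hx), Cv_symm (fun x hx => gr_off fun h' => hx (hI (h h')))
      (fun x hx => gr_off fun h' => hx (hI h')), Cv_gr hV (fun x hx => gr_off fun h' => hx (h h')), gr_symm I' w v]
  ring

lemma lgp_four {a b : ℤ} (h : a ≤ 4 * b) (hb : 0 < b) : lgp a ≤ lgp b + Real.log 4 := by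
  have hb' : (1:ℝ) ≤ b := by exact_mod_cast hb
  have ha' : (a:ℝ) ≤ 4 * b := by exact_mod_cast h
  rw [lgp, lgp_of_pos hb, ← Real.log_mul (by positivity) (by norm_num)]
  exact Real.log_le_log (by positivity) (max_le (by linarith) (by linarith))

lemma inter_energy {N : ℕ} {p q p' q' v : Vtx} (hI : Rc p q ⊆ intr (VN N))
    (h0 : 0 < dR (p ⊔ p') (q ⊓ q') v) (h : dR p q v ≤ 4 * dR (p ⊔ p') (q ⊓ q') v) :
    Cv N (fun z => gr (Rc p q) v z - gr (Rc p q ∩ Rc p' q') v z) (fun z => gr (Rc p q) v z - gr (Rc p q ∩ Rc p' q') v z)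
      ≤ 2 * C2 := by
  rw [nest hI Finset.inter_subset_left, Rc_inter]
  have h1 := abs_le.1 (est' p q v)
  have h2 := abs_le.1 (est' (p ⊔ p') (q ⊓ q') v)
  have := lgp_four h h0
  unfold C2; linarith [log4_pos]

noncomputable def Xd (N : ℕ) (t : ℝ) (v : Vtx) : Vtx → ℝ := fun z => gr (intr (VN N)) v z - gr (Ik N t v) v z

lemma cmpX {N : ℕ} {P : Measure FieldSp} (h : IsGFF N P) {t : ℝ} {v c : Vtx} (hv : v ∈ VN N) (hc : c ∈ VN N) {l : ℤ} (hl : 1 ≤ l)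
    (hr : 5 * l ≤ rr N t) (hd : 4 * l ≤ dV N v) (h1 : |v.1 - c.1| ≤ l) (h2 : |v.2 - c.2| ≤ l) :
    Cv N (fun z => Xd N t v z - Xd N t c z) (fun z => Xd N t v z - Xd N t c z) ≤ 40 * C2 := by
  set ρ := rr N t with hρ
  have hIv := Ik_sub (t := t) hv
  have hIc := Ik_sub (t := t) hc
  unfold Xd
  rw [Ik_eq hv, ← hρ] at hIv ⊢
  rw [Ik_eq hc, ← hρ] at hIc ⊢
  rw [abs_le] at h1 h2
  have hdc : 3 * l ≤ dV N c := by
    simp only [dV, dR, le_min_iff] at hd ⊢; omega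
  have dvv : dR (pI N ρ v) (qI N ρ v) v = min (dV N v) ρ := Ik_dR_self _ _
  have dcc : dR (pI N ρ c) (qI N ρ c) c = min (dV N c) ρ := Ik_dR_self _ _
  have dvc : dR (pI N ρ v) (qI N ρ v) c = min (dV N c) (dR (v.1 - ρ, v.2 - ρ) (v.1 + ρ, v.2 + ρ) c) := Ik_dR _ _ _
  have dcv : dR (pI N ρ c) (qI N ρ c) v = min (dV N v) (dR (c.1 - ρ, c.2 - ρ) (c.1 + ρ, c.2 + ρ) v) := Ik_dR _ _ _
  have a1 : ρ - l ≤ dR (v.1 - ρ, v.2 - ρ) (v.1 + ρ, v.2 + ρ) c := by simp only [dR, le_min_iff]; omega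
  have a2 : ρ - l ≤ dR (c.1 - ρ, c.2 - ρ) (c.1 + ρ, c.2 + ρ) v := by simp only [dR, le_min_iff]; omega
  have d2v := dR_inter (pI N ρ v) (qI N ρ v) (pI N ρ c) (qI N ρ c) v
  have d2c := dR_inter (pI N ρ c) (qI N ρ c) (pI N ρ v) (qI N ρ v) c
  have eB := inter_energy (p' := pI N ρ c) (q' := qI N ρ c) (v := v) hIv (by omega) (by omega)
  have eC := inter_energy (p' := pI N ρ v) (q' := qI N ρ v) (v := c) hIc (by omega) (by omega)
  rw [Finset.inter_comm] at eC
  have hI2 : Rc (pI N ρ v) (qI N ρ v) ∩ Rc (pI N ρ c) (qI N ρ c) ⊆ intr (VN N) := Finset.inter_subset_left.trans hIv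
  set I2 := Rc (pI N ρ v) (qI N ρ v) ∩ Rc (pI N ρ c) (qI N ρ c) with hI2d
  set Iv := Rc (pI N ρ v) (qI N ρ v)
  set Ic := Rc (pI N ρ c) (qI N ρ c)
  set J := intr (VN N) with hJ
  have eA : Cv N (fun z => (gr J v z - gr I2 v z) - (gr J c z - gr I2 c z)) (fun z => (gr J v z - gr I2 v z) - (gr J c z - gr I2 c z)) ≤ 4 * C1 := by
    have n := fun a b => nest (N := N) (I := J) (I' := I2) subset_rfl hI2 a b
    have cs := Cv_sub_right N (fun z => gr J v z - gr I2 v z) (fun z => gr J c z - gr I2 c z)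
    rw [Cv_sub_left, cs, cs, n, n, n, n]
    have q1 := est_diff (p := (0,0)) (q := (N,N)) (v := v) (c := c) (l := l) (by omega) (show 0 < dV N v by omega) (show 0 < dV N c by omega)
      hd (abs_le.2 h1) (abs_le.2 h2)
    rw [← intrVN_eq, ← hJ] at q1
    rw [Rc_inter] at hI2d
    have q2 := est_diff (p := pI N ρ v ⊔ pI N ρ c) (q := qI N ρ v ⊓ qI N ρ c) (v := v) (c := c) (l := l) (by omega) (by omega)
      (by have := dR_inter (pI N ρ v) (qI N ρ v) (pI N ρ c) (qI N ρ c) c; omega) (by omega) (abs_le.2 h1) (abs_le.2 h2)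
    rw [← hI2d] at q2
    have := abs_le.1 q1; have := abs_le.1 q2
    rw [gr_symm J c v, gr_symm I2 c v]; linarith
  have s : ∀ {I : Finset Vtx} {w : Vtx}, I ⊆ J → ∀ x ∉ J, gr I w x = 0 := fun hI x hx => gr_off fun h' => hx (hI h')
  have f1 := Cv_sub_le h (k := fun z => gr Ic c z - gr I2 c z) (k' := fun z => gr Iv v z - gr I2 v z)
    (fun x hx => by rw [s hIc x hx, s hI2 x hx, sub_zero]) (fun x hx => by rw [s hIv x hx, s hI2 x hx, sub_zero])
  have f2 := Cv_add_le h (k := fun z => (gr J v z - gr I2 v z) - (gr J c z - gr I2 c z))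
    (k' := fun z => (gr Ic c z - gr I2 c z) - (gr Iv v z - gr I2 v z))
    (fun x hx => by simp only [s hI2 x hx, s subset_rfl x hx, sub_zero]) (fun x hx => by simp only [s hI2 x hx, s hIv x hx, s hIc x hx, sub_zero])
  have e : (fun z => (gr J v z - gr I2 v z) - (gr J c z - gr I2 c z) + ((gr Ic c z - gr I2 c z) - (gr Iv v z - gr I2 v z))) =
      fun z => gr J v z - gr Iv v z - (gr J c z - gr Ic c z) := by funext z; ring
  rw [e] at f2
  have : C1 ≤ C2 := by unfold C2; linarith [log4_pos]
  linarith [C2_nonneg]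

lemma Whp_ev {P : ℕ → Measure FieldSp} {A : ℕ → Set FieldSp} (h : ∀ᶠ N in atTop, ∀ ω, ω ∈ A N) : Whp P A := by
  have h0 : Whp P (fun _ => Set.univ) := by simp [Whp]
  exact h0.mono (h.mono fun N hN ω _ => hN ω)

lemma VN_card (N : ℕ) (hN : 1 ≤ N) : ((VN N).card : ℝ) ≤ 4 * Real.exp (2 * Real.log N) := by
  have hN' : (1:ℝ) ≤ N := by exact_mod_cast hN
  have e : VN N = Finset.Icc (0:ℤ) N ×ˢ Finset.Icc (0:ℤ) N := by
    ext v; rw [mem_VN, Finset.mem_product, Finset.mem_Icc, Finset.mem_Icc]; tauto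
  rw [e, Finset.card_product, Int.card_Icc, show 2 * Real.log N = Real.log N + Real.log N by ring, Real.exp_add,
    Real.exp_log (by linarith)]
  have : ((N:ℤ) + 1 - 0).toNat = N + 1 := by omega
  rw [this]; push_cast; nlinarith

lemma rpow_ev {a : ℝ} (ha : 0 < a) (C : ℝ) : ∀ᶠ N : ℕ in atTop, C ≤ (N:ℝ)^a :=
  ((tendsto_rpow_atTop ha).comp tendsto_natCast_atTop_atTop).eventually_ge_atTop C

lemma rpow_exp {N : ℕ} (hN : 1 ≤ N) (a : ℝ) : (N:ℝ)^a = Real.exp (a * Real.log N) := by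
  rw [Real.rpow_def_of_pos (by exact_mod_cast hN), mul_comm]

lemma card_filter_VN {N : ℕ} (hN : 1 ≤ N) (p : Vtx → Prop) [DecidablePred p] : (((VN N).filter p).card:ℝ) ≤ 4 * Real.exp (2 * Real.log N) :=
  le_trans (Nat.cast_le.2 (Finset.card_le_card (Finset.filter_subset p (VN N)))) (VN_card N hN)

set_option maxHeartbeats 400000 in
lemma centers {P : ℕ → Measure FieldSp} (h : ∀ N, IsGFF N (P N)) {K : ℕ} {t : ℕ → ℝ} (ht : Grid K t) (τ : ℕ → ℝ) (n : ℕ)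
    (h0 : 0 < t n) : ∃ Cen : ℕ → Finset Vtx, ∃ A : ℝ, (∀ N, Cen N ⊆ VN N) ∧
      (∀ᶠ N : ℕ in atTop, ((Cen N).card : ℝ) ≤ A * Real.exp (2 * t n * Real.log N)) ∧
      ∀ δ > 0, ∀ η > 0, Whp P (fun N => {ω | ∀ v ∈ VN N, xi N (ker N τ t n v) ω < η * Real.log N ∨
        ∃ c ∈ Cen N, xi N (ker N τ t n v) ω < xi N (ker N τ t n c) ω + δ * Real.log N}) := by
  rcases eq_or_lt_of_le (ht.le1 n) with h1 | h1
  · refine ⟨VN, 4, fun N => subset_rfl, (eventually_ge_atTop 1).mono fun N hN => ?_, fun δ hδ η hη => Whp_ev ?_⟩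
    · rw [h1, mul_one]; exact VN_card N hN
    · filter_upwards [logN_top.eventually_gt_atTop 0] with N hN ω v hv
      exact Or.inr ⟨v, hv, by have := mul_pos hδ hN; linarith⟩
  set l : ℕ → ℤ := fun N => ⌊(N:ℝ)^(1 - t n)/16⌋ with hl
  set cen : ℕ → Vtx → Vtx := fun N v => (l N * (v.1 / l N), l N * (v.2 / l N)) with hcen
  have hl1 : ∀ᶠ N : ℕ in atTop, 1 ≤ l N := (rpow_ev (by linarith : 0 < 1 - t n) 16).mono fun N hN =>
    Int.le_floor.2 (by push_cast; linarith)
  have hcV : ∀ N, ∀ v ∈ VN N, 1 ≤ l N → cen N v ∈ VN N := fun N v hv hlN => by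
    rw [mem_VN] at hv ⊢
    have e1 := Int.mul_ediv_self_le (x := v.1) (k := l N) (by omega)
    have e2 := Int.mul_ediv_self_le (x := v.2) (k := l N) (by omega)
    have e3 := Int.ediv_nonneg hv.1.1 (by omega : 0 ≤ l N)
    have e4 := Int.ediv_nonneg hv.1.2 (by omega : 0 ≤ l N)
    simp only [hcen]
    exact ⟨⟨by positivity, by positivity⟩, by omega, by omega⟩
  refine ⟨fun N => ((VN N).image (cen N)).filter (· ∈ VN N), 33^2, fun N v hv => (Finset.mem_filter.1 hv).2, ?_, fun δ hδ η hη => ?_⟩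
  · filter_upwards [hl1, eventually_ge_atTop 1] with N hlN hN
    have hN' : (1:ℝ) ≤ N := by exact_mod_cast hN
    have s1 : (VN N).image (cen N) ⊆ ((Finset.Icc 0 (N / l N)) ×ˢ (Finset.Icc 0 (N / l N))).image (fun w : Vtx => (l N * w.1, l N * w.2)) := by
      intro w hw
      obtain ⟨v, hv, rfl⟩ := Finset.mem_image.1 hw
      rw [mem_VN] at hv
      refine Finset.mem_image.2 ⟨(v.1 / l N, v.2 / l N), ?_, rfl⟩
      simp only [Finset.mem_product, Finset.mem_Icc]
      exact ⟨⟨Int.ediv_nonneg hv.1.1 (by omega), Int.ediv_le_ediv (by omega) hv.2.1⟩, Int.ediv_nonneg hv.1.2 (by omega), Int.ediv_le_ediv (by omega) hv.2.2⟩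
    have s2 := (Finset.card_le_card (Finset.filter_subset (· ∈ VN N) _)).trans ((Finset.card_le_card s1).trans Finset.card_image_le)
    rw [Finset.card_product, Int.card_Icc] at s2
    have hq0 : 0 ≤ (N:ℤ) / l N := Int.ediv_nonneg (by positivity) (by omega)
    have hq : (((N:ℤ) / l N : ℤ):ℝ) ≤ 32 * (N:ℝ)^(t n) := by
      have e1 : ((l N : ℤ):ℝ) * (((N:ℤ) / l N : ℤ):ℝ) ≤ N := by exact_mod_cast Int.mul_ediv_self_le (x := (N:ℤ)) (k := l N) (by omega)
      have e2 := Int.lt_floor_add_one ((N:ℝ)^(1 - t n)/16)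
      have e3 : (N:ℝ)^(1 - t n) * (N:ℝ)^(t n) = N := by rw [← Real.rpow_add (by linarith)]; simp
      have e4 : (1:ℝ) ≤ (l N : ℤ) := by exact_mod_cast hlN
      have e5 : (N:ℝ)^(1 - t n) ≤ 32 * (l N:ℤ) := by simp only [hl] at e4 ⊢; linarith
      have e6 : 0 < (N:ℝ)^(t n) := by positivity
      have e7 : (N:ℝ) ≤ 32 * (l N:ℤ) * (N:ℝ)^(t n) := by
        calc (N:ℝ) = _ := e3.symm
          _ ≤ _ := mul_le_mul_of_nonneg_right e5 e6.le
      have e8 : ((l N : ℤ):ℝ) * (((N:ℤ) / l N : ℤ):ℝ) ≤ (l N : ℤ) * (32 * (N:ℝ)^(t n)) := by linarith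
      exact le_of_mul_le_mul_left e8 (by linarith)
    have e9 : 1 ≤ (N:ℝ)^(t n) := Real.one_le_rpow hN' h0.le
    have e10 : ((((N:ℤ) / l N + 1 - 0).toNat : ℕ) : ℝ) ≤ 33 * (N:ℝ)^(t n) := by
      have : ((((N:ℤ) / l N + 1 - 0).toNat : ℕ) : ℤ) = (N:ℤ) / l N + 1 := by omega
      have : ((((N:ℤ) / l N + 1 - 0).toNat : ℕ) : ℝ) = (((N:ℤ) / l N : ℤ):ℝ) + 1 := by exact_mod_cast this
      rw [this]; linarith
    have s3 : ((((VN N).image (cen N)).filter (· ∈ VN N)).card : ℝ) ≤ ((((N:ℤ) / l N + 1 - 0).toNat : ℕ) : ℝ) * ((((N:ℤ) / l N + 1 - 0).toNat : ℕ) : ℝ) := by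
      exact_mod_cast s2
    rw [show 2 * t n * Real.log N = t n * Real.log N + t n * Real.log N by ring, Real.exp_add, ← rpow_exp hN]
    calc _ ≤ _ := s3
      _ ≤ (33 * (N:ℝ)^(t n)) * (33 * (N:ℝ)^(t n)) := mul_le_mul e10 e10 (by positivity) (by positivity)
      _ = _ := by ring
  · have w1 := Whp_small h (fun N => (VN N).filter (fun v => dV N v < 4 * l N)) (fun N v => ker N τ t n v) 4
      (2 * C2 * ∑ k ∈ Finset.range n, τ k ^ 2) 2 η hη (by norm_num) ((eventually_ge_atTop 1).mono fun N hN => card_filter_VN hN _)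
      (Eventually.of_forall fun N v hv x hx => ker_supp (Finset.mem_filter.1 hv).1 x hx) (by
        filter_upwards [hl1, eventually_ge_atTop 1] with N hlN hN v hv
        rw [Finset.mem_filter] at hv
        rw [ker_var hN ht τ n hv.1, Finset.mul_sum]
        refine Finset.sum_le_sum fun k hk => ?_
        have hL : 0 ≤ Real.log N := Real.log_natCast_nonneg N
        have hN' : (1:ℝ) ≤ N := by exact_mod_cast hN
        have h1' := abs_le.1 (g_est hN hv.1 (ht.nn k) (ht.le1 k))
        have h2' := abs_le.1 (g_est hN hv.1 (ht.nn (k+1)) (ht.le1 (k+1)))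
        have hm := ht.mono (show k + 1 ≤ n by have := Finset.mem_range.1 hk; omega)
        have he : lgp (dV N v) ≤ (1 - t n) * Real.log N := by
          refine (lgp_mono hv.2.le).trans ?_
          rw [lgp, ← Real.log_rpow (by linarith)]
          apply Real.log_le_log (by positivity)
          have := Int.floor_le ((N:ℝ)^(1 - t n)/16)
          refine max_le (Real.one_le_rpow hN' (by linarith)) ?_
          push_cast; simp only [hl]; linarith [Real.one_le_rpow hN' (by linarith : 0 ≤ 1 - t n)]
        rw [min_eq_left (he.trans (mul_le_mul_of_nonneg_right (by linarith) hL))] at h2'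
        have := min_le_left (lgp (dV N v)) ((1-t k) * Real.log N)
        rw [mul_comm (2 * C2)]
        exact mul_le_mul_of_nonneg_left (by linarith) (sq_nonneg _))
    have w2 := Whp_small h (fun N => (VN N).filter (fun v => ¬ (dV N v < 4 * l N) ∧ 1 ≤ l N)) (fun N v z => ker N τ t n v z - ker N τ t n (cen N v) z) 4
      (2^n * (4 * (40 * C2)) * ∑ k ∈ Finset.range n, (- τ k) ^ 2) 2 δ hδ (by norm_num) ((eventually_ge_atTop 1).mono fun N hN => card_filter_VN hN _)
      (Eventually.of_forall fun N v hv x hx => by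
        have hv := Finset.mem_filter.1 hv
        rw [ker_supp hv.1 x hx, ker_supp (hcV N v hv.1 hv.2.2) x hx, sub_zero]) (by
        filter_upwards [eventually_ge_atTop 1] with N hN v hv
        obtain ⟨hv, hd, hlN⟩ := Finset.mem_filter.1 hv
        have hc := hcV N v hv hlN
        have e : (fun z => ker N τ t n v z - ker N τ t n (cen N v) z) = fun z => ∑ j ∈ Finset.range n, (- τ j) *
            ((Xd N (t j) v z - Xd N (t j) (cen N v) z) - (Xd N (t (j+1)) v z - Xd N (t (j+1)) (cen N v) z)) := by
          funext z
          simp only [_root_.ker, Xd, ← Finset.sum_sub_distrib]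
          refine Finset.sum_congr rfl fun j _ => by ring
        rw [e]
        refine Cv_diffsum (h N) (fun j z => Xd N (t j) v z - Xd N (t j) (cen N v) z) (fun j => - τ j) (40 * C2) (fun j x hx => ?_) n (fun j hj => ?_)
        · simp only [Xd]
          rw [gr_off hx, gr_off hx, gr_off fun h' => hx (Ik_sub hv h'), gr_off fun h' => hx (Ik_sub hc h')]; simp
        · have m1 := Int.emod_nonneg v.1 (by omega : l N ≠ 0)
          have m2 := Int.emod_nonneg v.2 (by omega : l N ≠ 0)
          have m3 := Int.emod_lt_of_pos v.1 (by omega : 0 < l N)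
          have m4 := Int.emod_lt_of_pos v.2 (by omega : 0 < l N)
          have m5 := Int.emod_add_mul_ediv v.1 (l N)
          have m6 := Int.emod_add_mul_ediv v.2 (l N)
          refine cmpX (h N) hv hc hlN ?_ (not_lt.1 hd) ?_ ?_
          · refine le_trans ?_ (rr_anti hN (ht.nn j) (ht.le1 n) (ht.mono hj))
            rw [rr, if_neg h0.ne', if_neg h1.ne]
            apply Int.le_floor.2
            have := Int.floor_le ((N:ℝ)^(1 - t n)/16)
            have e4 : (1:ℝ) ≤ (l N : ℤ) := by exact_mod_cast hlN
            push_cast; simp only [hl] at e4 ⊢; linarith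
          · simp only [hcen]; rw [abs_le]; constructor <;> linarith
          · simp only [hcen]; rw [abs_le]; constructor <;> linarith)
    refine w1.mono2 w2 ?_
    filter_upwards [hl1] with N hlN ω hω v hv
    by_cases hd : dV N v < 4 * l N
    · exact Or.inl (lt_of_abs_lt (hω.1 v (Finset.mem_filter.2 ⟨hv, hd⟩)))
    · right
      have hc := hcV N v hv hlN
      refine ⟨cen N v, Finset.mem_filter.2 ⟨Finset.mem_image_of_mem _ hv, hc⟩, ?_⟩
      have := lt_of_abs_lt (hω.2 v (Finset.mem_filter.2 ⟨hv, hd, hlN⟩))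
      rw [xi_sub] at this; linarith

lemma abel_id (x y : ℕ → ℝ) (n : ℕ) : ∑ j ∈ Finset.range n, y j * x j = y n * ∑ j ∈ Finset.range n, x j
    - ∑ j ∈ Finset.range n, (y (j+1) - y j) * ∑ i ∈ Finset.range (j+1), x i := by
  induction n with
  | zero => simp
  | succ n ih => rw [Finset.sum_range_succ, ih, Finset.sum_range_succ (fun j => (y (j+1) - y j) * _),
      Finset.sum_range_succ x]; ring

noncomputable def bb (t τ y : ℕ → ℝ) (j : ℕ) : ℝ := y j * (τ j ^ 2 * (t (j+1) - t j))

structure Cert (K : ℕ) (t τ y : ℕ → ℝ) (β : ℝ) : Prop where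
  grid : Grid K t
  t1 : 0 < t 1
  y0 : 0 < y 0
  ymono : ∀ k < K, y k ≤ y (k+1)
  yK : y K = β
  contact : ∀ k < K, y k < y (k+1) → ∑ j ∈ Finset.range (k+1), y j * bb t τ y j = 4 * t (k+1)
  feas : ∀ k ≤ K, ∑ j ∈ Finset.range k, y j * bb t τ y j ≤ 4 * t k

lemma Cert.ypos {K : ℕ} {t τ y : ℕ → ℝ} {β : ℝ} (H : Cert K t τ y β) : ∀ n ≤ K, y 0 ≤ y n := by
  intro n hn
  induction n with
  | zero => exact le_rfl
  | succ n ih => exact (ih (by omega)).trans (H.ymono n (by omega))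

lemma Cert.bnn {K : ℕ} {t τ y : ℕ → ℝ} {β : ℝ} (H : Cert K t τ y β) : ∀ n ≤ K, 0 ≤ bb t τ y n := fun n hn =>
  mul_nonneg (H.y0.le.trans (H.ypos n hn)) (mul_nonneg (sq_nonneg _) (sub_nonneg.2 (H.grid.mono (Nat.le_succ n))))

lemma xi_ker (N : ℕ) (a t : ℕ → ℝ) (n : ℕ) (v : Vtx) (ω : FieldSp) : xi N (ker N a t n v) ω =
    ∑ j ∈ Finset.range n, a j * xi N (fun z => gr (Ik N (t j) v) v z - gr (Ik N (t (j+1)) v) v z) ω :=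
  xi_sum N (Finset.range n) a (fun j z => gr (Ik N (t j) v) v z - gr (Ik N (t (j+1)) v) v z) ω

lemma xi_ker_abel (N : ℕ) (τ y t : ℕ → ℝ) (n : ℕ) (v : Vtx) (ω : FieldSp) :
    xi N (ker N (fun j => y j * τ j) t n v) ω = y n * xi N (ker N τ t n v) ω -
      ∑ j ∈ Finset.range n, (y (j+1) - y j) * xi N (ker N τ t (j+1) v) ω := by
  simp only [xi_ker, mul_assoc]
  exact abel_id (fun j => τ j * xi N (fun z => gr (Ik N (t j) v) v z - gr (Ik N (t (j+1)) v) v z) ω) y n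

lemma sum_diff_bd {K n : ℕ} {y S B : ℕ → ℝ} {η L : ℝ} (hn : n ≤ K) (hy : ∀ k < K, y k ≤ y (k+1))
    (hS : ∀ j < n, y j < y (j+1) → S j ≤ (B j + η) * L) :
    ∑ j ∈ Finset.range n, (y (j+1) - y j) * S j ≤ (∑ j ∈ Finset.range n, (y (j+1) - y j) * B j) * L + (y n - y 0) * η * L := by
  rw [← Finset.sum_range_sub y n, Finset.sum_mul, Finset.sum_mul, Finset.sum_mul, ← Finset.sum_add_distrib]
  refine Finset.sum_le_sum fun j hj => ?_
  have hj := Finset.mem_range.1 hj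
  rcases eq_or_lt_of_le (hy j (by omega)) with h | h
  · rw [h]; simp
  · have := mul_le_mul_of_nonneg_left (hS j hj h) (sub_nonneg.2 h.le)
    linarith

lemma ker_ysq (t τ y : ℕ → ℝ) (n : ℕ) : ∑ k ∈ Finset.range n, (y k * τ k) ^ 2 * (t (k+1) - t k) = ∑ j ∈ Finset.range n, y j * bb t τ y j :=
  Finset.sum_congr rfl fun j _ => by unfold bb; ring

lemma barrier {P : ℕ → Measure FieldSp} (h : ∀ N, IsGFF N (P N)) {K : ℕ} {t τ y : ℕ → ℝ} {β : ℝ} (H : Cert K t τ y β) {η : ℝ} (hη : 0 < η) :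
    ∀ n ≤ K, Whp P (fun N => {ω | ∀ j < n, ∀ v ∈ VN N, y j < y (j+1) → xi N (ker N τ t (j+1) v) ω ≤
      (∑ i ∈ Finset.range (j+1), bb t τ y i + η) * Real.log N}) := by
  intro n hn
  induction n with
  | zero => exact Whp_ev (Eventually.of_forall fun N ω j hj => absurd hj (by omega))
  | succ n ih =>
    by_cases hlt : y n < y (n+1)
    swap
    · refine (ih (by omega)).mono (Eventually.of_forall fun N ω hω j hj v hv hy => ?_)
      rcases Nat.lt_succ_iff_lt_or_eq.1 hj with h1 | h1
      · exact hω j h1 v hv hy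
      · subst h1; exact absurd hy hlt
    have yn : 0 < y n := H.y0.trans_le (H.ypos n (by omega))
    have htn : 0 < t (n+1) := H.t1.trans_le (H.grid.mono (by omega))
    obtain ⟨Cen, A, hCV, hCc, hC⟩ := centers h H.grid τ (n+1) htn
    have hy0 := H.y0
    have w1 := hC (y 0 * η / (2 * y n)) (by positivity) η hη
    have w2 := Whp_lt h Cen (fun N c => ker N (fun j => y j * τ j) t (n+1) c) A (2 * C2 * ∑ k ∈ Finset.range (n+1), (y k * τ k) ^ 2)
      (2 * t (n+1)) (4 * t (n+1)) (4 * t (n+1) + y 0 * η / 2) (by linarith [mul_pos hy0 hη]) hCc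
      (Eventually.of_forall fun N c hc x hx => ker_supp (hCV N hc) x hx)
      ((eventually_ge_atTop 1).mono fun N hN c hc => by
        have := ker_var_le hN H.grid (fun j => y j * τ j) (n+1) (hCV N hc)
        rwa [ker_ysq, H.contact n (by omega) hlt] at this)
    refine ((ih (by omega)).mono2 w1 (D := fun N => _ ∩ _) (Eventually.of_forall fun N => subset_rfl)).mono2 w2 ?_
    filter_upwards [logN_top.eventually_gt_atTop 0] with N hL ω hω j hj v hv hy
    obtain ⟨⟨o1, o2⟩, o3⟩ := hω
    rcases Nat.lt_succ_iff_lt_or_eq.1 hj with h1 | h1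
    · exact o1 j h1 v hv hy
    subst h1
    set L := Real.log N
    rcases o2 v hv with o2 | ⟨c, hc, o2⟩
    · have : 0 ≤ ∑ i ∈ Finset.range (j+1), bb t τ y i := Finset.sum_nonneg fun i hi => H.bnn i (by have := Finset.mem_range.1 hi; omega)
      rw [add_mul]; nlinarith [mul_nonneg this hL.le]
    · have e1 := xi_ker_abel N τ y t (j+1) c ω
      have e2 := abel_id (bb t τ y) y (j+1)
      rw [H.contact j (by omega) hlt] at e2
      rw [Finset.sum_range_succ (fun j => (y (j+1) - y j) * _)] at e1 e2
      have e3 := sum_diff_bd (n := j) (K := K) (y := y) (S := fun i => xi N (ker N τ t (i+1) c) ω)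
        (B := fun i => ∑ i ∈ Finset.range (i+1), bb t τ y i) (η := η) (L := L) (by omega) H.ymono
        (fun i hi hy => o1 i hi c (hCV N hc) hy)
      have e4 := o3 c hc
      have e5 : y j * (xi N (ker N τ t (j+1) c) ω + y 0 * η / (2 * y j) * L) ≤ y j * ((∑ i ∈ Finset.range (j+1), bb t τ y i + η) * L) := by
        have e6 : y j * (y 0 * η / (2 * y j) * L) = y 0 * η / 2 * L := by field_simp
        rw [mul_add, e6]
        have e7 : y j * xi N (ker N τ t (j+1) c) ω = xi N (ker N (fun j => y j * τ j) t (j+1) c) ω + ∑ x ∈ Finset.range j, (y (x + 1) - y x) * xi N (ker N τ t (x + 1) c) ω := by linarith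
        have e8 : y j * ∑ i ∈ Finset.range (j+1), bb t τ y i = 4 * t (j+1) + ∑ x ∈ Finset.range j, (y (x + 1) - y x) * ∑ i ∈ Finset.range (x+1), bb t τ y i := by linarith
        rw [e7]
        have : y j * ((∑ i ∈ Finset.range (j+1), bb t τ y i + η) * L) = (y j * ∑ i ∈ Finset.range (j+1), bb t τ y i) * L + y j * η * L := by ring
        rw [this, e8]
        linarith
      linarith [le_of_mul_le_mul_left e5 yn]

lemma upper {P : ℕ → Measure FieldSp} (h : ∀ N, IsGFF N (P N)) {K : ℕ} {t τ y : ℕ → ℝ} {β : ℝ} (H : Cert K t τ y β) {ε : ℝ} (hε : 0 < ε) :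
    Whp P (fun N => {ω | ∑ v ∈ VN N, Real.exp (β * xi N (ker N τ t K v) ω) ≤
      Real.exp ((2 + (β * ∑ j ∈ Finset.range K, bb t τ y j - (∑ j ∈ Finset.range K, y j * bb t τ y j) / 2) + ε) * Real.log N)}) := by
  have hβ : 0 < β := by rw [← H.yK]; exact H.y0.trans_le (H.ypos K le_rfl)
  set η := ε / (4 * β)
  have hη : 0 < η := by positivity
  have w1 := barrier h H hη K le_rfl
  set Q := ∑ j ∈ Finset.range K, y j * bb t τ y j with hQ
  have w2 := Whp_sum h VN (fun N c => ker N (fun j => y j * τ j) t K c) 4 (2 * C2 * ∑ k ∈ Finset.range K, (y k * τ k) ^ 2)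
      2 Q (2 + Q/2 + ε/2) (by linarith) ((eventually_ge_atTop 1).mono VN_card)
      (Eventually.of_forall fun N c hc x hx => ker_supp hc x hx)
      ((eventually_ge_atTop 1).mono fun N hN c hc => by
        have := ker_var_le hN H.grid (fun j => y j * τ j) K hc
        rwa [ker_ysq] at this)
  refine w1.mono2 w2 ?_
  filter_upwards [logN_top.eventually_gt_atTop 0] with N hL ω hω
  obtain ⟨o1, o2⟩ := hω
  set L := Real.log N
  set X := (β * ∑ j ∈ Finset.range K, bb t τ y j - Q + ε/4) * L with hX
  have key : ∀ v ∈ VN N, Real.exp (β * xi N (ker N τ t K v) ω) ≤ Real.exp (xi N (ker N (fun j => y j * τ j) t K v) ω) * Real.exp X := by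
    intro v hv
    rw [← Real.exp_add, Real.exp_le_exp]
    have e1 := xi_ker_abel N τ y t K v ω
    have e2 := abel_id (bb t τ y) y K
    have e3 := sum_diff_bd (n := K) (K := K) (y := y) (S := fun i => xi N (ker N τ t (i+1) v) ω)
        (B := fun i => ∑ i ∈ Finset.range (i+1), bb t τ y i) (η := η) (L := L) le_rfl H.ymono
        (fun i hi hy => o1 i hi v hv hy)
    rw [H.yK] at e1 e2 e3
    have e4 : (β - y 0) * η * L ≤ ε/4 * L := by
      apply mul_le_mul_of_nonneg_right _ hL.le
      calc (β - y 0) * η ≤ β * η := mul_le_mul_of_nonneg_right (by linarith [H.y0]) hη.le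
        _ = ε/4 := by simp only [η]; field_simp
    have e5 : (∑ j ∈ Finset.range K, (y (j+1) - y j) * ∑ i ∈ Finset.range (j+1), bb t τ y i) * L = (β * ∑ j ∈ Finset.range K, bb t τ y j - Q) * L := by
      rw [hQ, e2]; ring
    rw [hX]; linarith
  calc _ ≤ _ := Finset.sum_le_sum key
    _ = _ := (Finset.sum_mul _ _ _).symm
    _ ≤ Real.exp ((2 + Q/2 + ε/2) * L) * Real.exp X := mul_le_mul_of_nonneg_right (le_of_lt o2) (Real.exp_pos _).le
    _ ≤ _ := by
      rw [← Real.exp_add, Real.exp_le_exp, hX]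
      nlinarith [mul_pos hε hL]

noncomputable def Ib (n : ℕ → ℤ) (k : ℕ) (v : Vtx) : Finset Vtx :=
  Rc (n k * (v.1 / n k), n k * (v.2 / n k)) (n k * (v.1 / n k) + n k, n k * (v.2 / n k) + n k)

structure Dy (N : ℕ) (n : ℕ → ℤ) : Prop where
  pos : ∀ k, 0 < n k
  dvd : ∀ k, n (k+1) ∣ n k
  le : n 0 ≤ N

def same (n : ℕ → ℤ) (k : ℕ) (v v' : Vtx) : Prop := v.1 / n k = v'.1 / n k ∧ v.2 / n k = v'.2 / n k

lemma Dy.dvd' {N : ℕ} {n : ℕ → ℤ} (H : Dy N n) {j k : ℕ} (h : j ≤ k) : ∃ c, 0 < c ∧ n j = n k * c := by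
  have : n k ∣ n j := by
    induction h with
    | refl => exact dvd_rfl
    | step _ ih => exact (H.dvd _).trans ih
  obtain ⟨c, hc⟩ := this
  refine ⟨c, ?_, hc⟩
  have h1 := H.pos j
  rw [hc] at h1
  exact pos_of_mul_pos_right h1 (H.pos k).le

lemma same_anti {N : ℕ} {n : ℕ → ℤ} (H : Dy N n) {j k : ℕ} (h : j ≤ k) {v v' : Vtx} (hs : same n k v v') : same n j v v' := by
  obtain ⟨c, hc, e⟩ := H.dvd' h
  unfold same
  rw [e, ← Int.ediv_ediv_of_nonneg (H.pos k).le, ← Int.ediv_ediv_of_nonneg (H.pos k).le,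
    ← Int.ediv_ediv_of_nonneg (H.pos k).le, ← Int.ediv_ediv_of_nonneg (H.pos k).le, hs.1, hs.2]
  exact ⟨rfl, rfl⟩

lemma cell_1d {n c a : ℤ} (hn : 0 < n) (hc : 0 < c) : (n * c) * (a / (n * c)) ≤ n * (a / n) ∧ n * (a / n) + n ≤ (n * c) * (a / (n * c)) + n * c := by
  rw [← Int.ediv_ediv_of_nonneg hn.le]
  have h1 := Int.mul_ediv_self_le (x := a / n) (k := c) hc.ne'
  have h2 := Int.lt_mul_ediv_self_add (x := a / n) (k := c) hc
  constructor
  · nlinarith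
  · nlinarith

lemma Ib_anti {N : ℕ} {n : ℕ → ℤ} (H : Dy N n) {j k : ℕ} (h : j ≤ k) (v : Vtx) : Ib n k v ⊆ Ib n j v := by
  obtain ⟨c, hc, e⟩ := H.dvd' h
  intro x hx
  rw [Ib, mem_Rc] at *
  have h1 := cell_1d (a := v.1) (H.pos k) hc
  have h2 := cell_1d (a := v.2) (H.pos k) hc
  rw [← e] at h1 h2
  simp only at hx ⊢
  omega

lemma Ib_sub {N : ℕ} {n : ℕ → ℤ} (H : Dy N n) {v : Vtx} (h1 : 0 ≤ v.1 ∧ v.1 < n 0) (h2 : 0 ≤ v.2 ∧ v.2 < n 0) (k : ℕ) :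
    Ib n k v ⊆ intr (VN N) := by
  refine (Ib_anti H (Nat.zero_le k) v).trans ?_
  rw [intrVN_eq]
  intro x hx
  rw [Ib, mem_Rc, Int.ediv_eq_zero_of_lt h1.1 h1.2, Int.ediv_eq_zero_of_lt h2.1 h2.2] at hx
  rw [mem_Rc]
  have := H.le
  simp only at hx ⊢
  omega

lemma Ib_same {n : ℕ → ℤ} {k : ℕ} {v v' : Vtx} (h : same n k v v') : Ib n k v = Ib n k v' := by
  rw [Ib, Ib, h.1, h.2]

lemma cell_eq {n a b w : ℤ} (hn : 0 < n) (h1 : n * a ≤ w) (h2 : w ≤ n * a + n) (h3 : n * b < w) (h4 : w < n * b + n) : a = b := by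
  have e1 : n * a < n * (b + 1) := by linarith
  have e2 : n * b < n * (a + 1) := by linarith
  have := lt_of_mul_lt_mul_left e1 hn.le
  have := lt_of_mul_lt_mul_left e2 hn.le
  omega

lemma Ib_adj {N : ℕ} {n : ℕ → ℤ} (H : Dy N n) {k : ℕ} {v v' x w : Vtx} (hx : x ∈ Ib n k v) (hw : w = x ∨ nbr x w) (hw' : w ∈ Ib n k v') :
    same n k v v' := by
  have h := mem_Rc.1 hw'
  have ho : n k * (v.1 / n k) ≤ w.1 ∧ w.1 ≤ n k * (v.1 / n k) + n k ∧ n k * (v.2 / n k) ≤ w.2 ∧ w.2 ≤ n k * (v.2 / n k) + n k := by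
    rcases hw with rfl | hw
    · have := mem_Rc.1 hx; simp only at this; omega
    · exact Rc_outer hx hw
  exact ⟨cell_eq (H.pos k) ho.1 ho.2.1 h.1.1 h.1.2, cell_eq (H.pos k) ho.2.2.1 ho.2.2.2 h.2.1 h.2.2⟩

lemma Ib_mem {N : ℕ} {n : ℕ → ℤ} (H : Dy N n) {k : ℕ} {v v' : Vtx} (h : v' ∈ Ib n k v) : same n k v v' := by
  have h := mem_Rc.1 h
  have a1 := Int.mul_ediv_self_le (x := v'.1) (k := n k) (H.pos k).ne'
  have a2 := Int.lt_mul_ediv_self_add (x := v'.1) (k := n k) (H.pos k)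
  have a3 := Int.mul_ediv_self_le (x := v'.2) (k := n k) (H.pos k).ne'
  have a4 := Int.lt_mul_ediv_self_add (x := v'.2) (k := n k) (H.pos k)
  exact ⟨(cell_eq (H.pos k) a1 a2.le h.1.1 h.1.2).symm, (cell_eq (H.pos k) a3 a4.le h.2.1 h.2.2).symm⟩

lemma Cv_cell {N : ℕ} {n : ℕ → ℤ} (H : Dy N n) {v v' : Vtx} (h1 : 0 ≤ v'.1 ∧ v'.1 < n 0) (h2 : 0 ≤ v'.2 ∧ v'.2 < n 0)
    {k : ℕ} (hs : same n k v v') (hns : ¬ same n (k+1) v v') {k' : Vtx → ℝ} (hk' : ∀ x ∉ Ib n (k+1) v, k' x = 0) (j : ℕ) :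
    Cv N (gr (Ib n j v') v') k' = 0 := by
  rcases le_or_gt j k with hj | hj
  · have hsub : Ib n (k+1) v ⊆ Ib n j v' := by
      rw [← Ib_same (same_anti H hj hs)]; exact Ib_anti H (by omega) v
    rw [Cv_gr ((Ib_sub H h1 h2 j).trans (intr_sub _)) (fun x hx => hk' x fun h => hx (hsub h))]
    exact hk' _ fun h => hns (Ib_mem H h)
  · refine Finset.sum_eq_zero fun x _ => ?_
    by_cases hx : x ∈ Ib n (k+1) v
    · rw [lap_off (I := Ib n (k+1) v') (fun z hz => gr_off fun h => hz (Ib_anti H hj v' h)) (fun h => hns (Ib_adj H hx (Or.inl rfl) h))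
        (fun w hw h => hns (Ib_adj H hx (Or.inr hw) h))]; simp
    · rw [hk' x hx, mul_zero]

noncomputable def dk (n : ℕ → ℤ) (j : ℕ) (v : Vtx) : Vtx → ℝ := fun z => gr (Ib n j v) v z - gr (Ib n (j+1) v) v z
noncomputable def kb (n : ℕ → ℤ) (K : ℕ) (a : ℕ → ℝ) (v : Vtx) : Vtx → ℝ := fun z => ∑ j ∈ Finset.range K, a j * dk n j v z
noncomputable def ub (n : ℕ → ℤ) (j : ℕ) (v : Vtx) : ℝ := gr (Ib n j v) v v - gr (Ib n (j+1) v) v v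

def InB (n : ℕ → ℤ) (v : Vtx) : Prop := (0 ≤ v.1 ∧ v.1 < n 0) ∧ (0 ≤ v.2 ∧ v.2 < n 0)

lemma kb_supp {N : ℕ} {n : ℕ → ℤ} (H : Dy N n) {v : Vtx} (h : InB n v) (K : ℕ) (a : ℕ → ℝ) (x : Vtx) (hx : x ∉ intr (VN N)) : kb n K a v x = 0 :=
  Finset.sum_eq_zero fun j _ => by
    rw [dk, gr_off fun h' => hx (Ib_sub H h.1 h.2 _ h'), gr_off fun h' => hx (Ib_sub H h.1 h.2 _ h')]; simp

lemma kb_var {N : ℕ} {n : ℕ → ℤ} (H : Dy N n) {v : Vtx} (h : InB n v) (K : ℕ) (a : ℕ → ℝ) :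
    Cv N (kb n K a v) (kb n K a v) = ∑ j ∈ Finset.range K, a j ^ 2 * ub n j v :=
  chain_var (I := fun j => Ib n j v) (fun k => Ib_anti H (Nat.le_succ k) v) (Ib_sub H h.1 h.2 0) a K v

lemma kb_xi (N : ℕ) (n : ℕ → ℤ) (K : ℕ) (a : ℕ → ℝ) (v : Vtx) (ω : FieldSp) : xi N (kb n K a v) ω = ∑ j ∈ Finset.range K, a j * xi N (dk n j v) ω :=
  xi_sum N (Finset.range K) a (fun j => dk n j v) ω

lemma kb_cross {N : ℕ} {n : ℕ → ℤ} (H : Dy N n) {v v' : Vtx} (h' : InB n v')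
    {k : ℕ} (hs : same n k v v') (hns : ¬ same n (k+1) v v') (K : ℕ) (a b : ℕ → ℝ) (ha : ∀ j ≤ k, a j = 0) :
    Cv N (kb n K b v') (kb n K a v) = 0 := by
  have hk' : ∀ x ∉ Ib n (k+1) v, kb n K a v x = 0 := fun x hx => Finset.sum_eq_zero fun j _ => by
    rcases le_or_gt j k with hj | hj
    · rw [ha j hj, zero_mul]
    · rw [dk, gr_off fun h => hx (Ib_anti H hj v h), gr_off fun h => hx (Ib_anti H (by omega) v h)]; simp
  unfold kb
  rw [Cv_sum_left]
  refine Finset.sum_eq_zero fun j _ => ?_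
  unfold dk
  rw [Cv_sub_left]
  have := Cv_cell H h'.1 h'.2 hs hns hk' j
  have := Cv_cell H h'.1 h'.2 hs hns hk' (j+1)
  unfold kb dk at *
  simp_all

noncomputable def wt (N : ℕ) (n : ℕ → ℤ) (K : ℕ) (θ : ℕ → ℝ) (v : Vtx) (ω : FieldSp) : ℝ :=
  Real.exp (xi N (kb n K θ v) ω - (∑ j ∈ Finset.range K, θ j ^ 2 * ub n j v) / 2)
def Gd (N : ℕ) (n : ℕ → ℤ) (K : ℕ) (mm : ℕ → ℝ) (r : ℝ) (v : Vtx) : Set FieldSp := {ω | ∀ j < K, |xi N (dk n j v) ω - mm j| ≤ r}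
noncomputable def Wv (N : ℕ) (n : ℕ → ℤ) (K : ℕ) (θ mm : ℕ → ℝ) (r : ℝ) (v : Vtx) : FieldSp → ℝ :=
  (Gd N n K mm r v).indicator (wt N n K θ v)

lemma Gd_meas (N : ℕ) (n : ℕ → ℤ) (K : ℕ) (mm : ℕ → ℝ) (r : ℝ) (v : Vtx) : MeasurableSet (Gd N n K mm r v) := by
  unfold Gd
  rw [Set.ofPred_forall]
  refine MeasurableSet.iInter fun j => ?_
  rw [Set.ofPred_forall]
  refine MeasurableSet.iInter fun _ => measurableSet_le ?_ measurable_const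
  exact continuous_abs.measurable.comp ((xi_meas N _).sub_const _)

lemma exp_kb {N : ℕ} {P : Measure FieldSp} (h : IsGFF N P) {n : ℕ → ℤ} (H : Dy N n) {v : Vtx} (hv : InB n v) (K : ℕ) (a : ℕ → ℝ) (c : ℝ) :
    Integrable (fun ω => Real.exp (xi N (kb n K a v) ω + c)) P ∧
    ∫ ω, Real.exp (xi N (kb n K a v) ω + c) ∂P = Real.exp ((∑ j ∈ Finset.range K, a j ^ 2 * ub n j v) / 2 + c) := by
  have := xi_mgf h (kb_supp H hv K a)
  simp only [Real.exp_add]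
  exact ⟨this.1.mul_const _, by rw [integral_mul_const, this.2, kb_var H hv]⟩

lemma wt_int {N : ℕ} {P : Measure FieldSp} (h : IsGFF N P) {n : ℕ → ℤ} (H : Dy N n) {v : Vtx} (hv : InB n v) (K : ℕ) (θ : ℕ → ℝ) :
    Integrable (wt N n K θ v) P ∧ ∫ ω, wt N n K θ v ω ∂P = 1 := by
  have := exp_kb h H hv K θ (-((∑ j ∈ Finset.range K, θ j ^ 2 * ub n j v) / 2))
  simp only [wt, sub_eq_add_neg]
  refine ⟨this.1, this.2.trans ?_⟩
  rw [add_neg_cancel, Real.exp_zero]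

lemma Wv_int {N : ℕ} {P : Measure FieldSp} (h : IsGFF N P) {n : ℕ → ℤ} (H : Dy N n) {v : Vtx} (hv : InB n v) (K : ℕ) (θ mm : ℕ → ℝ) (r : ℝ) :
    Integrable (Wv N n K θ mm r v) P := (wt_int h H hv K θ).1.indicator (Gd_meas _ _ _ _ _ _)

lemma Wv_nonneg (N : ℕ) (n : ℕ → ℤ) (K : ℕ) (θ mm : ℕ → ℝ) (r : ℝ) (v : Vtx) (ω : FieldSp) : 0 ≤ Wv N n K θ mm r v ω :=
  Set.indicator_nonneg (fun _ _ => (Real.exp_pos _).le) _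

lemma sum_upd (K : ℕ) (θ X : ℕ → ℝ) (i : ℕ) (hi : i < K) (c : ℝ) :
    ∑ j ∈ Finset.range K, (θ j + if j = i then c else 0) * X j = ∑ j ∈ Finset.range K, θ j * X j + c * X i := by
  simp only [add_mul, Finset.sum_add_distrib, ite_mul, zero_mul]
  rw [Finset.sum_ite_eq' _ i, if_pos (Finset.mem_range.2 hi)]

lemma sum_upd_sq (K : ℕ) (θ X : ℕ → ℝ) (i : ℕ) (hi : i < K) (c : ℝ) :
    ∑ j ∈ Finset.range K, (θ j + if j = i then c else 0) ^ 2 * X j = ∑ j ∈ Finset.range K, θ j ^ 2 * X j + (2 * c * θ i + c^2) * X i := by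
  have : ∀ j, (θ j + if j = i then c else 0) ^ 2 = θ j ^ 2 + if j = i then (2 * c * θ i + c^2) else 0 := fun j => by
    split_ifs with h
    · rw [h]; ring
    · ring
  simp only [this]
  exact sum_upd K (fun j => θ j ^ 2) X i hi _

lemma first_moment {N : ℕ} {P : Measure FieldSp} (h : IsGFF N P) {n : ℕ → ℤ} (H : Dy N n) {v : Vtx} (hv : InB n v) (K : ℕ) (θ mm : ℕ → ℝ)
    (r α c1 c2 : ℝ) (hα : 0 ≤ α) (h1 : ∀ j < K, |θ j * ub n j v - mm j| ≤ c1) (h2 : ∀ j < K, ub n j v ≤ c2) :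
    1 - K * (2 * Real.exp (α * c1 + α^2 * c2 / 2 - α * r)) ≤ ∫ ω, Wv N n K θ mm r v ω ∂P := by
  set S := ∑ j ∈ Finset.range K, θ j ^ 2 * ub n j v
  set F : ℝ → ℕ → FieldSp → ℝ := fun c i ω => Real.exp (xi N (kb n K (fun j => θ j + if j = i then c else 0) v) ω + (- c * mm i - α * r - S/2)) with hF
  have hFe : ∀ c i ω, i < K → F c i ω = wt N n K θ v ω * Real.exp (c * (xi N (dk n i v) ω - mm i) - α * r) := fun c i ω hi => by
    simp only [hF, wt]
    rw [← Real.exp_add, kb_xi, sum_upd _ _ _ _ hi, kb_xi]; congr 1; ring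
  have hFi := fun c i => exp_kb h H hv K (fun j => θ j + if j = i then c else 0) (- c * mm i - α * r - S/2)
  have hFb : ∀ c, |c| = α → ∀ i < K, ∫ ω, F c i ω ∂P ≤ Real.exp (α * c1 + α^2 * c2 / 2 - α * r) := fun c hc i hi => by
    rw [(hFi c i).2, Real.exp_le_exp, sum_upd_sq _ _ _ _ hi]
    have e1 : c * (θ i * ub n i v - mm i) ≤ α * c1 := by
      refine (le_abs_self _).trans ?_
      rw [abs_mul, hc]; exact mul_le_mul_of_nonneg_left (h1 i hi) hα
    have e2 : c^2 * ub n i v ≤ α^2 * c2 := by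
      rw [← sq_abs, hc]; exact mul_le_mul_of_nonneg_left (h2 i hi) (sq_nonneg _)
    simp only [S]
    linarith
  have hpt : ∀ ω, wt N n K θ v ω - ∑ i ∈ Finset.range K, (F α i ω + F (-α) i ω) ≤ Wv N n K θ mm r v ω := fun ω => by
    have hFp : ∀ c i, 0 ≤ F c i ω := fun c i => (Real.exp_pos _).le
    have hwp : 0 ≤ wt N n K θ v ω := (Real.exp_pos _).le
    by_cases hg : ω ∈ Gd N n K mm r v
    · rw [Wv, Set.indicator_of_mem hg]
      have := Finset.sum_nonneg fun i (_ : i ∈ Finset.range K) => add_nonneg (hFp α i) (hFp (-α) i)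
      linarith
    · rw [Wv, Set.indicator_of_notMem hg, sub_nonpos]
      simp only [Gd, Set.mem_ofPred_eq, not_forall, not_le] at hg
      obtain ⟨i, hi, hg⟩ := hg
      refine le_trans ?_ (Finset.single_le_sum (fun i _ => add_nonneg (hFp α i) (hFp (-α) i)) (Finset.mem_range.2 hi))
      rcases lt_abs.1 hg with hg | hg
      · have : wt N n K θ v ω ≤ F α i ω := by
          rw [hFe _ _ _ hi]
          exact le_mul_of_one_le_right hwp (Real.one_le_exp (by nlinarith))
        linarith [hFp (-α) i]
      · have : wt N n K θ v ω ≤ F (-α) i ω := by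
          rw [hFe _ _ _ hi]
          exact le_mul_of_one_le_right hwp (Real.one_le_exp (by nlinarith))
        linarith [hFp α i]
  have hFs : ∀ i, Integrable (fun ω => F α i ω + F (-α) i ω) P := fun i => (hFi α i).1.add (hFi (-α) i).1
  have hint : Integrable (fun ω => ∑ i ∈ Finset.range K, (F α i ω + F (-α) i ω)) P :=
    integrable_finsetSum _ fun i _ => hFs i
  have := integral_mono ((wt_int h H hv K θ).1.sub hint) (Wv_int h H hv K θ mm r) hpt
  refine le_trans ?_ this
  simp only [Pi.sub_apply]
  rw [integral_sub (wt_int h H hv K θ).1 hint, (wt_int h H hv K θ).2, integral_finsetSum _ fun i _ => hFs i]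
  refine sub_le_sub_left ?_ _
  refine (Finset.sum_le_card_nsmul _ _ (2 * Real.exp (α * c1 + α^2 * c2 / 2 - α * r)) fun i hi => ?_).trans (by simp)
  rw [integral_add (hFi α i).1 (hFi (-α) i).1]
  have hi := Finset.mem_range.1 hi
  linarith [hFb α (abs_of_nonneg hα) i hi, hFb (-α) (by rw [abs_neg, abs_of_nonneg hα]) i hi]

lemma pair_moment {N : ℕ} {P : Measure FieldSp} (h : IsGFF N P) {n : ℕ → ℤ} (H : Dy N n) {v v' : Vtx} (hv : InB n v) (hv' : InB n v') (K : ℕ) (θ mm : ℕ → ℝ)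
    (r : ℝ) (hθ : ∀ j, 0 ≤ θ j) (k : ℕ)
    (hc : Cv N (kb n K θ v') (kb n K (fun j => if j ≤ k then 0 else θ j) v) = 0) :
    Integrable (fun ω => Wv N n K θ mm r v ω * Wv N n K θ mm r v' ω) P ∧
    ∫ ω, Wv N n K θ mm r v ω * Wv N n K θ mm r v' ω ∂P ≤
      Real.exp (∑ j ∈ Finset.range K, if j ≤ k then θ j * (mm j + r) - θ j ^ 2 * ub n j v / 2 else 0) := by
  set a : ℕ → ℝ := fun j => if j ≤ k then 0 else θ j with ha
  set X := ∑ j ∈ Finset.range K, if j ≤ k then θ j * (mm j + r) else 0 with hX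
  set S := fun v => ∑ j ∈ Finset.range K, θ j ^ 2 * ub n j v with hS
  set kk : Vtx → ℝ := fun z => kb n K a v z + kb n K θ v' z with hkk
  have hks : ∀ x ∉ intr (VN N), kk x = 0 := fun x hx => by simp only [hkk]; rw [kb_supp H hv K a x hx, kb_supp H hv' K θ x hx, add_zero]
  have hm := xi_mgf h hks
  have hCv : Cv N kk kk = ∑ j ∈ Finset.range K, a j ^ 2 * ub n j v + S v' := by
    have e1 : Cv N kk kk = Cv N (kb n K a v) (kb n K a v) + Cv N (kb n K θ v') (kb n K θ v') + Cv N (kb n K θ v') (kb n K a v) + Cv N (kb n K a v) (kb n K θ v') := by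
      simp only [Cv, hkk, lap_add, ← Finset.sum_add_distrib]
      refine Finset.sum_congr rfl fun x _ => by ring
    rw [e1, Cv_symm (kb_supp H hv K a) (kb_supp H hv' K θ), hc, kb_var H hv, kb_var H hv']; simp [hS]
  have hb : ∀ ω, Wv N n K θ mm r v ω * Wv N n K θ mm r v' ω ≤ Real.exp (xi N kk ω) * Real.exp (X - S v/2 - S v'/2) := fun ω => by
    by_cases hg : ω ∈ Gd N n K mm r v
    · have e2 : Wv N n K θ mm r v' ω ≤ wt N n K θ v' ω := Set.indicator_le_self' (fun _ _ => (Real.exp_pos _).le) _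
      have e1 : Wv N n K θ mm r v ω = wt N n K θ v ω := Set.indicator_of_mem hg _
      rw [e1]
      refine (mul_le_mul_of_nonneg_left e2 (Real.exp_pos _).le).trans ?_
      simp only [wt]
      rw [← Real.exp_add, ← Real.exp_add, Real.exp_le_exp]
      simp only [hkk]
      rw [xi_add, kb_xi N n K a v, kb_xi N n K θ v]
      have : ∑ j ∈ Finset.range K, θ j * xi N (dk n j v) ω ≤ ∑ j ∈ Finset.range K, a j * xi N (dk n j v) ω + X := by
        rw [hX, ← Finset.sum_add_distrib]
        refine Finset.sum_le_sum fun j hj => ?_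
        simp only [ha]
        split_ifs with hjk
        · rw [zero_mul, zero_add]
          exact mul_le_mul_of_nonneg_left (by linarith [(abs_le.1 (hg j (Finset.mem_range.1 hj))).2]) (hθ j)
        · linarith
      simp only [hS]
      linarith
    · have e1 : Wv N n K θ mm r v ω = 0 := Set.indicator_of_notMem hg _
      rw [e1, zero_mul]; positivity
  have hi := hm.1.mul_const (Real.exp (X - S v/2 - S v'/2))
  have hI : Integrable (fun ω => Wv N n K θ mm r v ω * Wv N n K θ mm r v' ω) P := by
    refine hi.mono' ((Wv_int h H hv K θ mm r).1.mul (Wv_int h H hv' K θ mm r).1) (Eventually.of_forall fun ω => ?_)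
    rw [Real.norm_of_nonneg (mul_nonneg (Wv_nonneg _ _ _ _ _ _ _ _) (Wv_nonneg _ _ _ _ _ _ _ _))]
    exact hb ω
  refine ⟨hI, (integral_mono hI hi hb).trans ?_⟩
  rw [integral_mul_const, hm.2, ← Real.exp_add, Real.exp_le_exp, hCv]
  have : ∑ j ∈ Finset.range K, a j ^ 2 * ub n j v / 2 + X - S v/2 = ∑ j ∈ Finset.range K, if j ≤ k then θ j * (mm j + r) - θ j ^ 2 * ub n j v / 2 else 0 := by
    simp only [hX, hS, Finset.sum_div, ← Finset.sum_add_distrib, ← Finset.sum_sub_distrib]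
    refine Finset.sum_congr rfl fun j _ => ?_
    simp only [ha]
    split_ifs <;> ring
  rw [← this, ← Finset.sum_div]
  linarith

lemma second_moment {P : Measure FieldSp} [IsProbabilityMeasure P] (T : Finset Vtx) (W : Vtx → FieldSp → ℝ)
    (hW : ∀ v ∈ T, Integrable (W v) P) (hWW : ∀ v ∈ T, ∀ v' ∈ T, Integrable (fun ω => W v ω * W v' ω) P) {δ : ℝ}
    (h1 : ∀ v ∈ T, 1 - δ ≤ ∫ ω, W v ω ∂P) (h2 : ∑ v ∈ T, ∑ v' ∈ T, ∫ ω, W v ω * W v' ω ∂P ≤ (1 + δ) * (T.card:ℝ)^2) (hT : 0 < T.card) :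
    P {ω | (T.card:ℝ) / 2 < ∑ v ∈ T, W v ω}ᶜ ≤ ENNReal.ofReal (12 * δ) := by
  set n : ℝ := (T.card : ℝ) with hn
  have hn0 : 0 < n := by rw [hn]; exact_mod_cast hT
  have i1 : Integrable (fun ω => ∑ v ∈ T, W v ω) P := integrable_finsetSum _ hW
  have i2 : Integrable (fun ω => ∑ v ∈ T, ∑ v' ∈ T, W v ω * W v' ω) P :=
    integrable_finsetSum _ fun v hv => integrable_finsetSum _ fun v' hv' => hWW v hv v' hv'
  have e : (fun ω => (∑ v ∈ T, W v ω - n)^2) = fun ω => ∑ v ∈ T, ∑ v' ∈ T, W v ω * W v' ω - 2 * n * ∑ v ∈ T, W v ω + n^2 := by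
    funext ω; rw [← Finset.sum_mul_sum]; ring
  have i4 : Integrable (fun ω => ∑ v ∈ T, ∑ v' ∈ T, W v ω * W v' ω - 2 * n * ∑ v ∈ T, W v ω) P := i2.sub (i1.const_mul _)
  have i3 : Integrable (fun ω => (∑ v ∈ T, W v ω - n)^2) P := by
    rw [e]; exact i4.add (integrable_const _)
  have hE : ∫ ω, (∑ v ∈ T, W v ω - n)^2 ∂P ≤ 3 * δ * n^2 := by
    rw [e, integral_add i4 (integrable_const _), integral_sub i2 (i1.const_mul _), integral_const_mul,
      integral_finsetSum _ hW, integral_finsetSum _ fun v hv => integrable_finsetSum _ fun v' hv' => hWW v hv v' hv',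
      Finset.sum_congr rfl fun v hv => integral_finsetSum _ fun v' hv' => hWW v hv v' hv']
    have := Finset.card_nsmul_le_sum _ _ _ h1
    rw [nsmul_eq_mul, ← hn] at this
    simp only [integral_const, smul_eq_mul]
    simp
    nlinarith
  have hM := mul_meas_ge_le_integral_of_nonneg (μ := P) (Eventually.of_forall fun ω => sq_nonneg _) i3 (n^2/4)
  have hM2 : P.real {ω | n^2/4 ≤ (∑ v ∈ T, W v ω - n)^2} ≤ 12 * δ := by
    have := hM.trans hE
    have h4 : n^2/4 * P.real {ω | n^2/4 ≤ (∑ v ∈ T, W v ω - n)^2} ≤ n^2/4 * (12 * δ) := by linarith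
    exact le_of_mul_le_mul_left h4 (by positivity)
  refine (measure_mono (t := {ω | n^2/4 ≤ (∑ v ∈ T, W v ω - n)^2}) fun ω hω => ?_).trans ?_
  · simp only [Set.mem_compl_iff, Set.mem_ofPred_eq, not_lt] at hω ⊢
    nlinarith
  · rw [← ENNReal.ofReal_toReal (measure_ne_top P _)]
    exact ENNReal.ofReal_le_ofReal hM2

noncomputable def G1 (n : ℕ → ℤ) (K k : ℕ) : Finset ℤ :=
  (Finset.Ico 0 (n k)).filter fun x => ∀ j, k ≤ j → j < K → n j ≤ 4 * (x % n j) ∧ 4 * (x % n j) ≤ 3 * n j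

lemma G1_card {N : ℕ} {n : ℕ → ℤ} (H : Dy N n) {K : ℕ} (hK : n K = 1) (h4 : ∀ k < K, ∃ E : ℤ, 0 < E ∧ n k = 4 * E * n (k+1)) :
    ∀ d ≤ K, n (K - d) ≤ 2^d * (G1 n K (K - d)).card := by
  intro d
  induction d with
  | zero =>
    intro _
    have : G1 n K K = {0} := by
      ext x; simp only [G1, Finset.mem_filter, Finset.mem_Ico, hK, Finset.mem_singleton]
      constructor
      · intro h; omega
      · rintro rfl; exact ⟨by omega, fun j h1 h2 => absurd h2 (by omega)⟩
    simp [hK, this]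
  | succ d ih =>
    intro hd
    have ih := ih (by omega)
    obtain ⟨k, hk⟩ : ∃ k, k = K - (d+1) := ⟨_, rfl⟩
    have e : K - d = k + 1 := by omega
    rw [← hk]; rw [e] at ih
    obtain ⟨E, hE, hn⟩ := h4 k (by omega)
    have hp := H.pos (k+1)
    have hc : (G1 n K (k+1) ×ˢ Finset.Ico 0 (2*E)).card ≤ (G1 n K k).card := by
      refine Finset.card_le_card_of_injOn (fun w => w.1 + n (k+1) * (w.2 + E)) ?_ ?_
      · rintro ⟨x, q⟩ hw
        simp only [G1, Finset.coe_product, Set.mem_prod, Finset.mem_coe, Finset.mem_filter, Finset.mem_Ico] at hw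
        obtain ⟨⟨hx, hj⟩, hq⟩ := hw
        have b1 : n (k+1) * (q + E) ≤ n (k+1) * (3 * E - 1) := mul_le_mul_of_nonneg_left (by omega) hp.le
        have b2 : n (k+1) * E ≤ n (k+1) * (q + E) := mul_le_mul_of_nonneg_left (by omega) hp.le
        have b3 : 0 < n (k+1) * E := mul_pos hp hE
        simp only [G1, Finset.mem_coe, Finset.mem_filter, Finset.mem_Ico]
        have r : 0 ≤ x + n (k+1) * (q + E) ∧ x + n (k+1) * (q + E) < n k := ⟨by nlinarith, by nlinarith⟩
        refine ⟨r, fun j h1 h2 => ?_⟩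
        rcases eq_or_lt_of_le h1 with rfl | h1
        · rw [Int.emod_eq_of_lt r.1 r.2]; constructor <;> nlinarith
        · obtain ⟨c, _, ec⟩ := H.dvd' (show k + 1 ≤ j from h1)
          rw [ec, mul_assoc, Int.add_mul_emod_self_left]
          exact hj j h1 h2
      · rintro ⟨x, q⟩ hw ⟨x', q'⟩ hw' hh
        simp only [G1, Finset.coe_product, Set.mem_prod, Finset.mem_coe, Finset.mem_filter, Finset.mem_Ico] at hw hw'
        simp only at hh
        have e1 := congrArg (· % n (k+1)) hh
        simp only [Int.add_mul_emod_self_left] at e1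
        rw [Int.emod_eq_of_lt hw.1.1.1 hw.1.1.2, Int.emod_eq_of_lt hw'.1.1.1 hw'.1.1.2] at e1
        subst e1
        have e2 := mul_left_cancel₀ hp.ne' (add_left_cancel hh)
        have : q = q' := by omega
        rw [this]
    rw [Finset.card_product, Int.card_Ico] at hc
    have hc' : ((G1 n K (k+1)).card : ℤ) * (2 * E) ≤ (G1 n K k).card := by
      have : (((2 * E - 0).toNat : ℕ) : ℤ) = 2 * E := by omega
      rw [← this]; exact_mod_cast hc
    rw [hn, pow_succ]
    have p : (0:ℤ) < 2^d := by positivity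
    nlinarith [mul_le_mul_of_nonneg_left hc' p.le, mul_le_mul_of_nonneg_left ih hE.le]

noncomputable def TT (n : ℕ → ℤ) (K : ℕ) : Finset Vtx := G1 n K 0 ×ˢ G1 n K 0

lemma TT_inB {n : ℕ → ℤ} {K : ℕ} {v : Vtx} (hv : v ∈ TT n K) : InB n v := by
  simp only [TT, G1, Finset.mem_product, Finset.mem_filter, Finset.mem_Ico] at hv
  exact ⟨hv.1.1, hv.2.1⟩

lemma TT_mod {n : ℕ → ℤ} {K : ℕ} {v : Vtx} (hv : v ∈ TT n K) {k : ℕ} (hk : k < K) :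
    (n k ≤ 4 * (v.1 % n k) ∧ 4 * (v.1 % n k) ≤ 3 * n k) ∧ (n k ≤ 4 * (v.2 % n k) ∧ 4 * (v.2 % n k) ≤ 3 * n k) := by
  simp only [TT, G1, Finset.mem_product, Finset.mem_filter] at hv
  exact ⟨hv.1.2 k (Nat.zero_le _) hk, hv.2.2 k (Nat.zero_le _) hk⟩

lemma TT_dR {n : ℕ → ℤ} {K : ℕ} {v : Vtx} (hv : v ∈ TT n K) {k : ℕ} (hk : k < K) :
    n k ≤ 4 * dR (n k * (v.1 / n k), n k * (v.2 / n k)) (n k * (v.1 / n k) + n k, n k * (v.2 / n k) + n k) v ∧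
    2 * dR (n k * (v.1 / n k), n k * (v.2 / n k)) (n k * (v.1 / n k) + n k, n k * (v.2 / n k) + n k) v ≤ n k := by
  have h := TT_mod hv hk
  have e1 := Int.emod_add_mul_ediv v.1 (n k)
  have e2 := Int.emod_add_mul_ediv v.2 (n k)
  simp only [dR]
  omega

lemma same_count {N : ℕ} {n : ℕ → ℤ} (H : Dy N n) (T : Finset Vtx) (v : Vtx) (k : ℕ) : ((T.filter (same n k v)).card : ℝ) ≤ (n k:ℝ)^2 := by
  have hs : T.filter (same n k v) ⊆ Finset.Ico (n k * (v.1 / n k)) (n k * (v.1 / n k) + n k) ×ˢ Finset.Ico (n k * (v.2 / n k)) (n k * (v.2 / n k) + n k) := by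
    intro w hw
    obtain ⟨_, h1, h2⟩ := Finset.mem_filter.1 hw
    rw [h1, h2, Finset.mem_product, Finset.mem_Ico, Finset.mem_Ico]
    exact ⟨⟨Int.mul_ediv_self_le (H.pos k).ne', Int.lt_mul_ediv_self_add (H.pos k)⟩, ⟨Int.mul_ediv_self_le (H.pos k).ne', Int.lt_mul_ediv_self_add (H.pos k)⟩⟩
  have := Finset.card_le_card hs
  rw [Finset.card_product, Int.card_Ico, Int.card_Ico, add_sub_cancel_left, add_sub_cancel_left] at this
  have e : (((n k).toNat : ℕ) : ℤ) = n k := Int.toNat_of_nonneg (H.pos k).le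
  have e' : (((n k).toNat : ℕ) : ℝ) = n k := by exact_mod_cast e
  rw [← e', sq]; exact_mod_cast this

noncomputable def nn (t : ℕ → ℝ) (N k : ℕ) : ℤ := (2:ℤ)^(Nat.log 2 ⌊(N:ℝ)^(1 - t k)⌋₊)

lemma nn_bd {t : ℕ → ℝ} {N k : ℕ} (hN : 1 ≤ N) (h1 : t k ≤ 1) : (nn t N k : ℝ) ≤ (N:ℝ)^(1 - t k) ∧ (N:ℝ)^(1 - t k) < 2 * nn t N k := by
  have hN' : (1:ℝ) ≤ N := by exact_mod_cast hN
  have hx : (1:ℝ) ≤ (N:ℝ)^(1 - t k) := Real.one_le_rpow hN' (by linarith)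
  have hf : 1 ≤ ⌊(N:ℝ)^(1 - t k)⌋₊ := (Nat.one_le_floor_iff _).2 hx
  have a1 := Nat.pow_log_le_self 2 (show ⌊(N:ℝ)^(1 - t k)⌋₊ ≠ 0 by omega)
  have a2 := Nat.lt_pow_succ_log_self (show 1 < 2 by norm_num) ⌊(N:ℝ)^(1 - t k)⌋₊
  have b1 := Nat.floor_le (show 0 ≤ (N:ℝ)^(1 - t k) by linarith)
  have b2 := Nat.lt_floor_add_one ((N:ℝ)^(1 - t k))
  have a2' : ⌊(N:ℝ)^(1 - t k)⌋₊ + 1 ≤ 2 * 2^(Nat.log 2 ⌊(N:ℝ)^(1 - t k)⌋₊) := by rw [pow_succ] at a2; omega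
  have c1 : ((2:ℝ)^(Nat.log 2 ⌊(N:ℝ)^(1 - t k)⌋₊)) ≤ (⌊(N:ℝ)^(1 - t k)⌋₊ : ℝ) := by exact_mod_cast a1
  have c2 : (⌊(N:ℝ)^(1 - t k)⌋₊ : ℝ) + 1 ≤ 2 * (2:ℝ)^(Nat.log 2 ⌊(N:ℝ)^(1 - t k)⌋₊) := by exact_mod_cast a2'
  unfold nn
  push_cast
  exact ⟨c1.trans b1, b2.trans_le c2⟩

lemma nn_dy {t : ℕ → ℝ} {K N : ℕ} (hN : 1 ≤ N) (ht : Grid K t) : Dy N (nn t N) where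
  pos k := by unfold nn; positivity
  dvd k := by
    unfold nn
    have hN' : (1:ℝ) ≤ N := by exact_mod_cast hN
    exact pow_dvd_pow _ (Nat.log_mono_right (Nat.floor_mono (Real.rpow_le_rpow_of_exponent_le hN' (by linarith [ht.mono (Nat.le_succ k)]))))
  le := by
    have := (nn_bd hN (ht.le1 0)).1
    rw [ht.zero, sub_zero, Real.rpow_one] at this; exact_mod_cast this

noncomputable def C3 : ℝ := C1 + Real.log 8

structure Geo (N K : ℕ) (t : ℕ → ℝ) (ρ : ℝ) (n : ℕ → ℤ) (T : Finset Vtx) : Prop where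
  dy : Dy N n
  inb : ∀ v ∈ T, InB n v
  nK : n K = 1
  var : ∀ v ∈ T, ∀ k ≤ K, |gr (Ib n k v) v v - (1 - t k) * Real.log N| ≤ C3
  rat : ∀ k, (n k:ℝ)^2 ≤ 4^(K+1) * Real.exp (-(2 * t k) * Real.log N) * T.card
  card : Real.exp (2 * Real.log N) ≤ 4^(K+1) * T.card
  sub : T ⊆ AN N ρ
  en : ∀ v ∈ T, ∀ k ≤ K, Cv N (fun z => gr (Ik N (t k) v) v z - gr (Ib n k v) v z) (fun z => gr (Ik N (t k) v) v z - gr (Ib n k v) v z) ≤ 8 * C2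

lemma geo_var {N K : ℕ} {t : ℕ → ℝ} (hN : 1 ≤ N) (ht : Grid K t) (hnK : nn t N K = 1) {v : Vtx} (hv : v ∈ TT (nn t N) K) {k : ℕ} (hk : k ≤ K) :
    |gr (Ib (nn t N) k v) v v - (1 - t k) * Real.log N| ≤ C3 := by
  have hN' : (1:ℝ) ≤ N := by exact_mod_cast hN
  have l8 : 0 < Real.log 8 := Real.log_pos (by norm_num)
  rcases eq_or_lt_of_le hk with rfl | hk
  · rw [gr_off, ht.one k le_rfl]
    · simp only [sub_self, zero_mul, abs_zero, C3]; linarith [C1_nonneg]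
    · rw [Ib, mem_Rc, hnK]; simp only [one_mul, Int.ediv_one]; omega
  · have e := est' (nn t N k * (v.1 / nn t N k), nn t N k * (v.2 / nn t N k)) (nn t N k * (v.1 / nn t N k) + nn t N k, nn t N k * (v.2 / nn t N k) + nn t N k) v
    have hd := TT_dR hv hk
    set d := dR (nn t N k * (v.1 / nn t N k), nn t N k * (v.2 / nn t N k)) (nn t N k * (v.1 / nn t N k) + nn t N k, nn t N k * (v.2 / nn t N k) + nn t N k) v
    have hp := (nn_dy hN ht).pos k
    have hd0 : 0 < d := by omega
    obtain ⟨b1, b2⟩ := nn_bd (k := k) hN (ht.le1 k)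
    have d1 : (nn t N k : ℝ) ≤ 4 * d := by exact_mod_cast hd.1
    have d2 : 2 * (d:ℝ) ≤ nn t N k := by exact_mod_cast hd.2
    have d0 : (0:ℝ) < d := by exact_mod_cast hd0
    have hx : 0 < (N:ℝ)^(1 - t k) := by positivity
    rw [lgp_of_pos hd0] at e
    have u1 := Real.log_le_log d0 (show (d:ℝ) ≤ (N:ℝ)^(1 - t k) by linarith)
    have u2 := Real.log_le_log hx (show (N:ℝ)^(1 - t k) ≤ 8 * d by linarith)
    rw [Real.log_mul (by norm_num) d0.ne', Real.log_rpow (by linarith)] at u2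
    rw [Real.log_rpow (by linarith)] at u1
    have := abs_le.1 e
    unfold C3 Ib
    rw [abs_le]; constructor <;> linarith

lemma geo_en {N K : ℕ} {P : Measure FieldSp} (hP : IsGFF N P) {t : ℕ → ℝ} (hN : 1 ≤ N) (ht : Grid K t) (hs : ∀ k < K, t k < t (k+1)) (hnK : nn t N K = 1)
    (hX : ∀ k < K, 8 ≤ (N:ℝ)^(1 - t k)) {v : Vtx} (hvV : v ∈ VN N) (hv : v ∈ TT (nn t N) K) {k : ℕ} (hk : k ≤ K) :
    Cv N (fun z => gr (Ik N (t k) v) v z - gr (Ib (nn t N) k v) v z) (fun z => gr (Ik N (t k) v) v z - gr (Ib (nn t N) k v) v z) ≤ 8 * C2 := by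
  have H := nn_dy hN ht
  have hin := TT_inB hv
  rcases eq_or_lt_of_le hk with rfl | hk
  · have e1 : Ik N (t k) v = ∅ := by
      rw [Ik_eq hvV, ht.one k le_rfl]
      ext w; simp only [mem_Rc, rr, pI, qI, Prod.fst_sup, Prod.snd_sup, Prod.fst_inf, Prod.snd_inf]; norm_num; omega
    have e2 : Ib (nn t N) k v = ∅ := by
      ext w; rw [Ib, mem_Rc, hnK]; simp only [one_mul, Int.ediv_one, Finset.notMem_empty, iff_false]; omega
    rw [e1, e2]
    have : (fun z => gr ∅ v z - gr ∅ v z) = fun z => (0:ℝ) := by funext z; simp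
    rw [this]
    have c := C2_nonneg
    have : Cv N (fun z => (0:ℝ)) (fun z => (0:ℝ)) = 0 := by simp [Cv]
    rw [this]; linarith
  · have hb := TT_dR hv hk
    have hb0 := TT_mod hv (k := 0) (by omega)
    rw [Int.emod_eq_of_lt hin.1.1 hin.1.2, Int.emod_eq_of_lt hin.2.1 hin.2.2] at hb0
    have hp := H.pos k
    have hp0 := H.pos 0
    have hle := H.le
    have hk0 : nn t N k ≤ nn t N 0 := by
      obtain ⟨c, hc, e⟩ := H.dvd' (Nat.zero_le k); rw [e]; nlinarith
    have hdV : nn t N 0 ≤ 4 * dV N v := by simp only [dV, dR]; omega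
    have hdV2 : 2 * dV N v ≤ N := by simp only [dV, dR]; omega
    have dI := Ik_dR_self (N := N) (rr N (t k)) v
    have IkE := Ik_eq (t := t k) hvV
    have hIk : Rc (pI N (rr N (t k)) v) (qI N (rr N (t k)) v) ⊆ intr (VN N) := IkE ▸ Ik_sub hvV
    have hIb := Ib_sub H hin.1 hin.2 k
    have key : nn t N k ≤ 8 * min (dV N v) (rr N (t k)) ∧ min (dV N v) (rr N (t k)) ≤ nn t N k := by
      obtain ⟨b1, b2⟩ := nn_bd (t := t) (k := k) hN (ht.le1 k)
      rcases Nat.eq_zero_or_pos k with rfl | hk1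
      · have : rr N (t 0) = N := by simp [rr, ht.zero]
        rw [this]
        rw [ht.zero, sub_zero, Real.rpow_one] at b2
        have b2' : (N:ℤ) < 2 * nn t N 0 := by exact_mod_cast b2
        omega
      · have t0 : t k ≠ 0 := by
          have := hs 0 (by omega); have := ht.mono (show 1 ≤ k from hk1); have := ht.zero; simp at *; linarith
        have t1 : t k ≠ 1 := by have := hs k hk; have := ht.le1 (k+1); linarith
        have er : rr N (t k) = ⌊(N:ℝ)^(1 - t k)/2⌋ := by rw [rr, if_neg t0, if_neg t1]
        have f1 := Int.floor_le ((N:ℝ)^(1 - t k)/2)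
        have f2 := Int.lt_floor_add_one ((N:ℝ)^(1 - t k)/2)
        rw [← er] at f1 f2
        have h8 := hX k hk
        have g1 : rr N (t k) ≤ nn t N k := by
          have : (rr N (t k) : ℝ) ≤ nn t N k := by linarith
          exact_mod_cast this
        have g2 : nn t N k ≤ 8 * rr N (t k) := by
          have : (nn t N k : ℝ) ≤ 8 * rr N (t k) := by linarith
          exact_mod_cast this
        omega
    have d1 := dR_inter (pI N (rr N (t k)) v) (qI N (rr N (t k)) v) (nn t N k * (v.1 / nn t N k), nn t N k * (v.2 / nn t N k)) (nn t N k * (v.1 / nn t N k) + nn t N k, nn t N k * (v.2 / nn t N k) + nn t N k) v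
    have d2 := dR_inter (nn t N k * (v.1 / nn t N k), nn t N k * (v.2 / nn t N k)) (nn t N k * (v.1 / nn t N k) + nn t N k, nn t N k * (v.2 / nn t N k) + nn t N k) (pI N (rr N (t k)) v) (qI N (rr N (t k)) v) v
    have eA := inter_energy (v := v) hIk (by rw [d1, dI]; omega) (by rw [d1, dI]; omega)
    have eB := inter_energy (v := v) hIb (by rw [d2, dI]; omega) (by rw [d2, dI]; omega)
    rw [Finset.inter_comm] at eB
    rw [← IkE] at eA eB hIk
    change Cv N (fun z => gr (Ib (nn t N) k v) v z - _) (fun z => gr (Ib (nn t N) k v) v z - _) ≤ _ at eB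
    rw [← Ib] at eA eB
    have := Cv_sub_le hP (k := fun z => gr (Ik N (t k) v) v z - gr (Ik N (t k) v ∩ Ib (nn t N) k v) v z)
      (k' := fun z => gr (Ib (nn t N) k v) v z - gr (Ik N (t k) v ∩ Ib (nn t N) k v) v z)
      (fun x hx => by rw [gr_off fun h => hx (hIk h), gr_off fun h => hx (hIk (Finset.mem_inter.1 h).1), sub_self])
      (fun x hx => by rw [gr_off fun h => hx (hIb h), gr_off fun h => hx (hIk (Finset.mem_inter.1 h).1), sub_self])
    simp only [sub_sub_sub_cancel_right] at this
    linarith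

lemma geo_ev {P : ℕ → Measure FieldSp} (hP : ∀ N, IsGFF N (P N)) {K : ℕ} {t : ℕ → ℝ} (ht : Grid K t) (hs : ∀ k < K, t k < t (k+1)) (hK : 1 ≤ K) {ρ : ℝ} (hρ : 0 < ρ) :
    ∀ᶠ N in atTop, Geo N K t ρ (nn t N) (TT (nn t N) K) := by
  have h1 : ∀ᶠ N : ℕ in atTop, ∀ k ∈ Finset.range K, 8 ≤ (N:ℝ)^(1 - t k) :=
    (Finset.eventually_all _).2 fun k hk => rpow_ev (by linarith [hs k (Finset.mem_range.1 hk), ht.le1 (k+1)]) 8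
  have h2 : ∀ᶠ N : ℕ in atTop, ∀ k ∈ Finset.range K, 8 ≤ (N:ℝ)^(t (k+1) - t k) :=
    (Finset.eventually_all _).2 fun k hk => rpow_ev (by linarith [hs k (Finset.mem_range.1 hk)]) 8
  filter_upwards [h1, h2, rpow_ev hρ 8, eventually_ge_atTop 1] with N h1 h2 h3 hN
  have hN' : (1:ℝ) ≤ N := by exact_mod_cast hN
  have hN0 : (0:ℝ) < N := by linarith
  have H := nn_dy hN ht
  have hnK : nn t N K = 1 := by unfold nn; rw [ht.one K le_rfl]; simp
  have h4 : ∀ k < K, ∃ E : ℤ, 0 < E ∧ nn t N k = 4 * E * nn t N (k+1) := by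
    intro k hk
    have b1 := (nn_bd (t := t) (k := k) hN (ht.le1 k)).2
    have b2 := (nn_bd (t := t) (k := k+1) hN (ht.le1 (k+1))).1
    have e : (N:ℝ)^(1 - t k) = (N:ℝ)^(t (k+1) - t k) * (N:ℝ)^(1 - t (k+1)) := by rw [← Real.rpow_add hN0]; congr 1; ring
    have hx : 0 < (N:ℝ)^(1 - t (k+1)) := by positivity
    have h8 := h2 k (Finset.mem_range.2 hk)
    have : (4:ℝ) * nn t N (k+1) < nn t N k := by nlinarith
    have : 4 * nn t N (k+1) < nn t N k := by exact_mod_cast this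
    unfold nn at this ⊢
    set a := Nat.log 2 ⌊(N:ℝ)^(1 - t k)⌋₊
    set b := Nat.log 2 ⌊(N:ℝ)^(1 - t (k+1))⌋₊
    have hab : b + 2 < a := by
      rw [show (4:ℤ) * 2^b = 2^(b+2) by ring] at this
      exact (pow_lt_pow_iff_right₀ (by norm_num : (1:ℤ) < 2)).1 this
    refine ⟨2^(a - b - 2), by positivity, ?_⟩
    rw [show (4:ℤ) = 2^2 by norm_num, ← pow_add, ← pow_add]; congr 1; omega
  have hsub : TT (nn t N) K ⊆ AN N ρ := by
    intro v hv
    have hin := TT_inB hv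
    have hb0 := TT_mod hv (k := 0) (by omega)
    rw [Int.emod_eq_of_lt hin.1.1 hin.1.2, Int.emod_eq_of_lt hin.2.1 hin.2.2] at hb0
    have hle := H.le
    have hp0 := H.pos 0
    rw [AN, Finset.mem_filter, mem_VN]
    refine ⟨by omega, fun z hz => ?_⟩
    rw [mem_VN] at hz
    have b2 := (nn_bd (t := t) (k := 0) hN (ht.le1 0)).2
    rw [ht.zero, sub_zero, Real.rpow_one] at b2
    have hd : nn t N 0 ≤ 4 * |v.1 - z.1| ∨ nn t N 0 ≤ 4 * |v.2 - z.2| := by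
      have := le_abs_self (v.1 - z.1); have := neg_le_abs (v.1 - z.1); have := le_abs_self (v.2 - z.2); have := neg_le_abs (v.2 - z.2); omega
    have hle2 : (N:ℝ)^(1 - ρ) ≤ nn t N 0 / 4 := by
      have e : (N:ℝ) = (N:ℝ)^ρ * (N:ℝ)^(1 - ρ) := by rw [← Real.rpow_add hN0]; simp
      have hx : 0 < (N:ℝ)^(1 - ρ) := by positivity
      nlinarith
    refine hle2.trans (Real.le_sqrt_of_sq_le ?_)
    have hp0' : (0:ℝ) < nn t N 0 := by exact_mod_cast hp0
    rcases hd with hd | hd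
    · have : (nn t N 0 : ℝ) ≤ 4 * |(v.1:ℝ) - z.1| := by exact_mod_cast hd
      have h5 := pow_le_pow_left₀ (by positivity) (show (nn t N 0 : ℝ) / 4 ≤ |(v.1:ℝ) - z.1| by linarith) 2
      rw [sq_abs] at h5; nlinarith [sq_nonneg ((v.2:ℝ) - z.2)]
    · have : (nn t N 0 : ℝ) ≤ 4 * |(v.2:ℝ) - z.2| := by exact_mod_cast hd
      have h5 := pow_le_pow_left₀ (by positivity) (show (nn t N 0 : ℝ) / 4 ≤ |(v.2:ℝ) - z.2| by linarith) 2
      rw [sq_abs] at h5; nlinarith [sq_nonneg ((v.1:ℝ) - z.1)]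
  have hcard : Real.exp (2 * Real.log N) ≤ 4^(K+1) * (TT (nn t N) K).card := by
    have g := G1_card H hnK h4 K le_rfl
    rw [Nat.sub_self] at g
    have g' : (nn t N 0 : ℝ) ≤ 2^K * ((G1 (nn t N) K 0).card : ℝ) := by exact_mod_cast g
    have b2 := (nn_bd (t := t) (k := 0) hN (ht.le1 0)).2
    rw [ht.zero, sub_zero, Real.rpow_one] at b2
    rw [two_mul, Real.exp_add, Real.exp_log hN0, TT, Finset.card_product]
    push_cast
    have h5 : (N:ℝ) ≤ 2^(K+1) * ((G1 (nn t N) K 0).card : ℝ) := by rw [pow_succ]; linarith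
    calc (N:ℝ) * N ≤ _ := mul_le_mul h5 h5 hN0.le (by positivity)
      _ = _ := by rw [show (4:ℝ) = 2 * 2 by norm_num, mul_pow]; ring
  refine ⟨H, fun v hv => TT_inB hv, hnK, fun v hv k hk => geo_var hN ht hnK hv hk, fun k => ?_, hcard, hsub, fun v hv k hk =>
    geo_en (hP N) hN ht hs hnK (fun k hk => h1 k (Finset.mem_range.2 hk)) (Finset.mem_filter.1 (hsub hv)).1 hv hk⟩
  have b1 := (nn_bd (t := t) (k := k) hN (ht.le1 k)).1
  have hp : (0:ℝ) ≤ nn t N k := by exact_mod_cast (H.pos k).le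
  rw [rpow_exp hN] at b1
  calc (nn t N k:ℝ)^2 ≤ (Real.exp ((1 - t k) * Real.log N))^2 := pow_le_pow_left₀ hp b1 2
    _ = Real.exp (-(2 * t k) * Real.log N) * Real.exp (2 * Real.log N) := by
        rw [← Real.exp_nat_mul, ← Real.exp_add]; congr 1; push_cast; ring
    _ ≤ Real.exp (-(2 * t k) * Real.log N) * (4^(K+1) * (TT (nn t N) K).card) := by gcongr
    _ = _ := by ring

noncomputable def Xk (K : ℕ) (t θ : ℕ → ℝ) (η : ℝ) (k : ℕ) : ℝ :=
  ∑ j ∈ Finset.range K, if j ≤ k then θ j ^ 2 * (t (j+1) - t j) / 2 + θ j * η else 0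
def Bad (K : ℕ) (θ : ℕ → ℝ) (k : ℕ) : Prop := ∃ j ≤ k, j < K ∧ θ j ≠ 0
noncomputable def bk (K : ℕ) (t θ : ℕ → ℝ) (η : ℝ) (N k : ℕ) : ℝ :=
  if Bad K θ k then Real.exp (Xk K t θ η k * Real.log N + C3 * ∑ j ∈ Finset.range K, θ j ^ 2) else 0
noncomputable def dl (K : ℕ) (t θ : ℕ → ℝ) (η : ℝ) (N : ℕ) : ℝ :=
  K * (2 * Real.exp (η * (2 * C3 * ∑ j ∈ Finset.range K, θ j) + η^2 * (Real.log N + 2 * C3) / 2 - η * (η * Real.log N))) +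
  ∑ k ∈ Finset.range (K+1), bk K t θ η N k * (4^(K+1) * Real.exp (-(2 * t k) * Real.log N))

lemma C3_nonneg : 0 ≤ C3 := by unfold C3; linarith [C1_nonneg, Real.log_pos (show (1:ℝ) < 8 by norm_num)]

lemma exp_lin_zero {a : ℝ} (ha : a < 0) (c : ℝ) : Tendsto (fun N : ℕ => Real.exp (a * Real.log N + c)) atTop (nhds 0) := by
  refine Real.tendsto_exp_atBot.comp (tendsto_atBot_add_const_right _ _ ?_)
  exact (Real.tendsto_log_atTop.comp tendsto_natCast_atTop_atTop).const_mul_atTop_of_neg ha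

lemma dl_zero {K : ℕ} {t θ : ℕ → ℝ} {η : ℝ} (h0 : 0 < η) (hη : ∀ k ≤ K, Bad K θ k → Xk K t θ η k < 2 * t k) : Tendsto (dl K t θ η) atTop (nhds 0) := by
  have e1 : Tendsto (fun N : ℕ => K * (2 * Real.exp (η * (2 * C3 * ∑ j ∈ Finset.range K, θ j) + η^2 * (Real.log N + 2 * C3) / 2 - η * (η * Real.log N)))) atTop (nhds 0) := by
    have := ((exp_lin_zero (show -(η^2/2) < 0 by nlinarith) (η * (2 * C3 * ∑ j ∈ Finset.range K, θ j) + η^2 * C3)).const_mul 2).const_mul (K:ℝ)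
    simp only [mul_zero] at this
    refine this.congr fun N => ?_
    congr 3; ring
  have e2 : Tendsto (fun N : ℕ => ∑ k ∈ Finset.range (K+1), bk K t θ η N k * (4^(K+1) * Real.exp (-(2 * t k) * Real.log N))) atTop (nhds 0) := by
    have z0 : (0:ℝ) = ∑ k ∈ Finset.range (K+1), (0:ℝ) := by simp
    refine Eq.subst (motive := fun x => Tendsto _ atTop (nhds x)) z0.symm (tendsto_finsetSum _ fun k hk => ?_)
    unfold bk
    split_ifs with hb
    · have := (exp_lin_zero (sub_neg.2 (hη k (by simpa [Nat.lt_succ_iff] using hk) hb)) (C3 * ∑ j ∈ Finset.range K, θ j ^ 2)).const_mul (4^(K+1))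
      rw [mul_zero] at this
      refine this.congr fun N => ?_
      rw [mul_left_comm, ← Real.exp_add]; congr 2; ring
    · simp
  have := e1.add e2
  rw [add_zero] at this; exact this

lemma pair_bd {N : ℕ} {P : Measure FieldSp} (h : IsGFF N P) {K : ℕ} {t : ℕ → ℝ} {ρ : ℝ} {n : ℕ → ℤ} {T : Finset Vtx} (G : Geo N K t ρ n T)
    {θ : ℕ → ℝ} (hθ : ∀ j, 0 ≤ θ j) {η : ℝ} (h0 : 0 < η) {v v' : Vtx} (hv : v ∈ T) (hv' : v' ∈ T) :
    Integrable (fun ω => Wv N n K θ (fun j => θ j * (t (j+1) - t j) * Real.log N) (η * Real.log N) v ω * Wv N n K θ (fun j => θ j * (t (j+1) - t j) * Real.log N) (η * Real.log N) v' ω) P ∧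
    ∫ ω, Wv N n K θ (fun j => θ j * (t (j+1) - t j) * Real.log N) (η * Real.log N) v ω * Wv N n K θ (fun j => θ j * (t (j+1) - t j) * Real.log N) (η * Real.log N) v' ω ∂P
      ≤ 1 + ∑ k ∈ Finset.range (K+1), if same n k v v' then bk K t θ η N k else 0 := by
  have H := G.dy
  have i1 := G.inb v hv
  have i2 := G.inb v' hv'
  have s0 : same n 0 v v' := by
    unfold same
    rw [Int.ediv_eq_zero_of_lt i1.1.1 i1.1.2, Int.ediv_eq_zero_of_lt i1.2.1 i1.2.2, Int.ediv_eq_zero_of_lt i2.1.1 i2.1.2, Int.ediv_eq_zero_of_lt i2.2.1 i2.2.2]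
    exact ⟨rfl, rfl⟩
  set k := Nat.findGreatest (fun k => same n k v v') K with hk
  have hkK : k ≤ K := Nat.findGreatest_le _
  have hs : same n k v v' := Nat.findGreatest_spec (P := fun k => same n k v v') (Nat.zero_le K) s0
  have hc : Cv N (kb n K θ v') (kb n K (fun j => if j ≤ k then 0 else θ j) v) = 0 := by
    rcases eq_or_lt_of_le hkK with e | hlt
    · have : kb n K (fun j => if j ≤ k then 0 else θ j) v = fun _ => 0 := by
        funext z
        refine Finset.sum_eq_zero fun j hj => ?_
        simp only; rw [if_pos (by have := Finset.mem_range.1 hj; omega), zero_mul]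
      rw [this]; simp [Cv]
    · exact kb_cross H i2 hs (Nat.findGreatest_is_greatest (P := fun k => same n k v v') (Nat.lt_succ_self k) hlt) K _ _ fun j hj => if_pos hj
  obtain ⟨p1, p2⟩ := pair_moment h H i1 i2 K θ (fun j => θ j * (t (j+1) - t j) * Real.log N) (η * Real.log N) hθ k hc
  refine ⟨p1, p2.trans ?_⟩
  have hbn : ∀ k, 0 ≤ bk K t θ η N k := fun k => by unfold bk; split_ifs; exacts [(Real.exp_pos _).le, le_rfl]
  have hS : bk K t θ η N k ≤ ∑ k ∈ Finset.range (K+1), if same n k v v' then bk K t θ η N k else 0 := by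
    have := Finset.single_le_sum (f := fun k => if same n k v v' then bk K t θ η N k else 0) (s := Finset.range (K+1))
      (fun i _ => by split_ifs; exacts [hbn i, le_rfl]) (Finset.mem_range.2 (Nat.lt_succ_of_le hkK))
    simpa only [if_pos hs] using this
  by_cases hb : Bad K θ k
  · refine le_trans ?_ (hS.trans (by linarith))
    rw [bk, if_pos hb]
    refine Real.exp_le_exp.2 ?_
    rw [Xk, Finset.sum_mul, Finset.mul_sum, ← Finset.sum_add_distrib]
    refine Finset.sum_le_sum fun j hj => ?_
    have hj := Finset.mem_range.1 hj
    have q := mul_nonneg C3_nonneg (sq_nonneg (θ j))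
    split_ifs
    · have a1 := abs_le.1 (G.var v hv j hj.le)
      have a2 := abs_le.1 (G.var v hv (j+1) hj)
      have : (t (j+1) - t j) * Real.log N - 2 * C3 ≤ ub n j v := by unfold ub; linarith
      nlinarith [mul_le_mul_of_nonneg_left this (sq_nonneg (θ j))]
    · linarith
  · have : (∑ j ∈ Finset.range K, if j ≤ k then θ j * (θ j * (t (j+1) - t j) * Real.log N + η * Real.log N) - θ j ^ 2 * ub n j v / 2 else 0) = 0 := by
      refine Finset.sum_eq_zero fun j hj => ?_
      split_ifs with hjk
      · have : θ j = 0 := by by_contra hne; exact hb ⟨j, hjk, Finset.mem_range.1 hj, hne⟩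
        rw [this]; ring
      · rfl
    rw [this, Real.exp_zero]
    linarith [hbn k]

lemma lower_W {P : ℕ → Measure FieldSp} (hP : ∀ N, IsGFF N (P N)) {K : ℕ} {t : ℕ → ℝ} (ht : Grid K t) {ρ : ℝ} {θ : ℕ → ℝ} (hθ : ∀ j, 0 ≤ θ j)
    {η : ℝ} (h0 : 0 < η) (hη : ∀ k ≤ K, Bad K θ k → Xk K t θ η k < 2 * t k) (n : ℕ → ℕ → ℤ) (T : ℕ → Finset Vtx)
    (hG : ∀ᶠ N in atTop, Geo N K t ρ (n N) (T N)) :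
    Whp P (fun N => {ω | ((T N).card:ℝ) / 2 < ∑ v ∈ T N, Wv N (n N) K θ (fun j => θ j * (t (j+1) - t j) * Real.log N) (η * Real.log N) v ω}) := by
  have hz : Tendsto (fun N => ENNReal.ofReal (12 * dl K t θ η N)) atTop (nhds 0) := by
    have := ENNReal.tendsto_ofReal ((dl_zero h0 hη).const_mul 12)
    simpa using this
  refine tendsto_of_tendsto_of_tendsto_of_le_of_le' tendsto_const_nhds hz (Eventually.of_forall fun _ => zero_le) ?_
  filter_upwards [hG] with N G
  have := (hP N).1
  have hL : 0 ≤ Real.log N := Real.log_natCast_nonneg N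
  have H := G.dy
  have c3 := C3_nonneg
  have hbn : ∀ k, 0 ≤ bk K t θ η N k := fun k => by unfold bk; split_ifs; exacts [(Real.exp_pos _).le, le_rfl]
  have hcp : 0 < (T N).card := by
    have := (Real.exp_pos _).trans_le G.card
    by_contra hc; rw [show (T N).card = 0 by omega] at this; simp at this
  have hub : ∀ v ∈ T N, ∀ j < K, |ub (n N) j v - (t (j+1) - t j) * Real.log N| ≤ 2 * C3 := fun v hv j hj => by
    have a1 := abs_le.1 (G.var v hv j hj.le)
    have a2 := abs_le.1 (G.var v hv (j+1) hj)
    unfold ub; rw [abs_le]; constructor <;> linarith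
  have hd1 : 0 ≤ ∑ k ∈ Finset.range (K+1), bk K t θ η N k * (4^(K+1) * Real.exp (-(2 * t k) * Real.log N)) :=
    Finset.sum_nonneg fun k _ => mul_nonneg (hbn k) (by positivity)
  refine second_moment (T N) _ (fun v hv => Wv_int (hP N) H (G.inb v hv) K θ _ _) (fun v hv v' hv' => (pair_bd (hP N) G hθ h0 hv hv').1) ?_ ?_ hcp
  · intro v hv
    have := first_moment (hP N) H (G.inb v hv) K θ (fun j => θ j * (t (j+1) - t j) * Real.log N) (η * Real.log N) η (2 * C3 * ∑ j ∈ Finset.range K, θ j)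
      (Real.log N + 2 * C3) h0.le (fun j hj => ?_) (fun j hj => ?_)
    · refine le_trans ?_ this
      unfold dl; linarith
    · have e : θ j * ub (n N) j v - θ j * (t (j+1) - t j) * Real.log N = θ j * (ub (n N) j v - (t (j+1) - t j) * Real.log N) := by ring
      rw [e, abs_mul, abs_of_nonneg (hθ j)]
      have s := Finset.single_le_sum (fun i _ => hθ i) (Finset.mem_range.2 hj)
      nlinarith [hub v hv j hj, hθ j]
    · have := (abs_le.1 (hub v hv j hj)).2
      have b : t (j+1) - t j ≤ 1 := by linarith [ht.le1 (j+1), ht.nn j]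
      nlinarith
  · have hr : ∀ v ∈ T N, ∑ v' ∈ T N, ∫ ω, Wv N (n N) K θ (fun j => θ j * (t (j+1) - t j) * Real.log N) (η * Real.log N) v ω * Wv N (n N) K θ (fun j => θ j * (t (j+1) - t j) * Real.log N) (η * Real.log N) v' ω ∂(P N)
        ≤ (T N).card + (∑ k ∈ Finset.range (K+1), bk K t θ η N k * (4^(K+1) * Real.exp (-(2 * t k) * Real.log N))) * (T N).card := by
      intro v hv
      refine (Finset.sum_le_sum fun v' hv' => (pair_bd (hP N) G hθ h0 hv hv').2).trans ?_
      rw [Finset.sum_add_distrib, Finset.sum_const, nsmul_eq_mul, mul_one, Finset.sum_comm, Finset.sum_mul]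
      refine add_le_add le_rfl (Finset.sum_le_sum fun k _ => ?_)
      rw [← Finset.sum_filter, Finset.sum_const, nsmul_eq_mul]
      have c1 := same_count H (T N) v k
      have c2 := c1.trans (G.rat k)
      rw [mul_comm]
      calc _ ≤ bk K t θ η N k * (4^(K+1) * Real.exp (-(2 * t k) * Real.log N) * (T N).card) := mul_le_mul_of_nonneg_left c2 (hbn k)
        _ = _ := by ring
    refine (Finset.sum_le_sum hr).trans ?_
    rw [Finset.sum_const, nsmul_eq_mul]
    have hd : (∑ k ∈ Finset.range (K+1), bk K t θ η N k * (4^(K+1) * Real.exp (-(2 * t k) * Real.log N))) ≤ dl K t θ η N := by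
      unfold dl; have : 0 ≤ (K:ℝ) * (2 * Real.exp (η * (2 * C3 * ∑ j ∈ Finset.range K, θ j) + η^2 * (Real.log N + 2 * C3) / 2 - η * (η * Real.log N))) := by positivity
      linarith
    calc _ = (1 + ∑ k ∈ Finset.range (K+1), bk K t θ η N k * (4^(K+1) * Real.exp (-(2 * t k) * Real.log N))) * ((T N).card:ℝ)^2 := by ring
      _ ≤ _ := by gcongr

lemma Whp_close {P : ℕ → Measure FieldSp} (hP : ∀ N, IsGFF N (P N)) {K : ℕ} {t : ℕ → ℝ} {ρ : ℝ} (τ : ℕ → ℝ) (n : ℕ → ℕ → ℤ) (T : ℕ → Finset Vtx)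
    (hG : ∀ᶠ N in atTop, Geo N K t ρ (n N) (T N)) {η : ℝ} (h0 : 0 < η) :
    Whp P (fun N => {ω | ∀ v ∈ T N, |xi N (ker N τ t K v) ω - xi N (kb (n N) K τ v) ω| < η * Real.log N}) := by
  have key := Whp_small hP (fun N => (T N).filter fun _ => Geo N K t ρ (n N) (T N) ∧ 1 ≤ N) (fun N v z => ker N τ t K v z - kb (n N) K τ v z) 4
    (2^K * (4 * (8 * C2)) * ∑ j ∈ Finset.range K, τ j ^ 2) 2 η h0 (by norm_num) ?_ ?_ ?_
  · refine key.mono ?_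
    filter_upwards [hG, eventually_ge_atTop 1] with N G hN ω hω v hv
    have := hω v (Finset.mem_filter.2 ⟨hv, G, hN⟩)
    rwa [xi_sub] at this
  · filter_upwards [hG, eventually_ge_atTop 1] with N G hN
    refine le_trans ?_ (VN_card N hN)
    exact_mod_cast Finset.card_le_card ((Finset.filter_subset _ _).trans (G.sub.trans (Finset.filter_subset _ _)))
  · refine Eventually.of_forall fun N v hv x hx => ?_
    obtain ⟨hv, G, hN⟩ := Finset.mem_filter.1 hv
    rw [ker_supp (Finset.mem_filter.1 (G.sub hv)).1 x hx, kb_supp G.dy (G.inb v hv) K τ x hx, sub_self]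
  · refine Eventually.of_forall fun N v hv => ?_
    obtain ⟨hv, G, hN⟩ := Finset.mem_filter.1 hv
    have hvV := (Finset.mem_filter.1 (G.sub hv)).1
    have := Cv_diffsum (hP N) (fun k z => gr (Ik N (t k) v) v z - gr (Ib (n N) k v) v z) τ (8 * C2)
      (fun k x hx => by rw [gr_off fun h => hx (Ik_sub hvV h), gr_off fun h => hx (Ib_sub G.dy (G.inb v hv).1 (G.inb v hv).2 _ h), sub_self]) K (fun k hk => G.en v hv k hk)
    convert this using 2 <;>
    · funext z
      simp only [_root_.ker, kb, dk, ← Finset.sum_sub_distrib]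
      refine Finset.sum_congr rfl fun j _ => by ring

lemma lower {P : ℕ → Measure FieldSp} (hP : ∀ N, IsGFF N (P N)) {K : ℕ} {t : ℕ → ℝ} (ht : Grid K t) (hs : ∀ k < K, t k < t (k+1)) (hK : 1 ≤ K) {ρ : ℝ} (hρ : 0 < ρ)
    (τ : ℕ → ℝ) {θ : ℕ → ℝ} (hθ : ∀ j, 0 ≤ θ j) {β : ℝ} (hβ : 0 < β) (hc : ∀ k ≤ K, Bad K θ k → Xk K t θ 0 k < 2 * t k) {ε : ℝ} (hε : 0 < ε) :
    Whp P (fun N => {ω | Real.exp ((2 + ∑ j ∈ Finset.range K, (β * τ j * θ j - θ j ^ 2 / 2) * (t (j+1) - t j) - ε) * Real.log N) ≤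
      ∑ v ∈ AN N ρ, Real.exp (β * xi N (ker N τ t K v) ω)}) := by
  set D := ∑ j ∈ Finset.range K, |β * τ j - θ j| + β with hD
  set A := ∑ j ∈ Finset.range K, (β * τ j * θ j - θ j ^ 2 / 2) * (t (j+1) - t j) with hA
  obtain ⟨η, h0, hη, hηD⟩ : ∃ η : ℝ, 0 < η ∧ (∀ k ≤ K, Bad K θ k → Xk K t θ η k < 2 * t k) ∧ D * η ≤ ε / 2 := by
    have e1 : ∀ᶠ η in nhdsWithin (0:ℝ) (Set.Ioi 0), ∀ k ∈ Finset.range (K+1), Bad K θ k → Xk K t θ η k < 2 * t k := by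
      refine (Finset.eventually_all _).2 fun k hk => ?_
      by_cases hb : Bad K θ k
      · have hcont : Continuous (fun η => Xk K t θ η k) := by
          unfold Xk
          refine continuous_finsetSum _ fun j _ => ?_
          split_ifs <;> fun_prop
        have := (hcont.tendsto 0).eventually_lt_const (hc k (by simpa [Nat.lt_succ_iff] using hk) hb)
        exact (this.filter_mono nhdsWithin_le_nhds).mono fun _ h _ => h
      · exact Eventually.of_forall fun _ h => absurd h hb
    have e2 : ∀ᶠ η in nhdsWithin (0:ℝ) (Set.Ioi 0), D * η < ε / 2 := by
      have hcont : Continuous (fun η : ℝ => D * η) := by fun_prop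
      have := (hcont.tendsto 0).eventually_lt_const (show D * 0 < ε / 2 by linarith)
      exact nhdsWithin_le_nhds this
    obtain ⟨η, h1, h2, h3⟩ := (e1.and (e2.and self_mem_nhdsWithin)).exists
    exact ⟨η, h3, fun k hk => h1 k (Finset.mem_range.2 (Nat.lt_succ_of_le hk)), h2.le⟩
  have hG := geo_ev hP ht hs hK hρ
  set c := C3 * ∑ j ∈ Finset.range K, θ j ^ 2 with hcdef
  refine (lower_W hP ht hθ h0 hη (fun N => nn t N) (fun N => TT (nn t N) K) hG).mono2 (Whp_close hP τ (fun N => nn t N) (fun N => TT (nn t N) K) hG h0) ?_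
  have hL := logN_top.eventually_ge_atTop ((c + Real.log (2 * 4^(K+1))) / (ε / 2))
  filter_upwards [hG, hL] with N G hL ω hω
  obtain ⟨w1, w2⟩ := hω
  set n := nn t N
  set T := TT n K
  have hL0 : 0 ≤ Real.log N := Real.log_natCast_nonneg N
  rw [Set.mem_ofPred_eq] at w1 w2 ⊢
  have hpt : ∀ v ∈ T, Real.exp ((A - D * η) * Real.log N - c) * Wv N n K θ (fun j => θ j * (t (j+1) - t j) * Real.log N) (η * Real.log N) v ω ≤ Real.exp (β * xi N (ker N τ t K v) ω) := by
    intro v hv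
    unfold Wv
    by_cases hg : ω ∈ Gd N n K (fun j => θ j * (t (j+1) - t j) * Real.log N) (η * Real.log N) v
    · rw [Set.indicator_of_mem hg, wt, ← Real.exp_add]
      refine Real.exp_le_exp.2 ?_
      have a1 := (abs_lt.1 (w2 v hv)).1
      have a2 := mul_le_mul_of_nonneg_left a1.le hβ.le
      have key : ∑ j ∈ Finset.range K, ((β * τ j * θ j - θ j ^ 2 / 2) * (t (j+1) - t j) * Real.log N - |β * τ j - θ j| * η * Real.log N - C3 * θ j ^ 2) ≤
          ∑ j ∈ Finset.range K, (β * (τ j * xi N (dk n j v) ω) - θ j * xi N (dk n j v) ω + θ j ^ 2 * ub n j v / 2) := by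
        refine Finset.sum_le_sum fun j hj => ?_
        have hj := Finset.mem_range.1 hj
        have b1 := abs_le.1 (G.var v hv j hj.le)
        have b2 := abs_le.1 (G.var v hv (j+1) hj)
        have b3 : (t (j+1) - t j) * Real.log N - 2 * C3 ≤ ub n j v := by unfold ub; linarith
        have b4 := mul_le_mul_of_nonneg_left b3 (sq_nonneg (θ j))
        have b5 := hg j hj
        have b6 : |(β * τ j - θ j) * (xi N (dk n j v) ω - θ j * (t (j+1) - t j) * Real.log N)| ≤ |β * τ j - θ j| * (η * Real.log N) := by
          rw [abs_mul]; exact mul_le_mul_of_nonneg_left b5 (abs_nonneg _)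
        have b7 := (abs_le.1 b6).1
        nlinarith
      simp only [Finset.sum_sub_distrib, Finset.sum_add_distrib, ← Finset.sum_mul, ← Finset.mul_sum, ← Finset.sum_div] at key
      rw [kb_xi] at a2 ⊢
      rw [← hA, ← hcdef] at key
      have : D * η * Real.log N = (∑ j ∈ Finset.range K, |β * τ j - θ j|) * η * Real.log N + β * (η * Real.log N) := by rw [hD]; ring
      linarith
    · rw [Set.indicator_of_notMem hg, mul_zero]; positivity
  have s1 : ∑ v ∈ T, Real.exp (β * xi N (ker N τ t K v) ω) ≤ ∑ v ∈ AN N ρ, Real.exp (β * xi N (ker N τ t K v) ω) :=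
    Finset.sum_le_sum_of_subset_of_nonneg G.sub fun _ _ _ => (Real.exp_pos _).le
  have s2 := Finset.sum_le_sum hpt
  rw [← Finset.mul_sum] at s2
  have s3 := mul_le_mul_of_nonneg_left w1.le (Real.exp_pos ((A - D * η) * Real.log N - c)).le
  have s4 := G.card
  refine le_trans ?_ (s3.trans (s2.trans s1))
  have q : (0:ℝ) < 2 * 4^(K+1) := by positivity
  have s5 : Real.exp (2 * Real.log N - Real.log (2 * 4^(K+1))) ≤ (T.card:ℝ) / 2 := by
    rw [Real.exp_sub, Real.exp_log q, div_le_iff₀ q]; linarith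
  calc _ ≤ Real.exp ((A - D * η) * Real.log N - c) * Real.exp (2 * Real.log N - Real.log (2 * 4^(K+1))) := by
        rw [← Real.exp_add]; refine Real.exp_le_exp.2 ?_
        rw [div_le_iff₀ (by linarith)] at hL
        nlinarith
    _ ≤ _ := by gcongr

lemma pw_int (x c : ℕ → ℝ) (f : ℝ → ℝ) (n : ℕ) (hx : ∀ i < n, x i ≤ x (i+1)) (hf : ∀ i < n, ∀ s, x i < s → s ≤ x (i+1) → f s = c i) :
    IntervalIntegrable f volume (x 0) (x n) ∧ ∫ s in (x 0)..(x n), f s = ∑ i ∈ Finset.range n, c i * (x (i+1) - x i) := by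
  induction n with
  | zero => simp
  | succ n ih =>
    obtain ⟨i1, i2⟩ := ih (fun i hi => hx i (by omega)) (fun i hi => hf i (by omega))
    have hn := hx n (by omega)
    have he : Set.EqOn (fun _ => c n) f (Set.uIoc (x n) (x (n+1))) := fun s hs => by
      rw [Set.uIoc_of_le hn] at hs; exact (hf n (by omega) s hs.1 hs.2).symm
    have j1 : IntervalIntegrable f volume (x n) (x (n+1)) := (intervalIntegrable_const (c := c n)).congr he
    refine ⟨i1.trans j1, ?_⟩
    rw [← intervalIntegral.integral_add_adjacent_intervals i1 j1, i2, Finset.sum_range_succ]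
    congr 1
    rw [intervalIntegral.integral_of_le hn, ← setIntegral_congr_fun measurableSet_Ioc (fun s hs => he (by rw [Set.uIoc_of_le hn]; exact hs))]
    simp [hn]; ring

lemma refine_sum {K : ℕ} {t : ℕ → ℝ} (ht : Grid K t) (hs : ∀ k < K, t k < t (k+1)) (x c : ℕ → ℝ) (f Φ : ℝ → ℝ) (n : ℕ) (hx0 : x 0 = 0)
    (hx : ∀ i < n, x i < x (i+1)) (hxt : ∀ i ≤ n, ∃ k ≤ K, t k = x i) (hf : ∀ i < n, ∀ s, x i < s → s ≤ x (i+1) → f s = c i) :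
    ∀ k ≤ K, t k = x n → ∑ j ∈ Finset.range k, f (t (j+1)) * (Φ (t (j+1)) - Φ (t j)) = ∑ i ∈ Finset.range n, c i * (Φ (x (i+1)) - Φ (x i)) := by
  induction n with
  | zero =>
    intro k hk e
    rcases Nat.eq_zero_or_pos k with rfl | h
    · simp
    · exfalso
      have := hs 0 (by omega); have := ht.mono (show 1 ≤ k from h); rw [ht.zero] at *; simp at *; linarith
  | succ n ih =>
    intro k hk e
    obtain ⟨k', hk', e'⟩ := hxt n (by omega)
    have ih := ih (fun i hi => hx i (by omega)) (fun i hi => hxt i (by omega)) (fun i hi => hf i (by omega)) k' hk' e'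
    have hn := hx n (by omega)
    have hkk : k' ≤ k := by
      by_contra h
      have := ht.mono (show k ≤ k' by omega); linarith
    rw [← Finset.sum_range_add_sum_Ico _ hkk, ih, Finset.sum_range_succ]
    congr 1
    rw [Finset.sum_congr rfl (g := fun j => c n * (Φ (t (j+1)) - Φ (t j))), ← Finset.mul_sum, Finset.sum_Ico_eq_sub _ hkk, Finset.sum_range_sub (fun j => Φ (t j)),
      Finset.sum_range_sub (fun j => Φ (t j)), e, e']
    · ring
    · intro j hj
      rw [Finset.mem_Ico] at hj
      rw [hf n (by omega) (t (j+1)) ?_ ?_]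
      · rw [← e']; exact (ht.mono hj.1).trans_lt (hs j (by omega))
      · rw [← e]; exact ht.mono hj.2

lemma grid_ex (S : Finset ℝ) (h0 : 0 ∈ S) (h1 : 1 ∈ S) (hS : ∀ s ∈ S, 0 ≤ s ∧ s ≤ 1) :
    ∃ K t, 1 ≤ K ∧ Grid K t ∧ (∀ k < K, t k < t (k+1)) ∧ (∀ s ∈ S, ∃ k ≤ K, t k = s) := by
  set n := S.card with hn
  have hc : 2 ≤ n := by
    have : ({0, 1} : Finset ℝ) ⊆ S := by intro x hx; simp at hx; rcases hx with rfl | rfl <;> assumption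
    have := Finset.card_le_card this
    rw [Finset.card_pair (by norm_num)] at this; exact this
  set e := S.orderEmbOfFin hn.symm
  set t : ℕ → ℝ := fun k => if h : k < n then e ⟨k, h⟩ else 1 with ht
  have tm : ∀ k, t k ∈ S := fun k => by
    simp only [ht]; split_ifs with h
    · exact Finset.orderEmbOfFin_mem S hn.symm _
    · exact h1
  have surj : ∀ s ∈ S, ∃ k ≤ n - 1, t k = s := fun s hs => by
    have : s ∈ Set.range e := by rw [Finset.range_orderEmbOfFin]; exact hs
    obtain ⟨⟨k, hk⟩, rfl⟩ := this
    exact ⟨k, by omega, by simp only [ht, dif_pos hk]⟩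
  have st : ∀ i j, i < j → j < n → t i < t j := fun i j hij hj => by
    simp only [ht, dif_pos hj, dif_pos (hij.trans hj)]
    exact e.strictMono (by simpa using hij)
  have hmono : Monotone t := fun i j hij => by
    rcases eq_or_lt_of_le hij with rfl | hij
    · exact le_rfl
    · by_cases hj : j < n
      · exact (st i j hij hj).le
      · have : t j = 1 := by simp only [ht, dif_neg hj]
        rw [this]; exact (hS _ (tm i)).2
  refine ⟨n - 1, t, by omega, ⟨hmono, ?_, ?_⟩, fun k hk => st k (k+1) (by omega) (by omega), surj⟩
  · obtain ⟨k, hk, e0⟩ := surj 0 h0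
    exact le_antisymm (e0 ▸ hmono (Nat.zero_le k)) (hS _ (tm 0)).1
  · intro k hk
    obtain ⟨k', hk', e1⟩ := surj 1 h1
    exact le_antisymm (hS _ (tm k)).2 (e1 ▸ hmono (by omega))

lemma abel0 (w D : ℕ → ℝ) (K : ℕ) (hD : D 0 = 0) (h : ∀ j < K, w j * D (j+1) = w (j+1) * D (j+1)) :
    ∀ k ≤ K, ∑ j ∈ Finset.range k, w j * (D (j+1) - D j) = w k * D k := by
  intro k
  induction k with
  | zero => simp [hD]
  | succ k ih => intro hk; rw [Finset.sum_range_succ, ih (by omega), ← h k (by omega)]; ring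

/-- abstract certificate -/
lemma cert_of {K : ℕ} {t τ sb : ℕ → ℝ} {β : ℝ} (hβ : 0 < β) (ht : Grid K t) (hs : ∀ k < K, t k < t (k+1)) (hK : 1 ≤ K)
    (hsb : ∀ k < K, 0 < sb k) (hanti : ∀ k, k + 1 < K → sb (k+1) ≤ sb k)
    (hle : ∀ k ≤ K, ∑ j ∈ Finset.range k, τ j ^ 2 * (t (j+1) - t j) ≤ ∑ j ∈ Finset.range k, sb j ^ 2 * (t (j+1) - t j))
    (hend : ∑ j ∈ Finset.range K, τ j ^ 2 * (t (j+1) - t j) = ∑ j ∈ Finset.range K, sb j ^ 2 * (t (j+1) - t j))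
    (hcon : ∀ k, k + 1 < K → sb (k+1) ≠ sb k → ∑ j ∈ Finset.range (k+1), τ j ^ 2 * (t (j+1) - t j) = ∑ j ∈ Finset.range (k+1), sb j ^ 2 * (t (j+1) - t j))
    (y : ℕ → ℝ) (hy : y = fun k => if k < K then min β (2 / sb k) else β) :
    Cert K t τ y β ∧ 2 + (β * ∑ j ∈ Finset.range K, bb t τ y j - (∑ j ∈ Finset.range K, y j * bb t τ y j) / 2) =
      2 * ∑ j ∈ Finset.range K, (if β ≤ 2 / sb j then 1 + β^2 / (2 / sb j)^2 else 2 * β / (2 / sb j)) * (t (j+1) - t j) := by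
  set D : ℕ → ℝ := fun k => ∑ j ∈ Finset.range k, τ j ^ 2 * (t (j+1) - t j) - ∑ j ∈ Finset.range k, sb j ^ 2 * (t (j+1) - t j) with hD
  have yl : ∀ k < K, y k = min β (2 / sb k) := fun k hk => by rw [hy]; exact if_pos hk
  have yK : y K = β := by rw [hy]; exact if_neg (lt_irrefl K)
  have ypos : ∀ k < K, 0 < y k := fun k hk => by rw [yl k hk]; have := hsb k hk; positivity
  have hD0 : D 0 = 0 := by simp [hD]
  have hDK : D K = 0 := by simp only [hD]; linarith
  have hDle : ∀ k ≤ K, D k ≤ 0 := fun k hk => by have := hle k hk; simp only [hD]; linarith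
  have hDy : ∀ j < K, y j ≠ y (j+1) → D (j+1) = 0 := fun j hj hne => by
    rcases eq_or_lt_of_le (show j + 1 ≤ K from hj) with e | hlt
    · rw [e, hDK]
    · have : sb (j+1) ≠ sb j := fun e => hne (by rw [yl j hj, yl _ hlt, e])
      have := hcon j hlt this; simp only [hD]; linarith
  have dD : ∀ j, D (j+1) - D j = τ j ^ 2 * (t (j+1) - t j) - sb j ^ 2 * (t (j+1) - t j) := fun j => by
    simp only [hD, Finset.sum_range_succ]; ring
  have ab : ∀ g : ℝ → ℝ, ∀ k ≤ K, ∑ j ∈ Finset.range k, g (y j) * (τ j ^ 2 * (t (j+1) - t j)) =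
      ∑ j ∈ Finset.range k, g (y j) * (sb j ^ 2 * (t (j+1) - t j)) + g (y k) * D k := fun g k hk => by
    have := abel0 (fun j => g (y j)) D K hD0 (fun j hj => by
      by_cases h : y j = y (j+1)
      · simp only [h]
      · rw [hDy j hj h]; simp) k hk
    rw [← this, ← Finset.sum_add_distrib]
    refine Finset.sum_congr rfl fun j _ => ?_
    rw [dD]; ring
  have e2 : ∀ k, ∑ j ∈ Finset.range k, y j * bb t τ y j = ∑ j ∈ Finset.range k, (y j)^2 * (τ j ^ 2 * (t (j+1) - t j)) := fun k =>
    Finset.sum_congr rfl fun j _ => by rw [bb]; ring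
  have hys : ∀ k < K, y k * sb k ≤ 2 := fun k hk => by
    have := hsb k hk
    rw [yl k hk, ← le_div_iff₀ this]; exact min_le_right _ _
  have sbm : ∀ k < K, ∀ j ≤ k, sb k ≤ sb j := fun k hk j hj => by
    induction k, hj using Nat.le_induction with
    | base => exact le_rfl
    | succ k _ ih => exact (hanti k hk).trans (ih (by omega))
  have tsum : ∀ k, ∑ j ∈ Finset.range k, 4 * (t (j+1) - t j) = 4 * t k := fun k => by
    rw [← Finset.mul_sum, Finset.sum_range_sub, ht.zero, sub_zero]
  have ymono : ∀ k < K, y k ≤ y (k+1) := fun k hk => by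
    rw [yl k hk]
    rcases eq_or_lt_of_le (show k + 1 ≤ K from hk) with e | hlt
    · rw [e, yK]; exact min_le_left _ _
    · rw [yl _ hlt]
      have := hanti k hlt; have := hsb _ hlt
      exact min_le_min le_rfl (by gcongr)
  refine ⟨⟨ht, ?_, ypos 0 (by omega), ymono, yK, ?_, ?_⟩, ?_⟩
  · have := hs 0 (by omega); rwa [ht.zero] at this
  · intro k hk hlt
    rw [e2, ab (fun x => x^2) (k+1) hk, hDy k hk hlt.ne, mul_zero, add_zero, ← tsum]
    refine Finset.sum_congr rfl fun j hj => ?_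
    have hj := Finset.mem_range.1 hj
    have hyb : y (k+1) ≤ β := by
      rw [hy]; simp only; split_ifs; exacts [min_le_left _ _, le_rfl]
    have h1 : 2 / sb k < β := by
      by_contra hc
      rw [yl k hk, min_eq_left (not_lt.1 hc)] at hlt; linarith
    have pj := hsb j (by omega)
    have pk := hsb k hk
    have h2 : 2 / sb j ≤ 2 / sb k := by have := sbm k hk j (by omega); gcongr
    rw [yl j (by omega), min_eq_right (by linarith)]
    field_simp; ring
  · intro k hk
    rw [e2, ab (fun x => x^2) k hk, ← tsum]
    have : (y k)^2 * D k ≤ 0 := mul_nonpos_of_nonneg_of_nonpos (sq_nonneg _) (hDle k hk)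
    have h2 : ∑ j ∈ Finset.range k, (y j)^2 * (sb j ^ 2 * (t (j+1) - t j)) ≤ ∑ j ∈ Finset.range k, 4 * (t (j+1) - t j) := by
      refine Finset.sum_le_sum fun j hj => ?_
      have hj : j < K := (Finset.mem_range.1 hj).trans_le hk
      have a1 := hys j hj
      have a2 := mul_pos (ypos j hj) (hsb j hj)
      have a3 := (hs j hj).le
      rw [← mul_assoc, ← mul_pow]
      exact mul_le_mul_of_nonneg_right (by nlinarith) (by linarith)
    linarith
  · have e3 : ∑ j ∈ Finset.range K, bb t τ y j = ∑ j ∈ Finset.range K, y j * (τ j ^ 2 * (t (j+1) - t j)) := rfl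
    have o : (2:ℝ) = ∑ j ∈ Finset.range K, 2 * (t (j+1) - t j) := by
      rw [← Finset.mul_sum, Finset.sum_range_sub, ht.zero, ht.one K le_rfl]; ring
    rw [e2, e3, ab (fun x => x^2) K le_rfl, ab (fun x => x) K le_rfl, hDK, mul_zero, mul_zero, add_zero, add_zero]
    nth_rewrite 1 [o]
    rw [Finset.mul_sum, Finset.sum_div, ← Finset.sum_sub_distrib, ← Finset.sum_add_distrib, Finset.mul_sum]
    refine Finset.sum_congr rfl fun j hj => ?_
    have hj := Finset.mem_range.1 hj
    have pj := hsb j hj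
    rw [yl j hj]
    split_ifs with h
    · rw [min_eq_left h]; field_simp; ring
    · rw [min_eq_right (not_le.1 h).le]; field_simp; ring

lemma J_bd {f : ℝ → ℝ} (hf : IntervalIntegrable f volume 0 1) {s t c : ℝ} (h0 : 0 ≤ s) (hst : s ≤ t) (h1 : t ≤ 1) :
    ((∀ r, s < r → r < t → f r ≤ c) → Jint f t - Jint f s ≤ c * (t - s)) ∧
    ((∀ r, s < r → r < t → c ≤ f r) → c * (t - s) ≤ Jint f t - Jint f s) := by
  have sub : ∀ u v, 0 ≤ u → u ≤ v → v ≤ 1 → IntervalIntegrable f volume u v := fun u v hu huv hv =>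
    hf.mono_set (by rw [Set.uIcc_of_le huv, Set.uIcc_of_le zero_le_one]; exact Set.Icc_subset_Icc hu hv)
  have i1 := sub s t h0 hst h1
  have e : Jint f t - Jint f s = ∫ r in s..t, f r :=
    intervalIntegral.integral_interval_sub_left (sub 0 t le_rfl (h0.trans hst) h1) (sub 0 s le_rfl h0 (hst.trans h1))
  have e2 : c * (t - s) = ∫ r in s..t, c := by simp; ring
  rw [e, e2]
  exact ⟨fun h => intervalIntegral.integral_mono_on_of_le_Ioo hst i1 intervalIntegrable_const fun r hr => h r hr.1 hr.2,
    fun h => intervalIntegral.integral_mono_on_of_le_Ioo hst intervalIntegrable_const i1 fun r hr => h r hr.1 hr.2⟩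

lemma hull_facts {f g : ℝ → ℝ} {C : ℝ} (hfi : IntervalIntegrable f volume 0 1) (hgi : IntervalIntegrable g volume 0 1)
    (hf : ∀ s, 0 < s → s ≤ 1 → 0 ≤ f s ∧ f s ≤ C)
    (hh : ∀ s, 0 < s → s ≤ 1 → concaveHull (Jint f) s = Jint g s) :
    (∀ s, 0 ≤ s → s ≤ 1 → Jint f s ≤ Jint g s) ∧ Jint f 1 = Jint g 1 ∧
    ∀ l a b, 0 < l → l < 1 → 0 ≤ b → b < a → (∀ r, 0 < r → r ≤ l → a ≤ g r) → (∀ r, l < r → r ≤ 1 → g r ≤ b) → Jint f l = Jint g l := by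
  have J0 : ∀ f : ℝ → ℝ, Jint f 0 = 0 := fun f => by simp [Jint]
  have Jm : ∀ s t, 0 ≤ s → s ≤ t → t ≤ 1 → Jint f s ≤ Jint f t ∧ Jint f t - Jint f s ≤ C * (t - s) := fun s t h0 hst h1 => by
    refine ⟨?_, (J_bd hfi h0 hst h1).1 fun r hr hr' => (hf r (by linarith) (by linarith)).2⟩
    have := (J_bd (c := 0) hfi h0 hst h1).2 fun r hr hr' => (hf r (by linarith) (by linarith)).1
    linarith
  have p1 : ∀ s, 0 ≤ s → s ≤ 1 → Jint f s ≤ Jint g s := fun s h0 h1 => by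
    rcases h0.eq_or_lt with rfl | h0
    · rw [J0, J0]
    · rw [← hh s h0 h1]
      refine le_csInf ⟨_, fun _ => Jint f 1, concaveOn_const _ (convex_Icc _ _), fun t ht => (Jm t 1 ht.1 ht.2 le_rfl).1, rfl⟩ ?_
      rintro y ⟨u, -, hu, rfl⟩
      exact hu s ⟨h0.le, h1⟩
  have inf_le : ∀ s, 0 < s → s ≤ 1 → ∀ p q, (∀ t, 0 ≤ t → t ≤ 1 → Jint f t ≤ p * t + q) → Jint g s ≤ p * s + q := fun s h0 h1 p q hu => by
    rw [← hh s h0 h1]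
    refine csInf_le ⟨Jint f s, ?_⟩ ⟨fun t => p * t + q, ⟨convex_Icc _ _, fun x _ y _ a b _ _ hab => ?_⟩, fun t ht => hu t ht.1 ht.2, rfl⟩
    · rintro y ⟨u, -, hu, rfl⟩
      exact hu s ⟨h0.le, h1⟩
    · simp only [smul_eq_mul]
      have : q = (a + b) * q := by rw [hab, one_mul]
      nlinarith
  refine ⟨p1, le_antisymm (p1 1 zero_le_one le_rfl) ?_, fun l a b l0 l1 hb hab ha hb' => ?_⟩
  · have := inf_le 1 one_pos le_rfl 0 (Jint f 1) (fun t h0 h1 => by have := (Jm t 1 h0 h1 le_rfl).1; linarith)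
    linarith
  · by_contra hne
    have hlt : Jint f l < Jint g l := lt_of_le_of_ne (p1 l l0.le l1.le) hne
    have hC : 0 ≤ C := (hf 1 one_pos le_rfl).1.trans (hf 1 one_pos le_rfl).2
    set q := ((a - b) / 2) / (C + a)
    have ha0 : 0 < C + a := by linarith
    have hq : 0 < q := div_pos (by linarith) ha0
    have hq2 : q * (C + a) = (a - b) / 2 := div_mul_cancel₀ _ ha0.ne'
    have fin : ∀ x, 0 ≤ x → (a - b) / 2 * x < q * (Jint g l - Jint f l) → (1 - q) * (Jint g l - Jint f l) < (C + (a + b) / 2) * x → False := by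
      intro x hx c1 c2
      rw [← hq2, mul_assoc] at c1
      have c1 := lt_of_mul_lt_mul_left c1 hq.le
      have c2 := mul_lt_mul_of_pos_left c2 ha0
      have e : (C + a) * ((1 - q) * (Jint g l - Jint f l)) = (C + (a + b) / 2) * (Jint g l - Jint f l) := by linear_combination (-(Jint g l - Jint f l)) * hq2
      rw [e, mul_left_comm] at c2
      have := lt_of_mul_lt_mul_left c2 (by linarith)
      linarith
    have key := inf_le l l0 l1.le ((a + b) / 2) (Jint g l - (a + b) / 2 * l - q * (Jint g l - Jint f l)) (fun t h0 h1 => by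
      have ht := p1 t h0 h1
      by_contra hc
      rcases le_total l t with h | h
      · have b1 := (J_bd (c := b) hgi l0.le h h1).1 fun r hr hr' => hb' r hr (by linarith)
        have b2 := (Jm l t l0.le h h1).2
        have c1 : (a - b) / 2 * (t - l) < q * (Jint g l - Jint f l) := by nlinarith
        have c2 : (1 - q) * (Jint g l - Jint f l) < (C - (a + b) / 2) * (t - l) := by nlinarith
        exact fin (t - l) (by linarith) c1 (by nlinarith)
      · have b1 := (J_bd (c := a) hgi h0 h l1.le).2 fun r hr hr' => ha r (by linarith) hr'.le
        have b2 := (Jm t l h0 h l1.le).1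
        have c1 : (a - b) / 2 * (l - t) < q * (Jint g l - Jint f l) := by nlinarith
        have c2 : (1 - q) * (Jint g l - Jint f l) < ((a + b) / 2) * (l - t) := by nlinarith
        exact fin (l - t) (by linarith) c1 (by nlinarith))
    nlinarith [mul_pos hq (sub_pos.2 hlt)]

lemma find_iv (x : ℕ → ℝ) (n : ℕ) (s : ℝ) (h0 : x 0 < s) (h : s ≤ x n) : ∃ i < n, x i < s ∧ s ≤ x (i+1) := by
  induction n with
  | zero => linarith
  | succ n ih =>
    by_cases h' : s ≤ x n
    · obtain ⟨i, hi, r⟩ := ih h'; exact ⟨i, by omega, r⟩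
    · exact ⟨n, by omega, not_le.1 h', h⟩

lemma inc_mono {x : ℕ → ℝ} {n : ℕ} (h : ∀ i < n, x i < x (i+1)) (i j : ℕ) (hij : i ≤ j) (hj : j ≤ n) : x i ≤ x j := by
  induction j, hij using Nat.le_induction with
  | base => exact le_rfl
  | succ j _ ih => exact (ih (by omega)).trans (h j (by omega)).le

lemma Icc_sum (F : ℕ → ℝ) (n : ℕ) : ∑ i ∈ Finset.Icc 1 n, F i = ∑ i ∈ Finset.range n, F (i+1) := by
  have : Finset.Icc 1 n = Finset.Ico 1 (n+1) := by ext; simp only [Finset.mem_Icc, Finset.mem_Ico]; omega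
  rw [this, Finset.sum_Ico_eq_sum_range]
  simp [add_comm]

lemma step_val {M : ℕ} {sigv lamv : ℕ → ℝ} (hp : ScaleParams M sigv lamv) (i : ℕ) (hi : i < M) (s : ℝ) (h1 : lamv i < s) (h2 : s ≤ lamv (i+1)) :
    stepFn M sigv lamv s = sigv (i+1) := by
  obtain ⟨_, _, l0, _, li⟩ := hp
  have hm := inc_mono li
  have := hm 0 i (by omega) hi.le
  rw [stepFn, if_neg (by linarith), zero_add, Finset.sum_eq_single (i+1), if_pos ⟨h1, h2⟩]
  · intro j hj hne
    rw [Finset.mem_Icc] at hj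
    rw [if_neg]
    rintro ⟨a, b⟩
    rcases Nat.lt_or_gt_of_ne hne with h | h
    · have := hm j i (by omega) hi.le; linarith
    · have := hm (i+1) (j-1) (by omega) (by omega); linarith
  · intro h; exact absurd (Finset.mem_Icc.2 ⟨by omega, hi⟩) h

lemma sigb_anti {m : ℕ} {sigb : ℕ → ℝ} (h : ∀ l, 1 ≤ l → l < m → sigb (l+1) < sigb l) (i j : ℕ) (h1 : 1 ≤ i) (hij : i ≤ j) (hj : j ≤ m) : sigb j ≤ sigb i := by
  induction j, hij using Nat.le_induction with
  | base => exact le_rfl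
  | succ j hj' ih => exact (h j (by omega) (by omega)).le.trans (ih (by omega))

lemma fpsi_eq {m : ℕ} {sigb lamb : ℕ → ℝ} {β : ℝ} (hm : 1 ≤ m) (h : ∀ l, 1 ≤ l → l < m → sigb (l+1) < sigb l) (hpos : ∀ l ∈ Finset.Icc 1 m, 0 < sigb l) :
    fpsiLim m sigb lamb β = ∑ i ∈ Finset.range m, (if β ≤ 2 / sigb (i+1) then 1 + β^2 / (2 / sigb (i+1))^2 else 2 * β / (2 / sigb (i+1))) * (lamb (i+1) - lamb i) := by
  have anti := sigb_anti h
  have anti2 : ∀ i j, 1 ≤ i → i ≤ j → j ≤ m → 2 / sigb i ≤ 2 / sigb j := fun i j h1 h2 h3 => by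
    have := anti i j h1 h2 h3
    have := hpos j (Finset.mem_Icc.2 ⟨by omega, h3⟩)
    gcongr
  obtain ⟨L1, L2, L3, L4⟩ : 1 ≤ lbeta m sigb β ∧ lbeta m sigb β ≤ m + 1 ∧ (∀ j, 1 ≤ j → j < lbeta m sigb β → ¬ β ≤ 2 / sigb j) ∧
      (∀ j, lbeta m sigb β ≤ j → j ≤ m → β ≤ 2 / sigb j) := by
    rw [lbeta]
    split_ifs with hb
    · have hmem : m ∈ {l : ℕ | 1 ≤ l ∧ β ≤ 2 / sigb l} := ⟨hm, hb⟩
      have hI := Nat.sInf_mem ⟨m, hmem⟩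
      have hle := Nat.sInf_le hmem
      refine ⟨hI.1, by omega, fun j hj hj' hc => ?_, fun j hj hj' => hI.2.trans (anti2 _ _ hI.1 hj hj')⟩
      exact Nat.notMem_of_lt_sInf hj' ⟨hj, hc⟩
    · refine ⟨by omega, le_rfl, fun j hj hj' hc => hb (hc.trans (anti2 j m hj (by omega) le_rfl)), fun j hj hj' => by omega⟩
  set L := lbeta m sigb β with hL
  have e := Icc_sum (fun j => (if β ≤ 2 / sigb j then 1 + β^2 / (2 / sigb j)^2 else 2 * β / (2 / sigb j)) * (lamb j - lamb (j-1))) m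
  simp only [Nat.add_sub_cancel] at e
  rw [← e]
  have : ∀ a b, Finset.Icc a b = Finset.Ico a (b+1) := fun a b => by ext; simp only [Finset.mem_Icc, Finset.mem_Ico]; omega
  rw [fpsiLim, ← hL, this, this, this, ← Finset.sum_Ico_consecutive _ L1 L2, Nat.sub_add_cancel L1]
  congr 1
  · refine Finset.sum_congr rfl fun j hj => ?_
    rw [Finset.mem_Ico] at hj
    rw [if_neg (L3 j hj.1 hj.2)]
  · refine Finset.sum_congr rfl fun j hj => ?_
    rw [Finset.mem_Ico] at hj
    rw [if_pos (L4 j hj.1 (by omega))]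

lemma const_on {K n : ℕ} {t x : ℕ → ℝ} (ht : Grid K t) (hx0 : x 0 = 0) (hx1 : x n = 1) (hxt : ∀ i ≤ n, ∃ k ≤ K, t k = x i) (j : ℕ) (s : ℝ) (h1 : t j < s) (h2 : s ≤ t (j+1)) :
    ∃ i < n, x i < s ∧ s ≤ x (i+1) ∧ x i < t (j+1) ∧ t (j+1) ≤ x (i+1) := by
  obtain ⟨i, hi, a, b⟩ := find_iv x n s (by rw [hx0]; exact (ht.nn j).trans_lt h1) (by rw [hx1]; exact h2.trans (ht.le1 _))
  obtain ⟨k, hk, e⟩ := hxt (i+1) hi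
  have : j + 1 ≤ k := by
    by_contra hc
    have := ht.mono (show k ≤ j by omega); linarith
  exact ⟨i, hi, a, b, by linarith, e ▸ ht.mono this⟩

lemma cert_exists {M : ℕ} {sigv lamv : ℕ → ℝ} (hp : ScaleParams M sigv lamv) {m : ℕ} {sigb lamb : ℕ → ℝ} {sigbar : ℝ → ℝ}
    (he : EffParams M sigv lamv m sigb lamb sigbar) {β : ℝ} (hβ : 0 < β) {a : ℝ} (ha : 0 < a) (ha1 : a < 1) {n : ℕ} (hn : 1 ≤ n) :
    ∃ (K : ℕ) (t τ y : ℕ → ℝ), Cert K t τ y β ∧ (∀ k < K, t k < t (k+1)) ∧ 1 ≤ K ∧ (∀ k < K, t (k+1) ≤ t k + 1 / n) ∧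
      (∃ κ < K, t κ = a) ∧ (∀ k < K, ∃ i ∈ Finset.Icc 1 M, τ k = sigv i) ∧ (∀ k < K, min β (2 / sigb 1) ≤ y k ∧ y k ≤ β) ∧
      2 + (β * ∑ j ∈ Finset.range K, bb t τ y j - (∑ j ∈ Finset.range K, y j * bb t τ y j) / 2) = 2 * fpsiLim m sigb lamb β ∧
      ∀ Φ : ℝ → ℝ, ∑ i ∈ Finset.Icc 1 M, sigv i * (Φ (lamv i) - Φ (lamv (i-1))) = ∑ k ∈ Finset.range K, τ k * (Φ (t (k+1)) - Φ (t k)) := by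
  have sv := step_val hp
  obtain ⟨hM, spos, l0, l1, li⟩ := hp
  obtain ⟨hm, -, b0, b1, bi, santi, sbpos, -, sbv, hull⟩ := he
  have lm := inc_mono li
  have bm := inc_mono bi
  have nR : (0:ℝ) < n := by exact_mod_cast hn
  obtain ⟨K, t, hK, ht, hs, hS⟩ := grid_ex (Finset.image lamv (Finset.range (M+1)) ∪ Finset.image lamb (Finset.range (m+1)) ∪
      Finset.image (fun i : ℕ => (i:ℝ) / n) (Finset.range (n+1)) ∪ {a})
    (by simp only [Finset.mem_union, Finset.mem_image, Finset.mem_range]; exact Or.inl (Or.inl (Or.inl ⟨0, by omega, l0⟩)))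
    (by simp only [Finset.mem_union, Finset.mem_image, Finset.mem_range]; exact Or.inl (Or.inl (Or.inl ⟨M, by omega, l1⟩)))
    (by
      intro s hs
      simp only [Finset.mem_union, Finset.mem_image, Finset.mem_range, Finset.mem_singleton] at hs
      rcases hs with ((⟨i, hi, rfl⟩ | ⟨i, hi, rfl⟩) | ⟨i, hi, rfl⟩) | rfl
      · exact ⟨l0 ▸ lm 0 i (by omega) (by omega), l1 ▸ lm i M (by omega) le_rfl⟩
      · exact ⟨b0 ▸ bm 0 i (by omega) (by omega), b1 ▸ bm i m (by omega) le_rfl⟩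
      · refine ⟨by positivity, ?_⟩
        rw [div_le_one nR]; exact_mod_cast (by omega : i ≤ n)
      · exact ⟨ha.le, ha1.le⟩)
  simp only [Finset.mem_union, Finset.mem_image, Finset.mem_range, Finset.mem_singleton] at hS
  have hl : ∀ i ≤ M, ∃ k ≤ K, t k = lamv i := fun i hi => hS _ (Or.inl (Or.inl (Or.inl ⟨i, by omega, rfl⟩)))
  have hb : ∀ i ≤ m, ∃ k ≤ K, t k = lamb i := fun i hi => hS _ (Or.inl (Or.inl (Or.inr ⟨i, by omega, rfl⟩)))
  have hg : ∀ i ≤ n, ∃ k ≤ K, t k = (i:ℝ) / n := fun i hi => hS _ (Or.inl (Or.inr ⟨i, by omega, rfl⟩))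
  have bv : ∀ i < m, ∀ s, lamb i < s → s ≤ lamb (i+1) → sigbar s = sigb (i+1) := fun i hi s h1 h2 =>
    sbv (i+1) (Finset.mem_Icc.2 ⟨by omega, hi⟩) s h1 h2
  set τ : ℕ → ℝ := fun k => stepFn M sigv lamv (t (k+1)) with hτ
  set sb : ℕ → ℝ := fun k => sigbar (t (k+1)) with hsb
  -- local constancy
  have cτ : ∀ j < K, ∀ s, t j < s → s ≤ t (j+1) → stepFn M sigv lamv s = τ j := fun j hj s h1 h2 => by
    obtain ⟨i, hi, u1, u2, u3, u4⟩ := const_on ht l0 l1 hl j s h1 h2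
    rw [sv i hi s u1 u2, hτ]; simp only; rw [sv i hi _ u3 u4]
  have cb : ∀ j < K, ∀ s, t j < s → s ≤ t (j+1) → sigbar s = sb j := fun j hj s h1 h2 => by
    obtain ⟨i, hi, u1, u2, u3, u4⟩ := const_on ht b0 b1 hb j s h1 h2
    rw [bv i hi s u1 u2, hsb]; simp only; rw [bv i hi _ u3 u4]
  have pτ : ∀ k ≤ K, _ := fun k hk => pw_int t (fun j => τ j ^ 2) (fun s => stepFn M sigv lamv s ^ 2) k (fun i hi => (hs i (by omega)).le)
    (fun i hi s h1 h2 => by simp only [cτ i (by omega) s h1 h2])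
  have pb : ∀ k ≤ K, _ := fun k hk => pw_int t (fun j => sb j ^ 2) (fun s => sigbar s ^ 2) k (fun i hi => (hs i (by omega)).le)
    (fun i hi s h1 h2 => by simp only [cb i (by omega) s h1 h2])
  have sbi : ∀ k < K, ∃ i < m, lamb i < t (k+1) ∧ t (k+1) ≤ lamb (i+1) ∧ sb k = sigb (i+1) := fun k hk => by
    obtain ⟨i, hi, u1, u2, -⟩ := const_on ht b0 b1 hb k _ (hs k hk) le_rfl
    exact ⟨i, hi, u1, u2, bv i hi _ u1 u2⟩
  have τi : ∀ k < K, ∃ i ∈ Finset.Icc 1 M, τ k = sigv i := fun k hk => by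
    obtain ⟨i, hi, u1, u2, -⟩ := const_on ht l0 l1 hl k _ (hs k hk) le_rfl
    exact ⟨i+1, Finset.mem_Icc.2 ⟨by omega, hi⟩, sv i hi _ u1 u2⟩
  have san := sigb_anti santi
  have sban : ∀ r r', 0 < r → r ≤ r' → r' ≤ 1 → sigbar r' ≤ sigbar r := fun r r' h0 h h1 => by
    obtain ⟨i, hi, u1, u2⟩ := find_iv lamb m r (by rwa [b0]) (by rw [b1]; linarith)
    obtain ⟨i', hi', v1, v2⟩ := find_iv lamb m r' (by rw [b0]; linarith) (by rwa [b1])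
    rw [bv i hi _ u1 u2, bv i' hi' _ v1 v2]
    refine san _ _ (by omega) ?_ (by omega)
    by_contra hc
    have := bm (i'+1) i (by omega) hi.le; linarith
  have sbp : ∀ r, 0 < r → r ≤ 1 → 0 < sigbar r := fun r h0 h1 => by
    obtain ⟨i, hi, u1, u2⟩ := find_iv lamb m r (by rwa [b0]) (by rwa [b1])
    rw [bv i hi _ u1 u2]; exact sbpos _ (Finset.mem_Icc.2 ⟨by omega, hi⟩)
  have tpos : ∀ k, k < K → 0 < t (k+1) := fun k hk => (ht.nn k).trans_lt (hs k hk)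
  have fi := (pτ K le_rfl).1
  have gi := (pb K le_rfl).1
  rw [ht.zero, ht.one K le_rfl] at fi gi
  have hfC : ∃ C, ∀ s, 0 < s → s ≤ 1 → 0 ≤ (fun s => stepFn M sigv lamv s ^ 2) s ∧ (fun s => stepFn M sigv lamv s ^ 2) s ≤ C := by
    refine ⟨∑ i ∈ Finset.range M, sigv (i+1) ^ 2, fun s h0 h1 => ⟨sq_nonneg _, ?_⟩⟩
    obtain ⟨i, hi, u1, u2⟩ := find_iv lamv M s (by rwa [l0]) (by rwa [l1])
    simp only [sv i hi s u1 u2]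
    exact Finset.single_le_sum (f := fun i => sigv (i+1) ^ 2) (fun j _ => sq_nonneg _) (Finset.mem_range.2 hi)
  obtain ⟨C, hfC⟩ := hfC
  obtain ⟨H1, H2, H3⟩ := hull_facts fi gi hfC hull
  have eτ : ∀ k ≤ K, ∑ j ∈ Finset.range k, τ j ^ 2 * (t (j+1) - t j) = Jint (fun s => stepFn M sigv lamv s ^ 2) (t k) := fun k hk => by
    rw [← (pτ k hk).2, Jint, ht.zero]
  have eb : ∀ k ≤ K, ∑ j ∈ Finset.range k, sb j ^ 2 * (t (j+1) - t j) = Jint (fun s => sigbar s ^ 2) (t k) := fun k hk => by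
    rw [← (pb k hk).2, Jint, ht.zero]
  set y : ℕ → ℝ := fun k => if k < K then min β (2 / sb k) else β with hy
  obtain ⟨c1, c2⟩ := cert_of (τ := τ) (sb := sb) hβ ht hs hK (fun k hk => sbp _ (tpos k hk) (ht.le1 _))
    (fun k hk => sban _ _ (tpos k (by omega)) (ht.mono (by omega)) (ht.le1 _))
    (fun k hk => by rw [eτ k hk, eb k hk]; exact H1 _ (ht.nn k) (ht.le1 k))
    (by rw [eτ K le_rfl, eb K le_rfl, ht.one K le_rfl, H2])
    (fun k hk hne => by
      rw [eτ _ hk.le, eb _ hk.le]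
      obtain ⟨i, hi, u1, u2, u3⟩ := sbi k (by omega)
      have hlt1 : t (k+1) < 1 := (hs _ hk).trans_le (ht.le1 _)
      have heq : t (k+1) = lamb (i+1) := by
        by_contra hc
        have hlt := lt_of_le_of_ne u2 hc
        obtain ⟨k', hk', e'⟩ := hb (i+1) hi
        have : k + 2 ≤ k' := by
          by_contra h'
          have := ht.mono (show k' ≤ k+1 by omega); linarith
        have h2 : t (k+2) ≤ lamb (i+1) := e' ▸ ht.mono this
        exact hne (by rw [u3]; exact bv i hi _ (u1.trans (hs _ hk)) h2)
      have him : i + 1 < m := by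
        by_contra hc
        have : i + 1 = m := by omega
        rw [this, b1] at heq; linarith
      have q1 := sbpos (i+1) (Finset.mem_Icc.2 ⟨by omega, by omega⟩)
      have q2 := sbpos (i+2) (Finset.mem_Icc.2 ⟨by omega, by omega⟩)
      refine H3 (t (k+1)) (sigb (i+1) ^ 2) (sigb (i+2) ^ 2) (tpos k (by omega)) hlt1 (sq_nonneg _) ?_ ?_ ?_
      · exact pow_lt_pow_left₀ (santi (i+1) (by omega) him) q2.le (by norm_num)
      · intro r h0 h1
        have := sban r _ h0 h1 hlt1.le
        rw [← u3]
        exact pow_le_pow_left₀ (sbp _ (tpos k (by omega)) hlt1.le).le this _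
      · intro r h0 h1
        have r0 := (tpos k (by omega)).trans h0
        obtain ⟨i', hi', v1, v2⟩ := find_iv lamb m r (by rwa [b0]) (by rwa [b1])
        simp only [bv i' hi' _ v1 v2]
        refine pow_le_pow_left₀ (sbpos _ (Finset.mem_Icc.2 ⟨by omega, hi'⟩)).le (san _ _ (by omega) ?_ (by omega)) _
        by_contra hc
        have := bm (i'+1) (i+1) (by omega) (by omega); linarith)
    y hy
  refine ⟨K, t, τ, y, c1, hs, hK, ?_, ?_, τi, ?_, ?_, ?_⟩
  · intro k hk
    have hk1 : t k < 1 := (hs k hk).trans_le (ht.le1 _)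
    have f0 := Nat.floor_le (mul_nonneg nR.le (ht.nn k))
    have f1 := Nat.lt_floor_add_one ((n:ℝ) * t k)
    have f2 : ⌊(n:ℝ) * t k⌋₊ < n := by
      have : (⌊(n:ℝ) * t k⌋₊ : ℝ) < n := by nlinarith
      exact_mod_cast this
    obtain ⟨k', hk', e⟩ := hg (⌊(n:ℝ) * t k⌋₊ + 1) f2
    have g1 : t k < t k' := by rw [e, lt_div_iff₀ nR]; push_cast; linarith
    have g2 : k + 1 ≤ k' := by
      by_contra hc
      have := ht.mono (show k' ≤ k by omega); linarith
    refine (ht.mono g2).trans ?_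
    rw [e, div_le_iff₀ nR, add_mul, one_div, inv_mul_cancel₀ nR.ne']; push_cast; linarith
  · obtain ⟨k, hk, e⟩ := hS a (Or.inr rfl)
    refine ⟨k, lt_of_le_of_ne hk ?_, e⟩
    rintro rfl
    rw [ht.one k le_rfl] at e; linarith
  · intro k hk
    simp only [hy, if_pos hk]
    refine ⟨min_le_min le_rfl ?_, min_le_left _ _⟩
    obtain ⟨i, hi, -, -, u3⟩ := sbi k hk
    rw [u3]
    have := san 1 (i+1) le_rfl (by omega) hi
    have := sbpos (i+1) (Finset.mem_Icc.2 ⟨by omega, hi⟩)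
    gcongr
  · rw [c2, fpsi_eq hm santi sbpos]
    congr 1
    exact refine_sum ht hs lamb (fun i => if β ≤ 2 / sigb (i+1) then 1 + β^2 / (2 / sigb (i+1))^2 else 2 * β / (2 / sigb (i+1)))
      (fun s => if β ≤ 2 / sigbar s then 1 + β^2 / (2 / sigbar s)^2 else 2 * β / (2 / sigbar s)) id m b0 bi hb
      (fun i hi s h1 h2 => by simp only [bv i hi s h1 h2]) K le_rfl (by rw [ht.one K le_rfl, b1])
  · intro Φ
    rw [Icc_sum]
    exact (refine_sum ht hs lamv (fun i => sigv (i+1)) (stepFn M sigv lamv) Φ M l0 li hl sv K le_rfl (by rw [ht.one K le_rfl, l1])).symm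

noncomputable def pk (N M : ℕ) (sigv lamv : ℕ → ℝ) (v : Vtx) : Vtx → ℝ := fun z =>
  ∑ i ∈ Finset.Icc 1 M, sigv i * (gr (Ik N (lamv (i-1)) v) v z - gr (Ik N (lamv i) v) v z)
noncomputable def Zx (N M : ℕ) (sigv lamv : ℕ → ℝ) (β ρ : ℝ) (ω : FieldSp) : ℝ :=
  ∑ v ∈ AN N ρ, Real.exp (β * xi N (pk N M sigv lamv v) ω)

lemma psi_ae {N : ℕ} {P : Measure FieldSp} (h : IsGFF N P) (M : ℕ) (sigv lamv : ℕ → ℝ) {v : Vtx} (hv : v ∈ VN N) :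
    psiFld N M sigv lamv P v =ᵐ[P] xi N (pk N M sigv lamv v) := by
  have : ∀ᵐ ω ∂P, ∀ i ∈ Finset.range (M+1), phiScale N P v (lamv i) ω = ω v - xi N (gr (intr (nbhd N (lamv i) v)) v) ω :=
    (Filter.eventually_all_finset _).2 fun i _ => phiScale_eq h hv (lamv i)
  filter_upwards [this] with ω hω
  unfold pk
  rw [xi_sum, psiFld]
  refine Finset.sum_congr rfl fun i hi => ?_
  rw [Finset.mem_Icc] at hi
  rw [hω i (Finset.mem_range.2 (by omega)), hω (i-1) (Finset.mem_range.2 (by omega)), xi_sub, Ik, Ik]; ring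

lemma sum_lt_K (f : ℕ → ℝ) {n K : ℕ} (h : n ≤ K) : ∑ j ∈ Finset.range n, f j = ∑ j ∈ Finset.range K, if j < n then f j else 0 := by
  rw [← Finset.sum_filter]
  refine Finset.sum_congr ?_ fun _ _ => rfl
  ext j; simp only [Finset.mem_range, Finset.mem_filter]; omega

lemma Z_bounds {M : ℕ} {sigv lamv : ℕ → ℝ} (hp : ScaleParams M sigv lamv) {m : ℕ} {sigb lamb : ℕ → ℝ} {sigbar : ℝ → ℝ}
    (he : EffParams M sigv lamv m sigb lamb sigbar) {P : ℕ → Measure FieldSp} (hP : ∀ N, IsGFF N (P N))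
    {β : ℝ} (hβ : 0 < β) {ρ : ℝ} (hρ : 0 < ρ) {ε : ℝ} (hε : 0 < ε) :
    Whp P (fun N => {ω | Real.exp ((2 * fpsiLim m sigb lamb β - ε) * Real.log N) ≤ Zx N M sigv lamv β ρ ω ∧
      Zx N M sigv lamv β ρ ω ≤ Real.exp ((2 * fpsiLim m sigb lamb β + ε) * Real.log N)}) := by
  have hM : (Finset.Icc 1 M).Nonempty := ⟨1, Finset.mem_Icc.2 ⟨le_rfl, hp.1⟩⟩
  obtain ⟨i1, hi1, m1⟩ := Finset.exists_min_image _ (fun i => sigv i ^ 2) hM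
  obtain ⟨i2, hi2, m2⟩ := Finset.exists_max_image _ (fun i => sigv i ^ 2) hM
  have p1 : 0 < sigv i1 ^ 2 := by have := hp.2.1 i1 hi1; positivity
  have p2 : 0 < sigv i2 ^ 2 := by have := hp.2.1 i2 hi2; positivity
  set s1 := sigv i1 ^ 2
  set s2 := sigv i2 ^ 2
  have sb1 : 0 < sigb 1 := he.2.2.2.2.2.2.1 1 (Finset.mem_Icc.2 ⟨le_rfl, he.1⟩)
  set Y := min β (2 / sigb 1) with hY
  have pY : 0 < Y := by positivity
  set a := min (1/2) (ε / (2 * (β^2 * s2))) with hadef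
  have a0 : 0 < a := by positivity
  have a1 : a < 1 := (min_le_left _ _).trans_lt (by norm_num)
  have a2 : β^2 * s2 * a ≤ ε / 2 := by
    have : a ≤ ε / (2 * (β^2 * s2)) := min_le_right _ _
    rw [le_div_iff₀ (by positivity)] at this; linarith
  obtain ⟨n, hn⟩ := exists_nat_gt (4 / (s1 * Y^2 * a))
  have c0 : 0 < s1 * Y^2 * a := by positivity
  have n0 : (0:ℝ) < n := lt_trans (by positivity) hn
  have hn' : 2 * (1 / (n:ℝ)) < s1 * Y^2 * a / 2 := by
    rw [div_lt_iff₀ c0] at hn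
    rw [mul_one_div, div_lt_iff₀ n0]; linarith
  obtain ⟨K, t, τ, y, H, hs, hK, mesh, ⟨κ, hκ, tκ⟩, hτ, hy, val, hΦ⟩ := cert_exists hp he hβ a0 a1 (n := n) (by exact_mod_cast n0)
  have hker : ∀ N v, pk N M sigv lamv v = ker N τ t K v := fun N v => by
    funext z
    have := hΦ (fun s => - gr (Ik N s v) v z)
    rw [pk, _root_.ker]
    convert this using 1
    · exact Finset.sum_congr rfl fun i _ => by ring
    · exact Finset.sum_congr rfl fun i _ => by ring
  have yb : ∀ k < K, 0 < y k := fun k hk => pY.trans_le (hy k hk).1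
  have τ1 : ∀ k < K, s1 ≤ τ k ^ 2 ∧ τ k ^ 2 ≤ s2 ∧ 0 < τ k := fun k hk => by
    obtain ⟨i, hi, e⟩ := hτ k hk
    rw [e]; exact ⟨m1 i hi, m2 i hi, hp.2.1 i hi⟩
  set θ : ℕ → ℝ := fun k => if κ ≤ k ∧ k < K then τ k * y k else 0 with hθ
  have ht := H.grid
  have Fκ : s1 * Y^2 * a ≤ ∑ j ∈ Finset.range κ, y j * bb t τ y j := by
    have : s1 * Y^2 * a = ∑ j ∈ Finset.range κ, s1 * Y^2 * (t (j+1) - t j) := by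
      rw [← Finset.mul_sum, Finset.sum_range_sub, ht.zero, tκ, sub_zero]
    rw [this]
    refine Finset.sum_le_sum fun j hj => ?_
    have hj := (Finset.mem_range.1 hj).trans hκ
    rw [bb, show y j * (y j * (τ j ^ 2 * (t (j+1) - t j))) = τ j ^ 2 * y j ^ 2 * (t (j+1) - t j) by ring]
    have := (τ1 j hj).1; have := (hy j hj).1; have := hs j hj
    exact mul_le_mul_of_nonneg_right (by gcongr) (by linarith)
  have hbn : ∀ j < K, 0 ≤ y j * bb t τ y j := fun j hj => mul_nonneg (yb j hj).le (H.bnn j hj.le)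
  have lw := lower hP ht hs hK hρ τ (θ := θ) (fun j => by
      simp only [hθ]; split_ifs with h
      · exact (mul_pos (τ1 j h.2).2.2 (yb j h.2)).le
      · exact le_rfl) hβ (fun k hk hB => by
      have hκk : κ ≤ k := by
        obtain ⟨j, hj, hjK, hne⟩ := hB
        by_contra hc
        apply hne; simp only [hθ]; rw [if_neg (by omega)]
      have h1 : Xk K t θ 0 k + (∑ j ∈ Finset.range κ, y j * bb t τ y j) / 2 ≤ (∑ j ∈ Finset.range (min (k+1) K), y j * bb t τ y j) / 2 := by
        rw [sum_lt_K _ hκ.le, sum_lt_K _ (min_le_right (k+1) K), Xk, Finset.sum_div, Finset.sum_div, ← Finset.sum_add_distrib]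
        refine Finset.sum_le_sum fun j hj => ?_
        have hj := Finset.mem_range.1 hj
        have := hbn j hj
        by_cases c1 : j < κ
        · rw [if_pos c1, if_pos (by omega), if_pos (by omega)]
          simp only [hθ]; rw [if_neg (by omega)]; simp
        · rw [if_neg c1]
          by_cases c2 : j ≤ k
          · rw [if_pos c2, if_pos (by omega)]
            simp only [hθ]; rw [if_pos (by omega), bb]; apply le_of_eq; ring
          · rw [if_neg c2, if_neg (by omega)]; simp
      have h2 := H.feas _ (min_le_right (k+1) K)
      have h3 : t (min (k+1) K) ≤ t k + 1 / n := by
        rcases eq_or_lt_of_le hk with rfl | hlt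
        · rw [min_eq_right (by omega)]; linarith [show 0 < 1 / (n:ℝ) by positivity]
        · rw [min_eq_left (by omega)]; exact mesh k hlt
      linarith) (half_pos hε)
  have up := upper hP H hε
  refine lw.mono2 up ?_
  filter_upwards [eventually_ge_atTop 1] with N hN ω ⟨w1, w2⟩
  have hL : 0 ≤ Real.log N := Real.log_nonneg (by exact_mod_cast hN)
  simp only [Set.mem_ofPred_eq] at w1 w2 ⊢
  simp only [Zx, hker]
  constructor
  · refine le_trans (Real.exp_le_exp.2 (mul_le_mul_of_nonneg_right ?_ hL)) w1
    have : ∑ j ∈ Finset.range K, (β * bb t τ y j - y j * bb t τ y j / 2) ≤ ∑ j ∈ Finset.range K, (β * τ j * θ j - θ j ^ 2 / 2) * (t (j+1) - t j) +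
        ∑ j ∈ Finset.range κ, β^2 * s2 * (t (j+1) - t j) := by
      rw [sum_lt_K _ hκ.le, ← Finset.sum_add_distrib]
      refine Finset.sum_le_sum fun j hj => ?_
      have hj := Finset.mem_range.1 hj
      have hd := hs j hj
      by_cases c1 : j < κ
      · rw [if_pos c1]
        simp only [hθ]; rw [if_neg (by omega)]
        have := hbn j hj
        have b2 : bb t τ y j ≤ β * (s2 * (t (j+1) - t j)) := by
          rw [bb]
          have := (τ1 j hj).2.1; have := (hy j hj).2
          have : 0 ≤ t (j+1) - t j := by linarith
          gcongr
        have := mul_le_mul_of_nonneg_left b2 hβ.le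
        nlinarith
      · rw [if_neg c1]
        simp only [hθ]; rw [if_pos (by omega), bb]; apply le_of_eq; ring
    rw [← Finset.mul_sum, Finset.sum_range_sub, ht.zero, tκ, sub_zero, Finset.sum_sub_distrib, ← Finset.mul_sum, ← Finset.sum_div] at this
    linarith
  · rw [← val]
    exact le_trans (Finset.sum_le_sum_of_subset_of_nonneg (Finset.filter_subset _ _) fun _ _ _ => (Real.exp_pos _).le) w2

lemma Lp_of {P : ℕ → Measure FieldSp} (hP : ∀ N, IsProbabilityMeasure (P N)) {X : ℕ → FieldSp → ℝ} {c p D : ℝ} (hp : 1 ≤ p)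
    (hm : ∀ N, Measurable (X N)) (hpr : TendstoInProb P X c) (hD : 0 ≤ D)
    (hb : ∀ᶠ N in atTop, Integrable (fun ω => Real.exp |X N ω - c|) (P N) ∧ ∫ ω, Real.exp |X N ω - c| ∂(P N) ≤ D) :
    TendstoLp P X p c := by
  have p0 : 0 < p := by linarith
  have hR : ∀ x : ℝ, 0 ≤ x → x ^ (2*p) ≤ (2*p) ^ (2*p) * Real.exp x := fun x hx => by
    have h1 : x ≤ 2*p * Real.exp (x / (2*p)) := by
      have := Real.add_one_le_exp (x / (2*p))
      have : x / (2*p) ≤ Real.exp (x / (2*p)) := by linarith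
      rw [div_le_iff₀ (by positivity)] at this; linarith
    refine (Real.rpow_le_rpow hx h1 (by positivity)).trans (le_of_eq ?_)
    rw [Real.mul_rpow (by positivity) (by positivity), ← Real.exp_mul, div_mul_cancel₀ _ (by positivity)]
  set R := (2*p) ^ (2*p)
  have R0 : 0 < R := by positivity
  have nn : ∀ N, 0 ≤ ∫ ω, |X N ω - c| ^ p ∂(P N) := fun N => integral_nonneg fun ω => by positivity
  rw [TendstoLp, Metric.tendsto_atTop']
  intro e he
  set η := e / 4 with hη
  have η0 : 0 < η := by positivity
  set δ := η / (R * D + 1) with hδ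
  have δ0 : 0 < δ := by positivity
  have hδ2 : δ * R * D ≤ η := by
    rw [hδ, mul_assoc, div_mul_eq_mul_div, div_le_iff₀ (by positivity)]; nlinarith [mul_nonneg R0.le hD]
  set s := η ^ (1/p) with hs
  have s0 : 0 < s := by positivity
  have ev := (ENNReal.tendsto_toReal ENNReal.zero_ne_top).comp (hpr s s0)
  have ev2 := ev.eventually_lt_const (show ENNReal.toReal 0 < δ * η by simp; positivity)
  obtain ⟨N0, hN0⟩ := eventually_atTop.1 (hb.and ev2)
  refine ⟨N0, fun N hN => ?_⟩
  obtain ⟨⟨i1, i2⟩, i3⟩ := hN0 N hN.le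
  have := hP N
  set B := {ω | s < |X N ω - c|}
  have mB : MeasurableSet B := measurableSet_lt measurable_const ((hm N).sub_const c).abs
  have key : ∫ ω, |X N ω - c| ^ p ∂(P N) ≤ ∫ ω, (η + δ * R * Real.exp |X N ω - c| + δ⁻¹ * B.indicator (fun _ => (1:ℝ)) ω) ∂(P N) := by
    refine integral_mono_of_nonneg (Eventually.of_forall fun ω => by positivity) ?_ (Eventually.of_forall fun ω => ?_)
    · exact ((integrable_const _).add (i1.const_mul _)).add (((integrable_const _).indicator mB).const_mul _)
    · show |X N ω - c| ^ p ≤ η + δ * R * Real.exp |X N ω - c| + δ⁻¹ * B.indicator (fun _ => (1:ℝ)) ω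
      set x := |X N ω - c| with hx
      have x0 : 0 ≤ x := abs_nonneg _
      have ex := Real.exp_pos x
      by_cases hB : ω ∈ B
      · rw [Set.indicator_of_mem hB]
        have h1 := hR x x0
        rw [two_mul p, Real.rpow_add_of_nonneg x0 p0.le p0.le] at h1
        set u := x ^ p
        have h2 : u ≤ δ * (u * u) + δ⁻¹ := by
          have e1 : δ * δ⁻¹ = 1 := mul_inv_cancel₀ δ0.ne'
          have : 0 < δ⁻¹ := inv_pos.2 δ0
          nlinarith [mul_nonneg δ0.le (sq_nonneg (u - δ⁻¹)), mul_nonneg δ0.le (sq_nonneg u)]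
        have := mul_le_mul_of_nonneg_left h1 δ0.le
        nlinarith
      · rw [Set.indicator_of_notMem hB]
        have hle : x ≤ s := not_lt.1 hB
        have : x ^ p ≤ η := by
          refine (Real.rpow_le_rpow x0 hle p0.le).trans (le_of_eq ?_)
          rw [hs, ← Real.rpow_mul η0.le, one_div, inv_mul_cancel₀ p0.ne', Real.rpow_one]
        have : 0 < δ * R * Real.exp x := by positivity
        linarith
  have e2 : ∫ ω, (η + δ * R * Real.exp |X N ω - c| + δ⁻¹ * B.indicator (fun _ => (1:ℝ)) ω) ∂(P N) =
      η + δ * R * ∫ ω, Real.exp |X N ω - c| ∂(P N) + δ⁻¹ * (P N B).toReal := by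
    have j1 : Integrable (fun ω => η + δ * R * Real.exp |X N ω - c|) (P N) := (integrable_const _).add (i1.const_mul _)
    rw [integral_add j1 (((integrable_const _).indicator mB).const_mul _),
      integral_add (integrable_const _) (i1.const_mul _), integral_const_mul, integral_const_mul, integral_indicator_const _ mB]
    simp [Measure.real]
  rw [e2] at key
  have k2 : δ * R * ∫ ω, Real.exp |X N ω - c| ∂(P N) ≤ η := (mul_le_mul_of_nonneg_left i2 (by positivity)).trans hδ2
  have k3 : δ⁻¹ * (P N B).toReal ≤ η := by
    rw [inv_mul_le_iff₀ δ0]; exact i3.le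
  rw [Real.dist_eq, sub_zero, abs_of_nonneg (nn N)]
  linarith

lemma exp_q {q x : ℝ} (h0 : 0 ≤ q) (h1 : q ≤ 1) : Real.exp (q * x) ≤ 1 + Real.exp x := by
  rcases le_total x 0 with h | h
  · have : Real.exp (q * x) ≤ 1 := Real.exp_le_one_iff.2 (mul_nonpos_of_nonneg_of_nonpos h0 h)
    have := Real.exp_pos x; linarith
  · have : Real.exp (q * x) ≤ Real.exp x := Real.exp_le_exp.2 (by nlinarith)
    linarith

lemma mom {M : ℕ} {sigv lamv : ℕ → ℝ} {P : ℕ → Measure FieldSp} (hP : ∀ N, IsGFF N (P N)) {β ρ : ℝ} {K : ℕ} {t τ : ℕ → ℝ} (ht : Grid K t)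
    (hker : ∀ N v, pk N M sigv lamv v = ker N τ t K v) (hne : ∀ᶠ N in atTop, (AN N ρ).Nonempty) (c : ℝ) :
    ∃ D : ℝ, 0 ≤ D ∧ ∀ᶠ N : ℕ in atTop, Integrable (fun ω => Real.exp |(Real.log ((N:ℝ)^2))⁻¹ * Real.log (Zx N M sigv lamv β ρ ω) - c|) (P N) ∧
      ∫ ω, Real.exp |(Real.log ((N:ℝ)^2))⁻¹ * Real.log (Zx N M sigv lamv β ρ ω) - c| ∂(P N) ≤ D := by
  set A := ∑ k ∈ Finset.range K, τ k ^ 2 * (t (k+1) - t k) with hA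
  set B := 2 * C2 * ∑ k ∈ Finset.range K, τ k ^ 2 with hB
  have A0 : 0 ≤ A := Finset.sum_nonneg fun k _ => mul_nonneg (sq_nonneg _) (sub_nonneg.2 (ht.mono (Nat.le_succ k)))
  have B0 : 0 ≤ B := mul_nonneg (mul_nonneg two_pos.le C2_nonneg) (Finset.sum_nonneg fun k _ => sq_nonneg _)
  set C := 1 + β^2 * A / 4 with hC
  set E := Real.exp (β^2 * (A + B) / 2) with hE
  refine ⟨Real.exp |c| * (Real.exp C * (1 + 4 * E) + E), by positivity, ?_⟩
  filter_upwards [hne, eventually_ge_atTop 1, logN_top.eventually_ge_atTop 1] with N ⟨v0, hv0⟩ hN hL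
  have h := hP N
  have := h.1
  set L := Real.log N with hLdef
  have sub : ∀ v ∈ AN N ρ, v ∈ VN N := fun v hv => (Finset.filter_subset _ _) hv
  have elog : Real.log ((N:ℝ)^2) = 2 * L := by rw [Real.log_pow]; norm_num [hLdef]
  set q := (2 * L)⁻¹ with hq
  have q0 : 0 < q := by positivity
  have qL : q * (2 * L) = 1 := inv_mul_cancel₀ (by positivity)
  have q1 : q ≤ 1 := by nlinarith
  have mgf : ∀ v ∈ AN N ρ, ∀ b : ℝ, Integrable (fun ω => Real.exp (b * xi N (pk N M sigv lamv v) ω)) (P N) ∧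
      ∫ ω, Real.exp (b * xi N (pk N M sigv lamv v) ω) ∂(P N) ≤ Real.exp (b^2 * (A * L + B) / 2) := fun v hv b => by
    have hk : ∀ x ∉ intr (VN N), (fun z => b * pk N M sigv lamv v z) x = 0 := fun x hx => by
      simp only [hker, ker_supp (sub v hv) x hx, mul_zero]
    have := xi_mgf h hk
    simp only [xi_smul, Cv_smul] at this
    refine ⟨this.1, this.2.le.trans (Real.exp_le_exp.2 ?_)⟩
    have hv := ker_var_le hN ht τ K (sub v hv)
    rw [← hker] at hv
    have := mul_le_mul_of_nonneg_left hv (sq_nonneg b)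
    linarith
  set Z := Zx N M sigv lamv β ρ with hZ
  have Zint : Integrable Z (P N) := by
    simp only [hZ]; unfold Zx
    exact integrable_finsetSum _ fun v hv => (mgf v hv β).1
  have EZ : ∫ ω, Z ω ∂(P N) ≤ 4 * E * Real.exp (2 * C * L) := by
    simp only [hZ]; unfold Zx
    rw [integral_finsetSum _ fun v hv => (mgf v hv β).1]
    refine (Finset.sum_le_sum fun v hv => (mgf v hv β).2).trans ?_
    rw [Finset.sum_const, nsmul_eq_mul]
    have hc : ((AN N ρ).card:ℝ) ≤ 4 * Real.exp (2 * L) := card_filter_VN hN _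
    have h2 : Real.exp (β^2 * (A * L + B) / 2) ≤ E * Real.exp (β^2 * A / 2 * L) := by
      rw [hE, ← Real.exp_add, Real.exp_le_exp]
      nlinarith [mul_nonneg (sq_nonneg β) A0]
    refine (mul_le_mul hc h2 (Real.exp_pos _).le (by positivity)).trans (le_of_eq ?_)
    rw [show 2 * C * L = 2 * L + β^2 * A / 2 * L by rw [hC]; ring, Real.exp_add]; ring
  have Zlow : ∀ ω, Real.exp (β * xi N (pk N M sigv lamv v0) ω) ≤ Z ω := fun ω =>
    Finset.single_le_sum (f := fun v => Real.exp (β * xi N (pk N M sigv lamv v) ω)) (fun _ _ => (Real.exp_pos _).le) hv0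
  have mZ : Measurable Z := by
    simp only [hZ]; unfold Zx
    exact Finset.measurable_sum _ fun v _ => ((xi_meas N _).const_mul β).exp
  have pw : ∀ ω, Real.exp |q * Real.log (Z ω) - c| ≤ Real.exp |c| * (Real.exp C * (1 + Real.exp (-(2 * C * L)) * Z ω) +
      Real.exp (-(q * β) * xi N (pk N M sigv lamv v0) ω)) := fun ω => by
    have Zp : 0 < Z ω := (Real.exp_pos _).trans_le (Zlow ω)
    have u1 : Real.exp (q * Real.log (Z ω)) ≤ Real.exp C * (1 + Real.exp (-(2 * C * L)) * Z ω) := by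
      have := exp_q (x := Real.log (Z ω) - 2 * C * L) q0.le q1
      rw [mul_sub, show q * (2 * C * L) = C by linear_combination C * qL, Real.exp_sub _ C, sub_eq_add_neg, Real.exp_add (Real.log (Z ω)), Real.exp_log Zp, div_le_iff₀ (Real.exp_pos _)] at this
      linarith
    have u2 : Real.exp (-(q * Real.log (Z ω))) ≤ Real.exp (-(q * β) * xi N (pk N M sigv lamv v0) ω) := by
      rw [Real.exp_le_exp]
      have : β * xi N (pk N M sigv lamv v0) ω ≤ Real.log (Z ω) := (Real.le_log_iff_exp_le Zp).2 (Zlow ω)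
      nlinarith
    have u3 : Real.exp |q * Real.log (Z ω)| ≤ Real.exp (q * Real.log (Z ω)) + Real.exp (-(q * Real.log (Z ω))) := Real.exp_abs_le _
    have u4 : Real.exp |q * Real.log (Z ω) - c| ≤ Real.exp |c| * Real.exp |q * Real.log (Z ω)| := by
      rw [← Real.exp_add, Real.exp_le_exp]
      have := abs_sub (q * Real.log (Z ω)) c
      linarith
    exact u4.trans (mul_le_mul_of_nonneg_left (by linarith) (Real.exp_pos _).le)
  have gi : Integrable (fun ω => Real.exp |c| * (Real.exp C * (1 + Real.exp (-(2 * C * L)) * Z ω) +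
      Real.exp (-(q * β) * xi N (pk N M sigv lamv v0) ω))) (P N) :=
    ((((integrable_const _).add (Zint.const_mul _)).const_mul _).add (mgf v0 hv0 (-(q*β))).1).const_mul _
  simp only [elog]
  refine ⟨gi.mono' ((((mZ.log.const_mul q).sub_const c).abs.exp).aestronglyMeasurable) (Eventually.of_forall fun ω => ?_), ?_⟩
  · rw [Real.norm_eq_abs, abs_of_pos (Real.exp_pos _)]; exact pw ω
  · refine (integral_mono_of_nonneg (Eventually.of_forall fun ω => (Real.exp_pos _).le) gi (Eventually.of_forall pw)).trans ?_
    have j1 : Integrable (fun ω => 1 + Real.exp (-(2 * C * L)) * Z ω) (P N) := (integrable_const _).add (Zint.const_mul _)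
    rw [integral_const_mul, integral_add (j1.const_mul _) (mgf v0 hv0 (-(q*β))).1, integral_const_mul,
      integral_add (integrable_const _) (Zint.const_mul _), integral_const_mul]
    refine mul_le_mul_of_nonneg_left (add_le_add (mul_le_mul_of_nonneg_left (add_le_add (by simp) ?_) (Real.exp_pos _).le) ?_) (Real.exp_pos _).le
    · refine (mul_le_mul_of_nonneg_left EZ (Real.exp_pos _).le).trans (le_of_eq ?_)
      rw [Real.exp_neg, mul_comm (4 * E), inv_mul_cancel_left₀ (Real.exp_pos _).ne']
    · refine (mgf v0 hv0 (-(q*β))).2.trans (Real.exp_le_exp.2 ?_)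
      have a1 : q^2 * L ≤ 1 := by nlinarith
      have a2 : q^2 ≤ 1 := by nlinarith
      have a3 : q^2 * (A * L + B) ≤ A + B := by nlinarith [mul_le_mul_of_nonneg_left a1 A0, mul_le_mul_of_nonneg_left a2 B0]
      nlinarith [mul_le_mul_of_nonneg_left a3 (sq_nonneg β)]

/-- **Theorem (Limit of the free energy on `A_{N,ρ}`).**
For every `ρ ∈ (0,1]`, `f_{N,ρ}^ψ(β) = (log N²)⁻¹ log Σ_{v∈A_{N,ρ}} e^{βψ_v}` converges,
in probability and in `L^p` for every `1 ≤ p < ∞`, to `f^ψ(β)`. -/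
theorem free_energy_limit_AN
    (M : ℕ) (sigv lamv : ℕ → ℝ) (hparams : ScaleParams M sigv lamv)
    (m : ℕ) (sigb lamb : ℕ → ℝ) (sigbar : ℝ → ℝ)
    (heff : EffParams M sigv lamv m sigb lamb sigbar)
    (P : ℕ → MeasureTheory.Measure FieldSp) (hGFF : ∀ N, IsGFF N (P N))
    (β : ℝ) (hβ : 0 < β) (ρ : ℝ) (hρ0 : 0 < ρ) (hρ1 : ρ ≤ 1) :
    TendstoInProb P (fun N => freeEnergyRes N M sigv lamv (P N) β ρ)
      (fpsiLim m sigb lamb β) ∧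
    ∀ p : ℝ, 1 ≤ p →
      TendstoLp P (fun N => freeEnergyRes N M sigv lamv (P N) β ρ) p
        (fpsiLim m sigb lamb β) := by
  have hp0 : ∀ N, IsProbabilityMeasure (P N) := fun N => (hGFF N).1
  set c := fpsiLim m sigb lamb β with hc
  set X : ℕ → FieldSp → ℝ := fun N ω => (Real.log ((N:ℝ)^2))⁻¹ * Real.log (Zx N M sigv lamv β ρ ω) with hX
  have ae : ∀ N, ∀ᵐ ω ∂(P N), freeEnergyRes N M sigv lamv (P N) β ρ ω = X N ω := fun N => by
    have : ∀ᵐ ω ∂(P N), ∀ v ∈ AN N ρ, psiFld N M sigv lamv (P N) v ω = xi N (pk N M sigv lamv v) ω :=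
      (Filter.eventually_all_finset _).2 fun v hv => psi_ae (hGFF N) M sigv lamv ((Finset.filter_subset _ _) hv)
    filter_upwards [this] with ω hω
    simp only [freeEnergyRes, hX, ZNres, Zx]
    congr 2
    exact Finset.sum_congr rfl fun v hv => by rw [hω v hv]
  have hprob : TendstoInProb P X c := fun ε hε => by
    refine tendsto_of_tendsto_of_tendsto_of_le_of_le' tendsto_const_nhds (Z_bounds hparams heff hGFF hβ hρ0 hε)
      (Eventually.of_forall fun N => zero_le) ?_
    filter_upwards [logN_top.eventually_ge_atTop 1] with N hL
    refine measure_mono fun ω hω hb => ?_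
    obtain ⟨b1, b2⟩ := hb
    have hω : ε < |X N ω - c| := hω
    have Zp := (Real.exp_pos _).trans_le b1
    rw [← Real.le_log_iff_exp_le Zp] at b1
    rw [← Real.log_le_iff_le_exp Zp] at b2
    have elog : Real.log ((N:ℝ)^2) = 2 * Real.log N := by rw [Real.log_pow]; norm_num
    have : |X N ω - c| ≤ ε := by
      simp only [hX, elog]
      rw [inv_mul_eq_div, abs_le]
      constructor
      · rw [le_sub_iff_add_le, le_div_iff₀ (by positivity)]; nlinarith
      · rw [sub_le_iff_le_add, div_le_iff₀ (by positivity)]; nlinarith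
    linarith
  refine ⟨fun ε hε => ?_, fun p hp => ?_⟩
  · refine (hprob ε hε).congr fun N => measure_congr ?_
    filter_upwards [ae N] with ω hω
    apply propext
    show ε < |X N ω - c| ↔ ε < |freeEnergyRes N M sigv lamv (P N) β ρ ω - c|
    rw [hω]
  · obtain ⟨K, t, τ, y, H, hs, hK, -, -, -, -, -, hΦ⟩ := cert_exists hparams heff hβ (a := 1/2) (by norm_num) (by norm_num) (n := 1) le_rfl
    have hker : ∀ N v, pk N M sigv lamv v = _root_.ker N τ t K v := fun N v => by
      funext z
      have := hΦ (fun s => - gr (Ik N s v) v z)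
      rw [pk, _root_.ker]
      convert this using 1
      · exact Finset.sum_congr rfl fun i _ => by ring
      · exact Finset.sum_congr rfl fun i _ => by ring
    have hne : ∀ᶠ N in atTop, (AN N ρ).Nonempty := by
      filter_upwards [geo_ev hGFF H.grid hs hK hρ0] with N hg
      refine Finset.Nonempty.mono hg.sub ?_
      by_contra hc
      rw [Finset.not_nonempty_iff_eq_empty] at hc
      have := hg.card
      rw [hc] at this
      have h2 := Real.exp_pos (2 * Real.log N)
      simp only [Finset.card_empty, Nat.cast_zero, mul_zero] at this
      linarith
    obtain ⟨D, hD, hb⟩ := mom (β := β) hGFF H.grid hker hne c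
    have hLp : TendstoLp P X p c := Lp_of hp0 hp (fun N => by
      simp only [hX]; unfold Zx
      exact ((Finset.measurable_sum _ fun v _ => ((xi_meas N _).const_mul β).exp).log).const_mul _) hprob hD hb
    refine hLp.congr fun N => integral_congr_ae ?_
    filter_upwards [ae N] with ω hω
    rw [hω]
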